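/- arXiv:2302.05909 — 2 statements merged into one kernel-verified Lean document; each statement's English description precedes it below -/
import Mathlib

section
/- Every involutive commutative two-valued group is isomorphic to one of the following: (1) X^a_A, where A is an abelian group; (2) X^u_V × W, where V and W are Boolean groups and dim V ≥ 3; (3) Y_V × W, where V and W are Boolean groups and dim V ≥ 2. Two-valued groups from different series are never isomorphic to each other, and two two-valued groups both in series (2) or both in series (3) are isomorphic if and only if the corresponding Boolean groups V are isomorphic and simultaneously the corresponding Boolean groups W are isomorphic. -/
/-!
Two-valued groups after V.M. Buchstaber, A.P. Veselov and A.A. Gaifullin.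

`X.mul x y` is the two-element multiset `x * y`.
-/

universe u v w u' v' w'

/-- A two-valued group: a set with a multiplication valued in two-element multisets,
a strong identity `e`, and a (unique) inverse. -/
structure TwoValuedGroup (T : Type u) where
  mul : T → T → Multiset T
  e : T
  inv : T → T
  card_mul : ∀ x y, Multiset.card (mul x y) = 2
  assoc : ∀ x y z, (mul x y).bind (fun t => mul t z) = (mul y z).bind (fun t => mul x t)
  e_mul : ∀ x, mul e x = {x, x}
  mul_e : ∀ x, mul x e = {x, x}
  e_mem_mul_inv : ∀ x, e ∈ mul x (inv x)
  e_mem_inv_mul : ∀ x, e ∈ mul (inv x) x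
  inv_unique : ∀ x y, (e ∈ mul x y ∨ e ∈ mul y x) → y = inv x

namespace TwoValuedGroup

/-- Commutativity of a two-valued group. -/
def Commutative {T : Type u} (X : TwoValuedGroup T) : Prop := ∀ x y, X.mul x y = X.mul y x

/-- Involutivity: every element is its own inverse. -/
def Involutive {T : Type u} (X : TwoValuedGroup T) : Prop := ∀ x, X.inv x = x

/-- A homomorphism of two-valued groups. -/
def IsHom {T : Type u} {S : Type v} (X : TwoValuedGroup T) (Z : TwoValuedGroup S)
    (f : T → S) : Prop :=
  f X.e = Z.e ∧ ∀ x y, (X.mul x y).map f = Z.mul (f x) (f y)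

/-- Two two-valued groups are isomorphic if there is a bijective homomorphism. -/
def Isomorphic {T : Type u} {S : Type v} (X : TwoValuedGroup T) (Z : TwoValuedGroup S) : Prop :=
  ∃ f : T → S, Function.Bijective f ∧ IsHom X Z f

/-- A subgroup of a two-valued group: a subset closed under multiplication. -/
def IsSubgroup {T : Type u} (X : TwoValuedGroup T) (Y : Set T) : Prop :=
  ∀ y₁ ∈ Y, ∀ y₂ ∈ Y, ∀ z ∈ X.mul y₁ y₂, z ∈ Y

/-- `S` generates `X` if the only subgroup of `X` containing `S` is all of `X`. -/
def Generates {T : Type u} (X : TwoValuedGroup T) (S : Set T) : Prop :=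
  ∀ Y : Set T, X.IsSubgroup Y → S ⊆ Y → Y = Set.univ

/-- Finitely generated two-valued group. -/
def FinitelyGenerated {T : Type u} (X : TwoValuedGroup T) : Prop :=
  ∃ S : Set T, S.Finite ∧ X.Generates S

/-- A family of integer power sequences: `P x k` is the `k`-th power `x^k` of `x`;
these are uniquely determined in an involutive two-valued group. -/
def IsPowFamily {T : Type u} (X : TwoValuedGroup T) (P : T → ℤ → T) : Prop :=
  ∀ x : T, P x 0 = X.e ∧ P x 1 = x ∧ (∀ k : ℤ, P x (-k) = P x k) ∧
    ∀ k : ℤ, 1 ≤ k → X.mul x (P x k) = {P x (k - 1), P x (k + 1)}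

/-- The order of an element: the least positive `k` with `x^k = e`;
the value `0` encodes infinite order. -/
noncomputable def ordOf {T : Type u} (X : TwoValuedGroup T) (P : T → ℤ → T) (x : T) : ℕ :=
  sInf {n : ℕ | 0 < n ∧ P x (n : ℤ) = X.e}

/-- `ord x > 2` (where infinite order counts as `> 2`). -/
def OrdGT2 {T : Type u} (X : TwoValuedGroup T) (P : T → ℤ → T) (x : T) : Prop :=
  X.ordOf P x = 0 ∨ 2 < X.ordOf P x

/-- A two-valued group is special if it contains a special pair: `ord x > 2`, `ord y > 2`,
and `x * y` consists of two equal elements. -/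
def IsSpecial {T : Type u} (X : TwoValuedGroup T) (P : T → ℤ → T) : Prop :=
  ∃ x y z : T, X.OrdGT2 P x ∧ X.OrdGT2 P y ∧ X.mul x y = {z, z}

/-- `ι` is an involutive automorphism of the group `G`. -/
def IsInvolutiveAut (G : Type v) [Group G] (ι : G → G) : Prop :=
  Function.Bijective ι ∧ (∀ g h : G, ι (g * h) = ι g * ι h) ∧ (∀ g : G, ι (ι g) = g)

/-- `X` is isomorphic to the coset two-valued group `G/ι`: there is a quotient map
`π : G → X` whose fibres are exactly the `ι`-orbits and which carries the coset
two-valued multiplication `π g * π h = [π (g h), π (g ι(h))]`. -/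
def IsCosetOf {T : Type u} {G : Type v} [Group G] (X : TwoValuedGroup T) (ι : G → G) : Prop :=
  ∃ π : G → T, Function.Surjective π ∧ π 1 = X.e ∧
    (∀ g, π (ι g) = π g) ∧
    (∀ g h, π g = π h → h = g ∨ h = ι g) ∧
    (∀ g h, X.mul (π g) (π h) = {π (g * h), π (g * ι h)}) ∧
    (∀ g, X.inv (π g) = π g⁻¹)

/-- `X` is isomorphic to the coset two-valued group `X^a_A = A/ι_a`
for the antipodal involution `ι_a (a) = a⁻¹` of the abelian group `A`. -/
def IsAntipodalCosetOf {T : Type u} (X : TwoValuedGroup T) (A : Type v) [CommGroup A] : Prop :=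
  ∃ π : A → T, Function.Surjective π ∧ π 1 = X.e ∧
    (∀ a, π a⁻¹ = π a) ∧
    (∀ a b, π a = π b → b = a ∨ b = a⁻¹) ∧
    (∀ a b, X.mul (π a) (π b) = {π (a * b), π (a * b⁻¹)}) ∧
    (∀ a, X.inv (π a) = π a⁻¹)

/-- A Boolean group: every element squares to the identity. -/
def IsBooleanGroup (V : Type v) [CommGroup V] : Prop := ∀ x : V, x * x = 1

/-- For a Boolean group, `dim V ≥ 2` (as an `𝔽₂`-vector space) is equivalent to the
existence of two distinct nontrivial elements. -/
def BoolDimGE2 (V : Type v) [CommGroup V] : Prop := ∃ a b : V, a ≠ 1 ∧ b ≠ 1 ∧ a ≠ b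

/-- For a Boolean group, `dim V ≥ 3` is equivalent to the existence of three
linearly independent elements. -/
def BoolDimGE3 (V : Type v) [CommGroup V] : Prop :=
  ∃ a b c : V, a ≠ 1 ∧ b ≠ 1 ∧ a ≠ b ∧ c ≠ 1 ∧ c ≠ a ∧ c ≠ b ∧ c ≠ a * b

/-- Isomorphism of (single-valued) groups. -/
def GroupIsomorphic (A : Type v) (B : Type w) [CommGroup A] [CommGroup B] : Prop :=
  Nonempty (A ≃* B)

/-- `X` is isomorphic to the coset two-valued group `X^u_V = (V × V)/ι_u`,
where `ι_u (a, b) = (a, a b)` is the unipotent involution of the Boolean group `V × V`. -/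
def IsUnipotentCosetOf {T : Type u} (X : TwoValuedGroup T) (V : Type v) [CommGroup V] : Prop :=
  ∃ π : V × V → T, Function.Surjective π ∧ π (1, 1) = X.e ∧
    (∀ a b : V, π (a, a * b) = π (a, b)) ∧
    (∀ p q : V × V, π p = π q → q = p ∨ q = (p.1, p.1 * p.2)) ∧
    (∀ a₁ b₁ a₂ b₂ : V,
      X.mul (π (a₁, b₁)) (π (a₂, b₂)) = {π (a₁ * a₂, b₁ * b₂), π (a₁ * a₂, a₂ * b₁ * b₂)}) ∧
    (∀ p : V × V, X.inv (π p) = π p)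

/-- `X` is isomorphic to the direct product `X^u_V × W` of the unipotent coset
two-valued group `X^u_V = (V × V)/ι_u` and the Boolean group `W`. -/
def IsUnipotentCosetProdOf {T : Type u} (X : TwoValuedGroup T) (V : Type v) (W : Type w)
    [CommGroup V] [CommGroup W] : Prop :=
  ∃ f : (V × V) × W → T, Function.Surjective f ∧ f ((1, 1), 1) = X.e ∧
    (∀ (a b : V) (w : W), f ((a, a * b), w) = f ((a, b), w)) ∧
    (∀ p q : (V × V) × W, f p = f q → q.2 = p.2 ∧ (q.1 = p.1 ∨ q.1 = (p.1.1, p.1.1 * p.1.2))) ∧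
    (∀ (a₁ b₁ a₂ b₂ : V) (w₁ w₂ : W),
      X.mul (f ((a₁, b₁), w₁)) (f ((a₂, b₂), w₂)) =
        {f ((a₁ * a₂, b₁ * b₂), w₁ * w₂), f ((a₁ * a₂, a₂ * b₁ * b₂), w₁ * w₂)}) ∧
    (∀ p, X.inv (f p) = f p)

open Classical in
/-- The multiplication table of the special two-valued group `Y_V` on `Option V`:
`none` is the extra element `s`, `some v` are the elements of the Boolean group `V`. -/
noncomputable def mulY {V : Type v} [CommGroup V] : Option V → Option V → Multiset (Option V)
  | some x, some y =>
      if x = y then (if x = 1 then {some 1, some 1} else {some 1, none})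
      else {some (x * y), some (x * y)}
  | some x, none => if x = 1 then {none, none} else {some x, some x}
  | none, some y => if y = 1 then {none, none} else {some y, some y}
  | none, none => {some 1, some 1}

/-- `X` is isomorphic to the special two-valued group `Y_V`. -/
def IsYOf {T : Type u} (X : TwoValuedGroup T) (V : Type v) [CommGroup V] : Prop :=
  ∃ f : Option V → T, Function.Bijective f ∧ f (some 1) = X.e ∧
    (∀ uu vv : Option V, X.mul (f uu) (f vv) = (mulY uu vv).map f) ∧
    (∀ uu : Option V, X.inv (f uu) = f uu)

/-- `X` is isomorphic to the direct product `Y_V × W`. -/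
def IsYProdOf {T : Type u} (X : TwoValuedGroup T) (V : Type v) (W : Type w)
    [CommGroup V] [CommGroup W] : Prop :=
  ∃ f : Option V × W → T, Function.Bijective f ∧ f (some 1, 1) = X.e ∧
    (∀ (uu vv : Option V) (w₁ w₂ : W),
      X.mul (f (uu, w₁)) (f (vv, w₂)) = (mulY uu vv).map (fun z => f (z, w₁ * w₂))) ∧
    (∀ p : Option V × W, X.inv (f p) = f p)

/-- `X` is isomorphic to the direct product `X' × W` of the two-valued group `X'`
and the (single-valued) Boolean group `W`. -/
def IsDirectProdOf {T : Type u} {T' : Type v} (W : Type w) [CommGroup W]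
    (X : TwoValuedGroup T) (X' : TwoValuedGroup T') : Prop :=
  ∃ f : T' × W → T, Function.Bijective f ∧ f (X'.e, 1) = X.e ∧
    (∀ (x₁ x₂ : T') (w₁ w₂ : W),
      X.mul (f (x₁, w₁)) (f (x₂, w₂)) = (X'.mul x₁ x₂).map (fun z => f (z, w₁ * w₂))) ∧
    (∀ (x : T') (w : W), X.inv (f (x, w)) = f (X'.inv x, w))

/-- `X` contains a single-valued direct factor: `X ≅ X' × W` with `W` a nontrivial
Boolean group. -/
def HasSingleValuedDirectFactor {T : Type u} (X : TwoValuedGroup T) : Prop :=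
  ∃ (T' : Type u) (X' : TwoValuedGroup T') (W : Type u) (iW : CommGroup W),
    X'.Commutative ∧ X'.Involutive ∧ @IsBooleanGroup W iW ∧ Nontrivial W ∧
    @IsDirectProdOf T T' W iW X X'

/-- The Boolean group `C₂ⁿ`. -/
abbrev C2vec (n : ℕ) : Type := Fin n → Multiplicative (ZMod 2)

/-- The group `C₄ⁿ`. -/
abbrev C4vec (n : ℕ) : Type := Fin n → Multiplicative (ZMod 4)

end TwoValuedGroup

namespace TwoValuedGroup

/-- `Y` belongs to the principal series: `Y ≅ X^a_A` for some abelian group `A`. -/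
def InSeriesA {S : Type v} (Y : TwoValuedGroup S) : Prop :=
  ∃ (A : Type v) (iA : CommGroup A), @IsAntipodalCosetOf S Y A iA

/-- `Y` belongs to the unipotent series: `Y ≅ X^u_V × W` with `V`, `W` Boolean and
`dim V ≥ 3`. -/
def InSeriesU {S : Type v} (Y : TwoValuedGroup S) : Prop :=
  ∃ (V W : Type v) (iV : CommGroup V) (iW : CommGroup W),
    @IsBooleanGroup V iV ∧ @IsBooleanGroup W iW ∧ @BoolDimGE3 V iV ∧
    @IsUnipotentCosetProdOf S Y V W iV iW

/-- `Y` belongs to the special series: `Y ≅ Y_V × W` with `V`, `W` Boolean and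
`dim V ≥ 2`. -/
def InSeriesY {S : Type v} (Y : TwoValuedGroup S) : Prop :=
  ∃ (V W : Type v) (iV : CommGroup V) (iW : CommGroup W),
    @IsBooleanGroup V iV ∧ @IsBooleanGroup W iW ∧ @BoolDimGE2 V iV ∧
    @IsYProdOf S Y V W iV iW

/-- An involutive commutative two-valued group. -/
structure ICGroup (T : Type u) extends TwoValuedGroup T where
  comm : ∀ x y, mul x y = mul y x
  invol : ∀ x, inv x = x

theorem pair_eq_pair {α : Type*} {a b c d : α} :
    ({a, b} : Multiset α) = {c, d} ↔ (a = c ∧ b = d) ∨ (a = d ∧ b = c) := by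
  classical
  constructor
  · intro h
    have hm : a ∈ ({c, d} : Multiset α) := by rw [← h]; simp
    simp only [Multiset.mem_cons, Multiset.insert_eq_cons, Multiset.mem_singleton] at hm
    rcases hm with rfl | rfl
    · left
      have := (Multiset.cons_inj_right a).1 h
      simpa using this
    · right
      rw [Multiset.pair_comm c a] at h
      have := (Multiset.cons_inj_right a).1 h
      simpa using this
  · rintro (⟨rfl, rfl⟩ | ⟨rfl, rfl⟩)
    · rfl
    · exact Multiset.pair_comm _ _

namespace ICGroup

variable {T : Type u} (X : ICGroup T)

theorem e_mem_mul_iff {x y : T} : X.e ∈ X.mul x y ↔ x = y := by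
  constructor
  · intro h
    have := X.inv_unique x y (Or.inl h)
    rw [X.invol] at this
    exact this.symm
  · rintro rfl
    have := X.e_mem_mul_inv x
    rwa [X.invol] at this

theorem exists_pair (x y : T) : ∃ a b, X.mul x y = {a, b} :=
  Multiset.card_eq_two.1 (X.card_mul x y)

theorem exists_pair_of_mem {x y a : T} (h : a ∈ X.mul x y) : ∃ b, X.mul x y = {a, b} := by
  obtain ⟨c, d, hcd⟩ := X.exists_pair x y
  rw [hcd] at h
  simp only [Multiset.mem_cons, Multiset.insert_eq_cons, Multiset.mem_singleton] at h
  rcases h with rfl | rfl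
  · exact ⟨d, hcd⟩
  · exact ⟨c, by rw [hcd, Multiset.pair_comm]⟩

/-- The formal rational combinations of the elements of a two-valued group. -/
@[nolint unusedArguments]
def Alg (_ : ICGroup T) : Type u := T →₀ ℚ

noncomputable instance : AddCommGroup X.Alg := inferInstanceAs (AddCommGroup (T →₀ ℚ))
noncomputable instance : Module ℚ X.Alg := inferInstanceAs (Module ℚ (T →₀ ℚ))

/-- The basis element of the algebra attached to an element. -/
noncomputable def bas (x : T) : X.Alg := Finsupp.single x (1 : ℚ)

/-- The formal sum of a multiset. -/
noncomputable def msum (M : Multiset T) : X.Alg := (M.map X.bas).sum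

@[elab_as_elim]
theorem Alg.induction {p : X.Alg → Prop} (f : X.Alg) (h0 : p 0)
    (hadd : ∀ f g, p f → p g → p (f + g)) (hb : ∀ (c : ℚ) x, p (c • X.bas x)) : p f := by
  refine Finsupp.induction_linear (motive := p) f h0 hadd (fun x c => ?_)
  have : (Finsupp.single x c : T →₀ ℚ) = c • (Finsupp.single x (1 : ℚ)) := by simp
  rw [this]
  exact hb c x

/-- The bilinear multiplication of the algebra. -/
noncomputable def mulLin : X.Alg →ₗ[ℚ] X.Alg →ₗ[ℚ] X.Alg :=
  Finsupp.linearCombination ℚ fun x =>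
    (Finsupp.linearCombination ℚ fun y => (1 / 2 : ℚ) • X.msum (X.mul x y) : X.Alg →ₗ[ℚ] X.Alg)

theorem mulLin_bas (x y : T) : X.mulLin (X.bas x) (X.bas y) = (1 / 2 : ℚ) • X.msum (X.mul x y) := by
  unfold mulLin bas
  erw [Finsupp.linearCombination_single, one_smul, Finsupp.linearCombination_single, one_smul]

theorem mulLin_comm (f g : X.Alg) : X.mulLin f g = X.mulLin g f := by
  induction f using Alg.induction with
  | h0 => simp
  | hadd f f' h h' => simp [h, h']
  | hb c x =>
    induction g using Alg.induction with
    | h0 => simp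
    | hadd f f' h h' => simp only [map_add, h, h', LinearMap.add_apply]
    | hb d y =>
      simp only [map_smul, LinearMap.smul_apply, mulLin_bas, X.comm x y]
      rw [smul_comm]

theorem msum_add (M N : Multiset T) : X.msum (M + N) = X.msum M + X.msum N := by
  simp [msum]

theorem mulLin_msum (M : Multiset T) (z : T) :
    X.mulLin (X.msum M) (X.bas z) = (1 / 2 : ℚ) • X.msum (M.bind fun t => X.mul t z) := by
  induction M using Multiset.induction with
  | empty => simp [msum]
  | cons a M ih =>
    have h1 : X.msum (a ::ₘ M) = X.bas a + X.msum M := by simp [msum]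
    rw [h1, Multiset.cons_bind, msum_add, map_add, LinearMap.add_apply, ih, mulLin_bas, smul_add]

theorem mulLin_assoc (f g h : X.Alg) : X.mulLin (X.mulLin f g) h = X.mulLin f (X.mulLin g h) := by
  induction f using Alg.induction with
  | h0 => simp
  | hadd f f' h h' => simp only [map_add, h, h', LinearMap.add_apply]
  | hb c x =>
    induction g using Alg.induction with
    | h0 => simp
    | hadd f f' h h' => simp only [map_add, h, h', LinearMap.add_apply]
    | hb d y =>
      induction h using Alg.induction with
      | h0 => simp
      | hadd f f' h h' => simp only [map_add, h, h']
      | hb k z =>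
        simp only [map_smul, LinearMap.smul_apply, mulLin_bas, mulLin_msum]
        rw [X.mulLin_comm (X.bas x), mulLin_msum]
        have : (X.mul y z).bind (fun t => X.mul t x) = (X.mul x y).bind (fun t => X.mul t z) := by
          rw [X.assoc x y z]
          exact Multiset.bind_congr fun t _ => X.comm t x
        rw [this]
        module

theorem mulLin_e (f : X.Alg) : X.mulLin (X.bas X.e) f = f := by
  induction f using Alg.induction with
  | h0 => simp
  | hadd f f' h h' => simp only [map_add, h, h']
  | hb d y =>
    rw [map_smul, mulLin_bas, X.e_mul, msum]
    simp only [Multiset.insert_eq_cons, Multiset.map_cons, Multiset.map_singleton,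
      Multiset.sum_cons, Multiset.sum_singleton]
    module

noncomputable instance : CommRing X.Alg :=
  { (inferInstance : AddCommGroup X.Alg) with
    mul := fun f g => X.mulLin f g
    one := X.bas X.e
    left_distrib := fun f g h => by change X.mulLin _ _ = X.mulLin _ _ + X.mulLin _ _; simp
    right_distrib := fun f g h => by change X.mulLin _ _ = X.mulLin _ _ + X.mulLin _ _; simp
    zero_mul := fun f => by change X.mulLin _ _ = 0; simp
    mul_zero := fun f => by change X.mulLin _ _ = 0; simp
    mul_assoc := fun f g h => X.mulLin_assoc f g h
    mul_comm := fun f g => X.mulLin_comm f g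
    one_mul := fun f => X.mulLin_e f
    mul_one := fun f => (X.mulLin_comm _ _).trans (X.mulLin_e f) }

theorem alg_mul_def (f g : X.Alg) : f * g = X.mulLin f g := rfl

theorem bas_mul_bas (x y : T) : X.bas x * X.bas y + X.bas x * X.bas y = X.msum (X.mul x y) := by
  rw [alg_mul_def, mulLin_bas]; module

theorem bas_e : X.bas X.e = 1 := rfl

end ICGroup

namespace ICGroup

variable {T : Type u} (X : ICGroup T)

/-- The coefficient of an element of the algebra at a basis element. -/
noncomputable def coef (x : T) : X.Alg →ₗ[ℚ] ℚ := Finsupp.lapply x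

theorem coef_bas [DecidableEq T] (x y : T) : X.coef x (X.bas y) = if y = x then 1 else 0 := by
  unfold coef bas
  erw [Finsupp.lapply_apply, Finsupp.single_apply]

theorem coef_msum [DecidableEq T] (x : T) (M : Multiset T) :
    X.coef x (X.msum M) = M.count x := by
  induction M using Multiset.induction with
  | empty => simp [msum]
  | cons a M ih =>
    have h1 : X.msum (a ::ₘ M) = X.bas a + X.msum M := by simp [msum]
    rw [h1, map_add, ih, coef_bas, Multiset.count_cons]
    push_cast
    rw [add_comm]
    simp [eq_comm]

theorem msum_injective {M N : Multiset T} (h : X.msum M = X.msum N) : M = N := by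
  classical
  ext x
  have := congrArg (X.coef x) h
  rw [coef_msum, coef_msum] at this
  exact_mod_cast this

theorem smul_mul_alg (c : ℚ) (f g : X.Alg) : (c • f) * g = c • (f * g) := by
  rw [alg_mul_def, alg_mul_def, map_smul, LinearMap.smul_apply]

theorem coef_e_mul [DecidableEq T] (x : T) (g : X.Alg) :
    X.coef X.e (X.bas x * g) = (1 / 2 : ℚ) * (X.mul x x).count X.e * X.coef x g := by
  induction g using Alg.induction with
  | h0 => simp
  | hadd f f' h h' => simp only [mul_add, map_add, h, h']
  | hb c y =>
    rw [mul_comm, smul_mul_alg, mul_comm, map_smul, map_smul, alg_mul_def, mulLin_bas, map_smul,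
      coef_msum, coef_bas]
    by_cases hxy : y = x
    · subst hxy
      simp
      ring
    · have : (X.mul x y).count X.e = 0 := by
        rw [Multiset.count_eq_zero, X.e_mem_mul_iff]
        exact fun h => hxy h.symm
      simp [this, hxy]

theorem coef_e_mul_self [DecidableEq T] (f : X.Alg) :
    X.coef X.e (f * f) = ∑ x ∈ Finsupp.support (M := ℚ) f,
      (1 / 2 : ℚ) * (X.mul x x).count X.e * (X.coef x f) ^ 2 := by
  have key : f = ∑ x ∈ Finsupp.support (M := ℚ) f, X.coef x f • X.bas x := by
    have := (Finsupp.sum_single (M := ℚ) f).symm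
    refine this.trans ?_
    refine Finset.sum_congr rfl fun x _ => ?_
    have : (Finsupp.single x (X.coef x f) : T →₀ ℚ)
      = (X.coef x f) • (Finsupp.single x (1 : ℚ)) := by simp
    exact this
  have h2 : f * f = ∑ x ∈ Finsupp.support (M := ℚ) f, X.coef x f • (X.bas x * f) := by
    conv_lhs => rw [key]
    rw [Finset.sum_mul]
    refine Finset.sum_congr rfl fun x _ => ?_
    rw [← key, smul_mul_alg]
  rw [h2, map_sum]
  refine Finset.sum_congr rfl fun x _ => ?_
  rw [map_smul, coef_e_mul, smul_eq_mul]
  ring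

instance : IsReduced X.Alg := by
  classical
  rw [isReduced_iff_pow_one_lt 2 (by norm_num)]
  intro f hf
  have h := X.coef_e_mul_self f
  rw [← pow_two, hf, map_zero] at h
  have h2 := (Finset.sum_eq_zero_iff_of_nonneg (fun x _ => by positivity)).1 h.symm
  refine Finsupp.ext (M := ℚ) fun x => ?_
  by_contra hx
  have h3 := h2 x (Finsupp.mem_support_iff.2 hx)
  have h4 : (X.mul x x).count X.e ≠ 0 :=
    Multiset.count_ne_zero.2 (X.e_mem_mul_iff.2 rfl)
  have h5 : X.coef x f ≠ 0 := hx
  have h6 : ((X.mul x x).count X.e : ℚ) ≠ 0 := by exact_mod_cast h4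
  simp [h5, h4] at h3

/-- The points at which elements of a two-valued group are evaluated. -/
abbrev Pt : Type u := PrimeSpectrum X.Alg

/-- The field of values at a point. -/
abbrev Fld (P : X.Pt) : Type u := AlgebraicClosure P.asIdeal.ResidueField

/-- Evaluation of the algebra at a point. -/
noncomputable def ev (P : X.Pt) : X.Alg →+* X.Fld P :=
  (algebraMap P.asIdeal.ResidueField (X.Fld P)).comp (algebraMap X.Alg P.asIdeal.ResidueField)

/-- The character of a two-valued group at a point. -/
noncomputable def chi (P : X.Pt) (x : T) : X.Fld P := X.ev P (X.bas x)

theorem eq_of_ev {f g : X.Alg} (h : ∀ P, X.ev P f = X.ev P g) : f = g := by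
  rw [← sub_eq_zero]
  have : IsNilpotent (f - g) := by
    rw [nilpotent_iff_mem_prime]
    intro J hJ
    have h1 := h ⟨J, hJ⟩
    rw [← sub_eq_zero, ← map_sub, ev, RingHom.comp_apply, map_eq_zero] at h1
    exact (Ideal.algebraMap_residueField_eq_zero (I := J)).1 h1
  exact this.eq_zero

theorem chi_e (P : X.Pt) : X.chi P X.e = 1 := by
  rw [chi, bas_e, map_one]

/-- The sum of a character over a multiset. -/
noncomputable def chis (P : X.Pt) (M : Multiset T) : X.Fld P := (M.map (X.chi P)).sum

theorem ev_msum (P : X.Pt) (M : Multiset T) : X.ev P (X.msum M) = X.chis P M := by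
  rw [msum, chis, map_multiset_sum, Multiset.map_map]
  rfl

theorem chis_pair (P : X.Pt) (a b : T) : X.chis P {a, b} = X.chi P a + X.chi P b := by
  simp [chis]

theorem chis_cons (P : X.Pt) (a : T) (M) : X.chis P (a ::ₘ M) = X.chi P a + X.chis P M := by
  simp [chis]

theorem chis_singleton (P : X.Pt) (a : T) : X.chis P {a} = X.chi P a := by
  simp [chis]

theorem chis_add (P : X.Pt) (M N : Multiset T) : X.chis P (M + N) = X.chis P M + X.chis P N := by
  simp [chis]

theorem chis_mul (P : X.Pt) (x y : T) : X.chis P (X.mul x y) = 2 * X.chi P x * X.chi P y := by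
  rw [← ev_msum, ← bas_mul_bas, map_add, map_mul, chi, chi]
  ring

theorem eq_of_chis {M N : Multiset T} (h : ∀ P, X.chis P M = X.chis P N) : M = N :=
  X.msum_injective (X.eq_of_ev fun P => by rw [ev_msum, ev_msum, h])

theorem isUnit_two : IsUnit (2 : X.Alg) := by
  refine IsUnit.of_mul_eq_one ((1 / 2 : ℚ) • (1 : X.Alg)) ?_
  rw [mul_comm, smul_mul_alg, one_mul, ← one_add_one_eq_two (R := X.Alg)]
  have h : ∀ f : X.Alg, (1 / 2 : ℚ) • (f + f) = f := fun f => by module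
  exact h 1

theorem two_ne_zero' (P : X.Pt) : (2 : X.Fld P) ≠ 0 := by
  have := X.isUnit_two.map (X.ev P)
  rw [map_ofNat] at this
  exact this.ne_zero

theorem eq_of_chi {x y : T} (h : ∀ P, X.chi P x = X.chi P y) : x = y := by
  have : ({x} : Multiset T) = {y} := X.eq_of_chis fun P => by simpa [chis] using h P
  simpa using this

end ICGroup

namespace ICGroup

variable {T : Type u} (X : ICGroup T)

theorem exists_square (x : T) : ∃ b, X.mul x x = {X.e, b} :=
  X.exists_pair_of_mem (X.e_mem_mul_iff.2 rfl)

/-- The square of an element: `x * x = [e, q x]`. -/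
noncomputable def q (x : T) : T := (X.exists_square x).choose

theorem mul_self (x : T) : X.mul x x = {X.e, X.q x} := (X.exists_square x).choose_spec

theorem q_mem (x : T) : X.q x ∈ X.mul x x := by rw [mul_self]; simp

variable {X} in
theorem chi_pair {x y a b : T} (h : X.mul x y = {a, b}) (P : X.Pt) :
    X.chi P a + X.chi P b = 2 * X.chi P x * X.chi P y := by
  rw [← chis_mul, h, chis_pair]

theorem chi_q (P : X.Pt) (x : T) : X.chi P (X.q x) = 2 * X.chi P x ^ 2 - 1 := by
  have := chi_pair (X.mul_self x) P
  rw [chi_e] at this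
  linear_combination this

theorem q_e : X.q X.e = X.e := X.eq_of_chi fun P => by rw [chi_q, chi_e]; ring

variable {X} in
theorem mem_rot {x y z : T} (h : z ∈ X.mul x y) : x ∈ X.mul y z := by
  have h1 : X.e ∈ (X.mul x y).bind (fun t => X.mul t z) :=
    Multiset.mem_bind.2 ⟨z, h, X.e_mem_mul_iff.2 rfl⟩
  rw [X.assoc] at h1
  obtain ⟨t, ht, h2⟩ := Multiset.mem_bind.1 h1
  rw [e_mem_mul_iff] at h2
  rwa [h2]

variable {X} in
theorem mem_comm {x y z : T} (h : z ∈ X.mul x y) : z ∈ X.mul y x := by rwa [X.comm]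

/-- The elements with trivial square. -/
def E : Type u := {g : T // X.q g = X.e}

variable {X} in
/-- The underlying element. -/
def E.val (g : X.E) : T := Subtype.val g

variable {X} in
theorem E.ext {g h : X.E} (H : g.val = h.val) : g = h := Subtype.ext H

variable {X} in
theorem E.q_val (g : X.E) : X.q g.val = X.e := g.2

variable {X} in
theorem E.sq (g : X.E) (P : X.Pt) : X.chi P g.val ^ 2 = 1 := by
  have := X.chi_q P g.val
  rw [g.q_val, chi_e] at this
  have h2 : (2 : X.Fld P) * (X.chi P g.val ^ 2 - 1) = 0 := by linear_combination -this
  rcases mul_eq_zero.1 h2 with h | h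
  · exact absurd h (X.two_ne_zero' P)
  · linear_combination h

theorem exists_act (g : X.E) (x : T) : ∃ a, X.mul g.val x = {a, a} ∧
    ∀ P, X.chi P a = X.chi P g.val * X.chi P x := by
  obtain ⟨a, b, h⟩ := X.exists_pair g.val x
  obtain ⟨c, d, h1⟩ := X.exists_pair g.val a
  obtain ⟨c', d', h2⟩ := X.exists_pair g.val b
  have key : ({c, d} + {c', d'} : Multiset T) = {x, x, x, x} := X.eq_of_chis fun P => by
    simp only [chis_add, chis_cons, Multiset.insert_eq_cons, chis_singleton]
    linear_combination chi_pair h1 P + chi_pair h2 P + 2 * X.chi P g.val * chi_pair h P +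
      4 * X.chi P x * g.sq P
  have hall : ∀ t ∈ ({c, d} + {c', d'} : Multiset T), t = x := by
    rw [key]; simp
  have hc := hall c (by simp)
  have hd := hall d (by simp)
  have hc' := hall c' (by simp)
  have hd' := hall d' (by simp)
  subst hc hd
  have ha : ∀ P, X.chi P a = X.chi P g.val * X.chi P d := fun P => by
    refine mul_left_cancel₀ (X.two_ne_zero' P) ?_
    linear_combination -(2 * X.chi P a) * g.sq P - X.chi P g.val * chi_pair h1 P
  have hb : ∀ P, X.chi P b = X.chi P g.val * X.chi P d := fun P => by
    refine mul_left_cancel₀ (X.two_ne_zero' P) ?_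
    have := chi_pair h2 P
    rw [hc', hd'] at this
    linear_combination -(2 * X.chi P b) * g.sq P - X.chi P g.val * this
  have hab : a = b := X.eq_of_chi fun P => by rw [ha, hb]
  subst hab
  exact ⟨a, h, ha⟩

noncomputable instance : SMul X.E T := ⟨fun g x => (X.exists_act g x).choose⟩

variable {X} in
theorem mul_val (g : X.E) (x : T) : X.mul g.val x = {g • x, g • x} :=
  (X.exists_act g x).choose_spec.1

variable {X} in
@[simp] theorem chi_smul (g : X.E) (x : T) (P : X.Pt) :
    X.chi P (g • x) = X.chi P g.val * X.chi P x :=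
  (X.exists_act g x).choose_spec.2 P

variable {X} in
theorem q_smul (g : X.E) (x : T) : X.q (g • x) = X.q x := X.eq_of_chi fun P => by
  rw [chi_q, chi_q, chi_smul]
  linear_combination 2 * X.chi P x ^ 2 * g.sq P

/-- The identity as an element with trivial square. -/
def E.one : X.E := ⟨X.e, X.q_e⟩

noncomputable instance : Mul X.E := ⟨fun g h => ⟨g • h.val, by rw [q_smul, h.q_val]⟩⟩
instance : One X.E := ⟨E.one X⟩
instance : Inv X.E := ⟨fun g => g⟩

@[simp] theorem E.val_one : (1 : X.E).val = X.e := rfl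

variable {X} in
theorem E.val_mul (g h : X.E) : (g * h).val = g • h.val := rfl

variable {X} in
theorem E.ext_chi {g h : X.E} (H : ∀ P, X.chi P g.val = X.chi P h.val) : g = h :=
  E.ext (X.eq_of_chi H)

variable {X} in
theorem E.mul_self (g : X.E) : g * g = 1 := E.ext_chi fun P => by
  rw [E.val_mul, chi_smul, E.val_one, chi_e, ← g.sq P, pow_two]

noncomputable instance : CommGroup X.E where
  mul_assoc a b c := E.ext_chi fun P => by simp only [E.val_mul, chi_smul]; ring
  mul_comm a b := E.ext_chi fun P => by simp only [E.val_mul, chi_smul]; ring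
  one_mul a := E.ext_chi fun P => by simp [E.val_mul, chi_e]
  mul_one a := E.ext_chi fun P => by simp [E.val_mul, chi_e]
  inv_mul_cancel a := E.mul_self a

noncomputable instance : MulAction X.E T where
  one_smul x := X.eq_of_chi fun P => by simp [chi_e]
  mul_smul g h x := X.eq_of_chi fun P => by simp [E.val_mul, mul_assoc]

theorem isBooleanGroup_E : IsBooleanGroup X.E := fun g => g.mul_self

variable {X} in
theorem smul_e (g : X.E) : g • X.e = g.val := X.eq_of_chi fun P => by simp [chi_e]

variable {X} in
theorem chis_map_smul (g : X.E) (M : Multiset T) (P : X.Pt) :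
    X.chis P (M.map (g • ·)) = X.chi P g.val * X.chis P M := by
  rw [chis, chis, Multiset.map_map, ← Multiset.sum_map_mul_left]
  simp

variable {X} in
theorem smul_mul (g : X.E) (x y : T) : X.mul (g • x) y = (X.mul x y).map (g • ·) :=
  X.eq_of_chis fun P => by rw [chis_map_smul, chis_mul, chis_mul, chi_smul]; ring

variable {X} in
theorem mul_smul' (g : X.E) (x y : T) : X.mul x (g • y) = (X.mul x y).map (g • ·) := by
  rw [X.comm, smul_mul, X.comm]

variable {X} in
theorem smul_smul_self (g : X.E) (x : T) : g • g • x = x := by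
  rw [← mul_smul, E.mul_self, one_smul]

variable {X} in
theorem smul_mem {g : X.E} {x y z : T} (h : z ∈ X.mul x y) : g • z ∈ X.mul (g • x) y := by
  rw [smul_mul]; exact Multiset.mem_map_of_mem _ h

variable {X} in
theorem eq_smul_of_mem {g : X.E} {x y : T} (h : g.val ∈ X.mul x y) : y = g • x := by
  have : g • g.val ∈ X.mul (g • x) y := smul_mem h
  rw [← E.val_mul, E.mul_self, E.val_one, e_mem_mul_iff] at this
  exact this.symm

variable {X} in
theorem smul_eq_self_iff {g : X.E} {x : T} : g • x = x ↔ g = 1 ∨ g.val = X.q x := by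
  constructor
  · intro h
    have h1 : X.mul (g • x) x = (X.mul x x).map (g • ·) := smul_mul g x x
    rw [h] at h1
    have h2 : g.val ∈ X.mul x x := by
      rw [h1, ← smul_e]
      exact Multiset.mem_map_of_mem _ (X.e_mem_mul_iff.2 rfl)
    rw [X.mul_self x] at h2
    simp only [Multiset.mem_cons, Multiset.insert_eq_cons, Multiset.mem_singleton] at h2
    exact h2.imp_left E.ext
  · rintro (rfl | h)
    · simp
    · have : g.val ∈ X.mul x x := by rw [h]; exact X.q_mem x
      exact (eq_smul_of_mem this).symm

variable {X} in
theorem q_eq_e_of_mul_eq {h p : T} (hp : X.mul h p = {p, p}) : X.q h = X.e := by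
  have h1 : h ∈ X.mul p p := mem_rot (by rw [hp]; simp)
  obtain ⟨a, b, hab⟩ := X.exists_pair (X.q h) p
  have h2 : ({a, b} : Multiset T) = {p, p} := X.eq_of_chis fun P => by
    rw [chis_pair, chis_pair, chi_pair hab, chi_q]
    linear_combination -2 * (1 + X.chi P h) * chi_pair hp P
  rw [h2] at hab
  have h3 : X.q h ∈ X.mul p p := mem_rot (by rw [hab]; simp)
  rw [X.mul_self p] at h1 h3
  simp only [Multiset.mem_cons, Multiset.insert_eq_cons, Multiset.mem_singleton] at h1 h3
  rcases h3 with h3 | h3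
  · exact h3
  rcases h1 with h1 | h1
  · rw [h1, q_e]
  · refine X.eq_of_chi fun P => ?_
    have e1 := chi_pair hp P
    have e2 := X.chi_q P p
    rw [← h1] at e2
    have e3 := X.chi_q P h
    rw [h3, ← h1] at e3
    rw [h3, ← h1, chi_e]
    have h4 : X.chi P h = 1 ∨ X.chi P p = 0 := by
      have : (2 : X.Fld P) * ((X.chi P h - 1) * X.chi P p) = 0 := by linear_combination -e1
      rcases mul_eq_zero.1 this with h | h
      · exact absurd h (X.two_ne_zero' P)
      · rcases mul_eq_zero.1 h with h | h
        · left; linear_combination h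
        · right; exact h
    rcases h4 with h4 | h4
    · exact h4
    · rw [h4] at e2
      have : X.chi P h = -1 := by linear_combination e2
      rw [this] at e3
      have : (2 : X.Fld P) = 0 := by linear_combination -e3
      exact absurd this (X.two_ne_zero' P)

end ICGroup

namespace ICGroup

variable {T : Type u} {X : ICGroup T}

theorem chi_sum_eq {x y z x' y' : T} (hx : X.mul y z = {x, x'}) (hy : X.mul x z = {y, y'}) :
    X.q x ::ₘ X.mul x x' = X.q y ::ₘ X.mul y y' := X.eq_of_chis fun P => by
  simp only [chis_cons, chis_mul, chi_q]
  linear_combination 2 * X.chi P x * chi_pair hx P - 2 * X.chi P y * chi_pair hy P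

theorem square_sum_eq {x y z x' : T} (hx : X.mul y z = {x, x'}) :
    ({X.q x, X.q x'} + (X.mul x x' + X.mul x x') : Multiset T) =
      {X.q y, X.q y, X.q z, X.q z} + X.mul (X.q y) (X.q z) := X.eq_of_chis fun P => by
  simp only [chis_add, chis_cons, chis_singleton, chis_mul, chi_q, Multiset.insert_eq_cons]
  linear_combination 2 * (X.chi P x + X.chi P x' + 2 * X.chi P y * X.chi P z) * chi_pair hx P

theorem mul_conj_of_ne {x y z x' : T} (hx : X.mul y z = {x, x'}) (h1 : X.q x ≠ X.q y)
    (h2 : X.q x ≠ X.q z) : X.mul x x' = {X.q y, X.q z} := by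
  classical
  have hxm : x ∈ X.mul y z := by rw [hx]; simp
  obtain ⟨y', hy⟩ := X.exists_pair_of_mem (mem_comm (mem_rot hxm))
  obtain ⟨z', hz⟩ := X.exists_pair_of_mem (mem_comm (mem_rot (mem_comm hxm)))
  have e1 := chi_sum_eq hx hy
  have e2 := chi_sum_eq ((X.comm z y).trans hx) hz
  have e3 := square_sum_eq hx
  obtain ⟨a, b, hab⟩ := X.exists_pair x x'
  rw [hab] at e1 e2 e3 ⊢
  have m1 : X.q y ∈ X.q x ::ₘ {a, b} := by rw [e1]; simp
  have m2 : X.q z ∈ X.q x ::ₘ {a, b} := by rw [e2]; simp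
  simp only [Multiset.mem_cons, Multiset.insert_eq_cons, Multiset.mem_singleton] at m1 m2
  by_cases hyz : X.q y = X.q z
  · rw [hyz, X.mul_self] at e3
    have hc := congrArg (Multiset.count (X.q z)) e3
    rw [hyz] at m1 ⊢
    simp only [Multiset.insert_eq_cons, Multiset.count_add, Multiset.count_cons,
      Multiset.count_singleton] at hc
    rw [pair_eq_pair]
    grind
  · rw [pair_eq_pair]
    grind

theorem mul_conj_of_eq {x y z x' : T} (hx : X.mul y z = {x, x'}) (h1 : X.q x = X.q y)
    (h2 : X.q x ≠ X.q z) : X.mul x x' = {X.q y, X.q z} := by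
  have hxm : x ∈ X.mul y z := by rw [hx]; simp
  obtain ⟨z', hz⟩ := X.exists_pair_of_mem (mem_comm (mem_rot (mem_comm hxm)))
  have e2 := chi_sum_eq ((X.comm z y).trans hx) hz
  rw [mul_conj_of_ne hz (Ne.symm h2) (h1 ▸ Ne.symm h2)] at e2
  rw [← Multiset.cons_inj_right (X.q x), e2, Multiset.pair_comm (X.q y)]
  exact Multiset.cons_swap _ _ _

theorem mul_conj {x y z x' : T} (hx : X.mul y z = {x, x'}) :
    X.mul x x' = {X.q y, X.q z} ∨
      (x' = x ∧ X.q x = X.q y ∧ X.q z = X.q y ∧ X.q (X.q y) = X.e ∧ X.q y ≠ X.e) := by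
  classical
  have hxm : x ∈ X.mul y z := by rw [hx]; simp
  by_cases h1 : X.q x = X.q y
  · by_cases h2 : X.q x = X.q z
    · have e3 := square_sum_eq hx
      obtain ⟨a, b, hab⟩ := X.exists_pair x x'
      have he : X.e ∈ ({a, b} : Multiset T) → x = x' := by
        rw [← hab]; exact X.e_mem_mul_iff.1
      simp only [Multiset.mem_cons, Multiset.insert_eq_cons, Multiset.mem_singleton] at he
      rw [hab, ← h1, ← h2, X.mul_self] at e3
      rw [hab, ← h1, ← h2, pair_eq_pair]
      have c1 := congrArg (Multiset.count (X.q x)) e3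
      have c2 := congrArg (Multiset.count a) e3
      have c3 := congrArg (Multiset.count b) e3
      have c4 := congrArg (Multiset.count X.e) e3
      simp only [Multiset.insert_eq_cons, Multiset.count_add, Multiset.count_cons,
        Multiset.count_singleton] at c1 c2 c3 c4
      grind
    · exact Or.inl (mul_conj_of_eq hx h1 h2)
  · by_cases h2 : X.q x = X.q z
    · left
      rw [mul_conj_of_eq ((X.comm z y).trans hx) h2 h1, Multiset.pair_comm]
    · exact Or.inl (mul_conj_of_ne hx h1 h2)

end ICGroup

namespace ICGroup

variable {T : Type u} {X : ICGroup T}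

theorem exists_E {x : T} (h : X.q x = X.e) : ∃ g : X.E, g.val = x := ⟨⟨x, h⟩, rfl⟩

theorem q_q_ne_of_smul {x : T} (h : X.q x ≠ X.e) (g : X.E) : g • x ≠ X.e := by
  intro h'
  have := q_smul g x
  rw [h', q_e] at this
  exact h this.symm

theorem E.val_ne {x : T} (h : X.q x ≠ X.e) (g : X.E) : g.val ≠ x := by
  rintro rfl
  exact h g.q_val

theorem ne_e_of_q {x : T} (h : X.q x ≠ X.e) : x ≠ X.e := by
  rintro rfl
  exact h X.q_e

theorem mul_eq_of_q_eq_val {x₀ y a : T} (h₀ : X.q (X.q x₀) ≠ X.e) {g : X.E}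
    (hy : X.q y = g.val) (ha : a ∈ X.mul x₀ y) :
    X.mul x₀ y = {a, g • a} ∧ X.q a = g • X.q x₀ := by
  obtain ⟨a', ha'⟩ := X.exists_pair_of_mem ha
  have h1 : X.mul a a' = {X.q x₀, X.q y} := by
    rcases mul_conj ha' with h | h
    · exact h
    · exact absurd h.2.2.2.1 h₀
  have h2 : a' = g • a := eq_smul_of_mem (by rw [h1, hy]; simp)
  refine ⟨by rw [← h2, ha'], ?_⟩
  obtain ⟨x', hx'⟩ := X.exists_pair_of_mem (mem_rot ha)
  have h3 : X.mul x₀ x' = {X.q y, X.q a} := by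
    rcases mul_conj hx' with h | h
    · exact h
    · exact absurd (h.2.1 ▸ h.2.2.2.1) h₀
  have h4 : x' = g • x₀ := eq_smul_of_mem (by rw [h3, hy]; simp)
  rw [h4, mul_smul', X.mul_self, hy, Multiset.insert_eq_cons, Multiset.map_cons,
    Multiset.map_singleton, smul_e] at h3
  simpa using ((Multiset.cons_inj_right _).1 h3).symm

theorem eq_smul_q_of_mul_eq {x₀ y t w : T} (h₀ : X.q (X.q x₀) ≠ X.e) {g : X.E} (hg : g ≠ 1)
    (hy : X.q y = g.val) (ht : X.q t = g.val) (hw : X.q w = g.val) (h : X.mul y t = {w, w}) :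
    g.val = X.q (X.q x₀) ∧ ∃ k : X.E, y = k • X.q x₀ := by
  classical
  have hge : g.val ≠ X.e := fun h => hg (E.ext h)
  obtain ⟨a, a₁, ha⟩ := X.exists_pair x₀ y
  have ham : a ∈ X.mul x₀ y := by rw [ha]; simp
  obtain ⟨ha', hqa⟩ := mul_eq_of_q_eq_val h₀ hy ham
  obtain ⟨b, b₁, hb⟩ := X.exists_pair x₀ w
  have hbm : b ∈ X.mul x₀ w := by rw [hb]; simp
  obtain ⟨hb', hqb⟩ := mul_eq_of_q_eq_val h₀ hw hbm
  obtain ⟨m, m', hm⟩ := X.exists_pair a t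
  have e1 : ({m, m', g • m, g • m'} : Multiset T) = {b, b, g • b, g • b} :=
    X.eq_of_chis fun P => by
    simp only [chis_cons, chis_singleton, Multiset.insert_eq_cons, chi_smul]
    have h1 := chi_pair ha' P
    have h2 := chi_pair hb' P
    have h3 := chi_pair hm P
    have h4 := chi_pair h P
    rw [chi_smul] at h1 h2
    linear_combination (1 + X.chi P g.val) * h3 + 2 * X.chi P t * h1 - 2 * h2
      - 2 * X.chi P x₀ * h4
  have hqm : X.q m = g • X.q x₀ ∧ (m' = m ∨ m' = g • m) := by
    have m1 : m ∈ ({b, b, g • b, g • b} : Multiset T) := by rw [← e1]; simp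
    have m2 : m' ∈ ({b, b, g • b, g • b} : Multiset T) := by rw [← e1]; simp
    simp only [Multiset.mem_cons, Multiset.insert_eq_cons, Multiset.mem_singleton] at m1 m2
    have : X.q (g • b) = X.q b := q_smul g b
    have := smul_smul_self g b
    grind
  obtain ⟨hqm, hm'⟩ := hqm
  have hqqa : X.q (X.q a) ≠ X.e := by rw [hqa, q_smul]; exact h₀
  have e2 : X.mul m m' = {g • X.q x₀, g.val} := by
    rcases mul_conj hm with h | h
    · rw [h, hqa, ht]
    · exact absurd h.2.2.2.1 hqqa
  have hgx : g • X.q x₀ = X.q x₀ := by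
    rcases hm' with rfl | rfl
    · rw [X.mul_self, pair_eq_pair] at e2
      rcases e2 with h | h
      · exact absurd h.1.symm (q_q_ne_of_smul h₀ g)
      · exact absurd h.1.symm hge
    · rw [mul_smul', X.mul_self, Multiset.insert_eq_cons, Multiset.map_cons,
        Multiset.map_singleton, smul_e, ← Multiset.insert_eq_cons, pair_eq_pair, hqm,
        smul_smul_self] at e2
      rcases e2 with h | h
      · exact absurd h.2.symm (E.val_ne h₀ g)
      · exact h.2.symm
  have hgq : g.val = X.q (X.q x₀) := by
    rcases smul_eq_self_iff.1 hgx with h | h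
    · exact absurd h hg
    · exact h
  refine ⟨hgq, ?_⟩
  rw [hgx] at hqa
  obtain ⟨f, hf⟩ := X.exists_pair_of_mem (mem_rot (mem_comm ham) : y ∈ X.mul x₀ a)
  have hax : a ∈ X.mul (X.q x₀) a := by
    rw [← hqa]
    exact mem_comm (mem_rot (X.q_mem a))
  obtain ⟨a₂, ha₂⟩ := X.exists_pair_of_mem hax
  obtain ⟨u, v, huv⟩ := X.exists_pair x₀ f
  have e3 : ({a, a, a, a₂} : Multiset T) = {a, g • a, u, v} := X.eq_of_chis fun P => by
    simp only [chis_cons, chis_singleton, Multiset.insert_eq_cons]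
    linear_combination chi_pair ha₂ P + 2 * X.chi P a * X.chi_q P x₀ - chi_pair ha' P
      - chi_pair huv P - 2 * X.chi P x₀ * chi_pair hf P
  have hag : g • a ≠ a := by
    intro h
    rcases smul_eq_self_iff.1 h with h | h
    · exact hg h
    · rw [hqa] at h
      exact E.val_ne h₀ g h
  have huv' : u = a ∧ v = a := by
    have m1 := congrArg (Multiset.count u) e3
    have m2 := congrArg (Multiset.count v) e3
    have m3 := congrArg (Multiset.count a) e3
    simp only [Multiset.insert_eq_cons, Multiset.count_cons, Multiset.count_singleton] at m1 m2 m3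
    grind
  obtain ⟨rfl, rfl⟩ := huv'
  have hfE : X.q f = X.e := by
    rcases mul_conj huv with h | h
    · rw [X.mul_self, pair_eq_pair] at h
      rcases h with h | h
      · exact absurd h.1.symm (ne_e_of_q h₀)
      · exact h.1.symm
    · exact absurd h.2.2.2.1 h₀
  have e4 : X.mul y f = {X.q x₀, X.q x₀} := by
    rcases mul_conj hf with h | h
    · rw [h, hqa]
    · exact absurd h.2.2.2.1 h₀
  obtain ⟨k, rfl⟩ := exists_E hfE
  refine ⟨k, ?_⟩
  have e6 := e4.symm.trans ((X.comm _ _).trans (mul_val k y))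
  rw [pair_eq_pair] at e6
  have : X.q x₀ = k • y := by tauto
  rw [this, smul_smul_self]

theorem mul_conj_of_exists {x₀ : T} (h₀ : X.q (X.q x₀) ≠ X.e) {y t w v : T}
    (h : X.mul y t = {w, v}) : X.mul w v = {X.q y, X.q t} := by
  rcases mul_conj h with h1 | ⟨rfl, h1, h2, h3, h4⟩
  · exact h1
  exfalso
  let g : X.E := ⟨X.q y, h3⟩
  have hy : X.q y = g.val := rfl
  have hg : g ≠ 1 := fun h => h4 (by rw [hy, h, E.val_one])
  obtain ⟨hgx, k, rfl⟩ := eq_smul_q_of_mul_eq h₀ hg hy (h2.trans hy) (h1.trans hy) h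
  obtain ⟨-, l, rfl⟩ := eq_smul_q_of_mul_eq h₀ hg (h2.trans hy) hy (h1.trans hy)
    ((X.comm _ _).trans h)
  rw [smul_mul, mul_smul', Multiset.map_map, X.mul_self, Multiset.insert_eq_cons,
    Multiset.map_cons, Multiset.map_singleton, ← Multiset.insert_eq_cons, pair_eq_pair] at h
  have h5 : k • l • X.e = k • l • X.q (X.q x₀) := by simp at h; rw [h.1, h.2]
  rw [smul_left_cancel_iff, smul_left_cancel_iff] at h5
  exact h₀ h5.symm

theorem chi_mul_chi_of_exists {x₀ : T} (h₀ : X.q (X.q x₀) ≠ X.e) {y t w v : T}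
    (h : X.mul y t = {w, v}) (P : X.Pt) :
    X.chi P w * X.chi P v = X.chi P y ^ 2 + X.chi P t ^ 2 - 1 := by
  have h1 := chi_pair (mul_conj_of_exists h₀ h) P
  rw [chi_q, chi_q] at h1
  refine mul_left_cancel₀ (X.two_ne_zero' P) ?_
  linear_combination -h1

end ICGroup

theorem eq_of_shift_invariant {A : Type*} {g : ℤ → A} (h : ∀ j, g j = g (j - 1)) (i j : ℤ) :
    g i = g j := by
  have key : ∀ j, g j = g 0 := by
    intro j
    induction j using Int.induction_on with
    | zero => rfl
    | succ i hi => rw [h, add_sub_cancel_right, hi]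
    | pred i hi => rw [← h, hi]
  rw [key i, key j]

theorem exchange_of_adjacent {A : Type*} [AddCommGroup A] {f : ℤ → ℤ → A}
    (h : ∀ i j, f i j + f (i - 1) (j - 1) = f i (j - 1) + f (i - 1) j) (i i' j j' : ℤ) :
    f i j + f i' j' = f i j' + f i' j := by
  have h1 : ∀ i, f i j - f (i - 1) j = f i j' - f (i - 1) j' := fun i =>
    eq_of_shift_invariant (g := fun j => f i j - f (i - 1) j)
      (fun j => by have := h i j; rw [← sub_eq_zero] at this ⊢; rw [← this]; abel) j j'
  have h2 : f i j - f i j' = f i' j - f i' j' :=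
    eq_of_shift_invariant (g := fun i => f i j - f i j')
      (fun i => by have := h1 i; rw [← sub_eq_zero] at this ⊢; rw [← this]; abel) i i'
  rw [← sub_eq_zero] at h2 ⊢
  rw [← h2]; abel

theorem pair_cases_of_ne {α : Type*} {A B : Multiset α} (hA : Multiset.card A = 2)
    (hB : Multiset.card B = 2) (h : A ≠ B) :
    Disjoint A B ∨ ∃ p r f, p ≠ r ∧ A = {p, f} ∧ B = {r, f} := by
  obtain ⟨a, b, rfl⟩ := Multiset.card_eq_two.1 hA
  obtain ⟨c, d, rfl⟩ := Multiset.card_eq_two.1 hB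
  by_cases hd : Disjoint ({a, b} : Multiset α) {c, d}
  · exact Or.inl hd
  right
  rw [Multiset.disjoint_left] at hd
  push Not at hd
  obtain ⟨f, hf1, hf2⟩ := hd
  simp only [Multiset.mem_cons, Multiset.insert_eq_cons, Multiset.mem_singleton] at hf1 hf2
  have h' : ¬ _ := fun H => h (pair_eq_pair.2 H)
  rcases hf1 with rfl | rfl <;> rcases hf2 with rfl | rfl
  · exact ⟨b, d, f, by tauto, Multiset.pair_comm _ _, Multiset.pair_comm _ _⟩
  · exact ⟨b, c, f, by tauto, Multiset.pair_comm _ _, rfl⟩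
  · exact ⟨a, d, f, by tauto, rfl, Multiset.pair_comm _ _⟩
  · exact ⟨a, c, f, by tauto, rfl, rfl⟩

theorem eq_of_le_add_of_disjoint {α : Type*} {A B C : Multiset α} (hA : Multiset.card A = 2)
    (hC : Multiset.card C = 2) (hd : Disjoint A B) (h : A ≤ C + B) : C = A := by
  classical
  refine (Multiset.eq_of_le_of_card_le (Multiset.le_iff_count.2 fun x => ?_) (by omega)).symm
  have h1 := Multiset.le_iff_count.1 h x
  rw [Multiset.count_add] at h1
  by_cases hx : x ∈ A
  · have : x ∉ B := fun hb => Multiset.disjoint_left.1 hd hx hb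
    rw [Multiset.count_eq_zero_of_notMem this] at h1
    omega
  · rw [Multiset.count_eq_zero_of_notMem hx]; omega

theorem pair_add {α : Type*} (p r : α) (M : Multiset α) :
    ({p, r} : Multiset α) + M = p ::ₘ r ::ₘ M := by
  rw [Multiset.insert_eq_cons, Multiset.cons_add, Multiset.singleton_add]

/-- An array of two-element multisets satisfying the exchange relation splits. -/
theorem split_of_exchange {I J α : Type*} {M : I → J → Multiset α}
    (hM : ∀ i j, Multiset.card (M i j) = 2)
    (hex : ∀ i i' j j', M i j + M i' j' = M i j' + M i' j) :
    (∃ (F : I → α) (G : J → α), ∀ i j, M i j = {F i, G j}) ∨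
      (∀ i j j', M i j = M i j') ∨ (∀ i i' j, M i j = M i' j) := by
  by_contra hcon
  push Not at hcon
  obtain ⟨hF, ⟨i₀, j₀, j₁, hne⟩, ⟨a, b, j₂, hab⟩⟩ := hcon
  rcases pair_cases_of_ne (hM _ _) (hM _ _) hne with hd | ⟨p, r, f, hpr, hp, hr⟩
  · have h1 : ∀ i, M i j₀ = M i₀ j₀ := fun i =>
      eq_of_le_add_of_disjoint (hM _ _) (hM _ _) hd (by
        rw [hex i i₀ j₀ j₁]; exact Multiset.le_add_left _ _)
    have h2 := hex a b j₀ j₂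
    rw [h1 a, h1 b, add_comm] at h2
    exact hab (add_right_cancel h2).symm
  · have h1 : ∀ i, ∃ g, M i j₀ = {p, g} := by
      intro i
      have h2 := hex i i₀ j₀ j₁
      rw [hp, hr] at h2
      have h3 : M i j₀ + {r} = M i j₁ + {p} := by
        have : M i j₀ + {r} + {f} = M i j₁ + {p} + {f} := by
          rw [add_assoc, add_assoc]; exact h2
        exact add_right_cancel this
      have h4 : p ∈ M i j₀ + {r} := by rw [h3]; simp
      rw [Multiset.mem_add, Multiset.mem_singleton] at h4
      have h5 : p ∈ M i j₀ := h4.resolve_right hpr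
      obtain ⟨c, d, hcd⟩ := Multiset.card_eq_two.1 (hM i j₀)
      rw [hcd] at h5 ⊢
      simp only [Multiset.mem_cons, Multiset.insert_eq_cons, Multiset.mem_singleton] at h5
      rcases h5 with rfl | rfl
      · exact ⟨d, rfl⟩
      · exact ⟨c, Multiset.pair_comm _ _⟩
    choose F hF' using h1
    have cancel : ∀ (i i' : I) (j : J), F i' ::ₘ M i j = F i ::ₘ M i' j := by
      intro i i' j
      have h2 := hex i i' j j₀
      rw [hF', hF'] at h2
      refine (Multiset.cons_inj_right p).1 ?_
      calc p ::ₘ F i' ::ₘ M i j = M i j + {p, F i'} := by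
            rw [add_comm, pair_add]
        _ = {p, F i} + M i' j := h2
        _ = _ := pair_add _ _ _
    have hFab : F a ≠ F b := by
      intro h
      have := cancel a b j₂
      rw [h] at this
      exact hab ((Multiset.cons_inj_right _).1 this)
    have h3 : ∀ j, ∃ g, M a j = {F a, g} := by
      intro j
      have h4 : F a ∈ F b ::ₘ M a j := by rw [cancel a b j]; simp
      rw [Multiset.mem_cons] at h4
      have h5 : F a ∈ M a j := h4.resolve_left hFab
      obtain ⟨c, d, hcd⟩ := Multiset.card_eq_two.1 (hM a j)
      rw [hcd] at h5 ⊢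
      simp only [Multiset.mem_cons, Multiset.insert_eq_cons, Multiset.mem_singleton] at h5
      rcases h5 with h | h
      · exact ⟨d, by rw [h]⟩
      · exact ⟨c, by rw [h, Multiset.pair_comm]⟩
    choose G hG using h3
    refine hF F G |>.elim fun i ⟨j, hij⟩ => hij ?_
    have := cancel a i j
    rw [hG] at this
    refine (Multiset.cons_inj_right (F a)).1 (this.symm.trans ?_)
    exact Multiset.cons_swap _ _ _

namespace ICGroup

variable {T : Type u} {X : ICGroup T}

theorem inSeriesA_of_hom {A : Type u} [CommGroup A] {π : A → T} (hs : Function.Surjective π)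
    (h1 : π 1 = X.e) (hm : ∀ a b, X.mul (π a) (π b) = {π (a * b), π (a * b⁻¹)})
    (hk : ∀ a, π a = X.e → a = 1) : InSeriesA X.toTwoValuedGroup := by
  have hinv : ∀ a, π a⁻¹ = π a := by
    intro a
    have := hm 1 a
    rw [h1, X.e_mul, pair_eq_pair, one_mul, one_mul] at this
    rcases this with h | h
    · exact h.2.symm
    · exact h.1.symm
  refine ⟨A, inferInstance, π, hs, h1, hinv, ?_, hm, fun a => by rw [X.invol, hinv]⟩
  intro a b hab
  have : X.e ∈ X.mul (π a) (π b) := X.e_mem_mul_iff.2 hab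
  rw [hm] at this
  simp only [Multiset.mem_cons, Multiset.insert_eq_cons, Multiset.mem_singleton] at this
  rcases this with h | h
  · right
    rw [eq_comm, inv_eq_iff_mul_eq_one]
    exact hk _ h.symm
  · left
    have := hk _ h.symm
    exact (mul_inv_eq_one.1 this).symm

theorem inSeriesA_of_q_eq (h : ∀ x, X.q x = X.e) : InSeriesA X.toTwoValuedGroup := by
  refine inSeriesA_of_hom (A := X.E) (π := E.val) (fun x => exists_E (h x)) rfl ?_
    (fun a ha => E.ext ha)
  intro a b
  rw [mul_val]
  rfl

end ICGroup

namespace ICGroup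

variable {T : Type u} {X : ICGroup T}

theorem chis_bind_mul (P : X.Pt) (z : T) (M : Multiset T) :
    X.chis P (M.bind (X.mul z)) = 2 * X.chi P z * X.chis P M := by
  induction M using Multiset.induction with
  | empty => simp [chis]
  | cons a M ih => rw [Multiset.cons_bind, chis_add, chis_cons, ih, chis_mul]; ring

variable (X) in
/-- The points at which the square of `x₀` is not trivial. -/
abbrev GP (x₀ : T) : Type u := {P : X.Pt // X.chi P x₀ ^ 2 ≠ 1}

theorem eq_of_chis_good {x₀ : T} {M N : Multiset T}
    (h : ∀ P : X.GP x₀, X.chis P.1 M = X.chis P.1 N) :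
    M + M + N.bind (X.mul (X.q x₀)) = N + N + M.bind (X.mul (X.q x₀)) :=
  X.eq_of_chis fun P => by
    simp only [chis_add, chis_bind_mul, chi_q]
    by_cases hP : X.chi P x₀ ^ 2 = 1
    · linear_combination 4 * (X.chis P N - X.chis P M) * hP
    · rw [h ⟨P, hP⟩]

theorem eq_of_chi_good {x₀ : T} (h₀ : X.q (X.q x₀) ≠ X.e) {x y : T}
    (h : ∀ P : X.GP x₀, X.chi P.1 x = X.chi P.1 y) : x = y := by
  classical
  by_contra hxy
  have h1 := eq_of_chis_good (X := X) (x₀ := x₀) (M := {x}) (N := {y})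
    (fun P => by rw [chis_singleton, chis_singleton, h])
  rw [Multiset.singleton_bind, Multiset.singleton_bind] at h1
  obtain ⟨a, b, hab⟩ := X.exists_pair (X.q x₀) x
  have : a = x ∧ b = x := by
    rw [hab] at h1
    have c1 := congrArg (Multiset.count x) h1
    simp only [Multiset.insert_eq_cons, Multiset.count_add, Multiset.count_cons,
      Multiset.count_singleton] at c1
    grind
  obtain ⟨rfl, rfl⟩ := this
  exact h₀ (q_eq_e_of_mul_eq hab)

theorem exists_unit_add_inv {K : Type*} [Field K] [IsAlgClosed K] (c : K) :
    ∃ s : Kˣ, (s : K) + (s⁻¹ : Kˣ) = 2 * c := by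
  obtain ⟨d, hd⟩ := IsAlgClosed.exists_eq_mul_self (c ^ 2 - 1)
  have h : (c + d) * (c - d) = 1 := by linear_combination hd
  exact ⟨⟨c + d, c - d, h, by rw [mul_comm, h]⟩, by simp; ring⟩

variable (X) in
/-- The group of families of units over the good points. -/
abbrev Gr (x₀ : T) : Type u := ∀ P : X.GP x₀, (X.Fld P.1)ˣ

theorem exists_root (x₀ : T) : ∃ s : X.Gr x₀, ∀ P, (s P : X.Fld P.1) + ((s P)⁻¹ : (X.Fld P.1)ˣ) =
    2 * X.chi P.1 x₀ := by
  choose s hs using fun P : X.GP x₀ => exists_unit_add_inv (X.chi P.1 x₀)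
  exact ⟨s, hs⟩

/-- The element `y` has the values `(β + β⁻¹) / 2` at all good points. -/
def Rep {x₀ : T} (β : X.Gr x₀) (y : T) : Prop :=
  ∀ P, (β P : X.Fld P.1) + ((β P)⁻¹ : (X.Fld P.1)ˣ) = 2 * X.chi P.1 y

theorem Rep.unique {x₀ : T} (h₀ : X.q (X.q x₀) ≠ X.e) {β : X.Gr x₀} {y y' : T} (h : Rep β y)
    (h' : Rep β y') : y = y' :=
  eq_of_chi_good h₀ fun P => mul_left_cancel₀ (X.two_ne_zero' P.1) (by rw [← h P, ← h' P])

theorem Rep.inv {x₀ : T} {β : X.Gr x₀} {y : T} (h : Rep β y) : Rep β⁻¹ y := fun P => by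
  rw [← h P, Pi.inv_apply, inv_inv, add_comm]

theorem Rep.next {x₀ : T} {s β : X.Gr x₀} (hs : Rep s x₀) {y z z' : T} (h : Rep β y)
    (hz : Rep (β * s) z) (hm : X.mul x₀ y = {z, z'}) : Rep (β * s⁻¹) z' := fun P => by
  have h1 := h P
  have h2 := hz P
  have h3 := chi_pair hm P.1
  have h4 := hs P
  simp only [Pi.mul_apply, Pi.inv_apply, mul_inv, inv_inv, Units.val_mul] at *
  linear_combination -2 * h3 - h2 + 2 * X.chi P.1 x₀ * h1 +
    ((β P : X.Fld P.1) + ((β P)⁻¹ : (X.Fld P.1)ˣ)) * h4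

/-- Families of units whose translates by `s` are compatible with multiplication by `x₀`. -/
def Adm {x₀ : T} (s β : X.Gr x₀) : Prop :=
  ∃ y z z', Rep β y ∧ Rep (β * s) z ∧ Rep (β * s⁻¹) z' ∧ X.mul x₀ y = {z, z'}

theorem Adm.inv {x₀ : T} {s β : X.Gr x₀} (h : Adm s β) : Adm s β⁻¹ := by
  obtain ⟨y, z, z', hy, hz, hz', hm⟩ := h
  refine ⟨y, z', z, hy.inv, ?_, ?_, by rw [hm, Multiset.pair_comm]⟩
  · have := hz'.inv
    rwa [mul_inv, inv_inv] at this
  · have := hz.inv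
    rwa [mul_inv] at this

theorem Adm.mul_root {x₀ : T} {s β : X.Gr x₀} (hs : Rep s x₀) (h : Adm s β) : Adm s (β * s) := by
  obtain ⟨y, z, z', hy, hz, hz', hm⟩ := h
  have hzm : z ∈ X.mul x₀ y := by rw [hm]; simp
  obtain ⟨y', hy'⟩ := X.exists_pair_of_mem (mem_rot (mem_comm hzm) : y ∈ X.mul x₀ z)
  have h1 : Rep (β * s * s⁻¹) y := by rwa [mul_inv_cancel_right]
  refine ⟨z, y', y, hz, ?_, h1, by rw [hy', Multiset.pair_comm]⟩
  have := Rep.next hs.inv hz h1 hy'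
  rwa [inv_inv] at this

theorem Adm.mul_zpow {x₀ : T} {s β : X.Gr x₀} (hs : Rep s x₀) (h : Adm s β) (k : ℤ) :
    Adm s (β * s ^ k) := by
  induction k using Int.induction_on with
  | zero => simpa using h
  | succ i hi =>
    rw [zpow_add_one, ← mul_assoc]
    exact hi.mul_root hs
  | pred i hi =>
    have := (hi.inv.mul_root hs).inv
    rwa [mul_inv, inv_inv, mul_assoc, ← zpow_sub_one] at this

theorem adm_one {x₀ : T} {s : X.Gr x₀} (hs : Rep s x₀) : Adm s 1 := by
  refine ⟨X.e, x₀, x₀, fun P => ?_, by rwa [one_mul], by rw [one_mul]; exact hs.inv, X.mul_e x₀⟩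
  rw [chi_e]
  simp
  norm_num

theorem GP.root_sq_ne {x₀ : T} {s : X.Gr x₀} (hs : Rep s x₀) (P : X.GP x₀) :
    (s P : X.Fld P.1) - ((s P)⁻¹ : (X.Fld P.1)ˣ) ≠ 0 := by
  intro h
  have h1 := hs P
  refine P.2 ?_
  refine mul_left_cancel₀ (X.two_ne_zero' P.1) (mul_left_cancel₀ (X.two_ne_zero' P.1) ?_)
  linear_combination -(2 * X.chi P.1 x₀ + (s P : X.Fld P.1) + ((s P)⁻¹ : (X.Fld P.1)ˣ)) * h1 +
    4 * (s P).mul_inv +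
    ((s P : X.Fld P.1) - ((s P)⁻¹ : (X.Fld P.1)ˣ)) * h

theorem exists_adm {x₀ : T} (h₀ : X.q (X.q x₀) ≠ X.e) {s : X.Gr x₀} (hs : Rep s x₀) (y : T) :
    ∃ β, Adm s β ∧ Rep β y := by
  obtain ⟨z, z', hz⟩ := X.exists_pair x₀ y
  have hex : ∀ P : X.GP x₀, ∃ b : (X.Fld P.1)ˣ, (b : X.Fld P.1) + (b⁻¹ : (X.Fld P.1)ˣ) =
      2 * X.chi P.1 y ∧
      (b : X.Fld P.1) * s P + (b⁻¹ : (X.Fld P.1)ˣ) * ((s P)⁻¹ : (X.Fld P.1)ˣ) =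
      2 * X.chi P.1 z := by
    intro P
    have hd := GP.root_sq_ne hs P
    have h1 := hs P
    have h2 := chi_pair hz P.1
    have h3 := chi_mul_chi_of_exists h₀ hz P.1
    have hss := (s P).mul_inv
    set c := X.chi P.1 x₀
    set a := (s P : X.Fld P.1)
    set a' := (((s P)⁻¹ : (X.Fld P.1)ˣ) : X.Fld P.1)
    set η : X.Fld P.1 := 2 * (X.chi P.1 z - c * X.chi P.1 y) / (a - a') with hη
    have hη' : η * (a - a') = 2 * (X.chi P.1 z - c * X.chi P.1 y) := by
      rw [hη]; field_simp
    have h4 : (X.chi P.1 y + η) * (X.chi P.1 y - η) = 1 := by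
      refine mul_right_cancel₀ (pow_ne_zero 2 hd) ?_
      linear_combination 4 * h3 - 4 * X.chi P.1 z * h2 -
        (η * (a - a') + 2 * (X.chi P.1 z - c * X.chi P.1 y)) * hη' +
        (X.chi P.1 y ^ 2 - 1) * ((a + a' + 2 * c) * h1 - 4 * hss)
    refine ⟨⟨_, _, h4, by rw [mul_comm, h4]⟩, ?_, ?_⟩
    · simp; ring
    · simp only [Units.inv_mk]
      linear_combination hη' + X.chi P.1 y * h1
  choose β hβ hβ' using hex
  have r1 : Rep (β * s) z := fun P => by
    rw [← hβ' P]
    simp [mul_comm]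
  exact ⟨β, ⟨y, z, z', hβ, r1, Rep.next hs hβ r1 hz, hz⟩, hβ⟩

end ICGroup

/-- The trace `u + u⁻¹` of a unit. -/
def utr {K : Type*} [Field K] (u : Kˣ) : K := u + (u⁻¹ : Kˣ)

theorem utr_mul_utr {K : Type*} [Field K] (u v : Kˣ) :
    utr u * utr v = utr (u * v) + utr (u * v⁻¹) := by
  simp only [utr, mul_inv, inv_inv, Units.val_mul]; ring

theorem utr_mul_mul_utr_mul_inv {K : Type*} [Field K] (u v : Kˣ) :
    utr (u * v) * utr (u * v⁻¹) = utr u ^ 2 + utr v ^ 2 - 4 := by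
  simp only [utr, mul_inv, inv_inv, Units.val_mul]
  linear_combination (((v : K)) ^ 2 + ((v⁻¹ : Kˣ) : K) ^ 2 - 2) * u.mul_inv +
    ((u : K) ^ 2 + ((u⁻¹ : Kˣ) : K) ^ 2 - 2) * v.mul_inv

theorem utr_eq_zero_of_const {K : Type*} [Field K] {d s : Kˣ}
    (hs : (s : K) - (s⁻¹ : Kˣ) ≠ 0) (h1 : utr (d * s ^ (2 : ℤ)) = utr d)
    (h2 : utr (d * s ^ (-2 : ℤ)) = utr d) : utr s = 0 ∧ utr d = 0 := by
  have hss := s.mul_inv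
  have hdd := d.mul_inv
  rw [zpow_neg] at h2
  have hz : s ^ (2 : ℤ) = s * s := zpow_two s
  rw [hz] at h1 h2
  simp only [utr, mul_inv, inv_inv, Units.val_mul] at *
  set a := (s : K)
  set a' := ((s⁻¹ : Kˣ) : K)
  set b := (d : K)
  set b' := ((d⁻¹ : Kˣ) : K)
  have e1 : b * a = b' * a' := by
    refine mul_left_cancel₀ hs ?_
    linear_combination h1 - (b + b') * hss
  have e2 : b * a' = b' * a := by
    refine mul_left_cancel₀ hs ?_
    linear_combination -h2 + (b + b') * hss
  have hb : b ≠ 0 := d.ne_zero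
  have ha : a ≠ 0 := s.ne_zero
  have e3 : a + a' = 0 := by
    refine mul_left_cancel₀ hs (mul_left_cancel₀ hb ?_)
    linear_combination a * e1 - a' * e2
  refine ⟨e3, mul_right_cancel₀ ha ?_⟩
  linear_combination e1 + b' * e3

namespace ICGroup

variable {T : Type u} {X : ICGroup T}

theorem Rep.utr_eq {x₀ : T} {β : X.Gr x₀} {y : T} (h : Rep β y) (P : X.GP x₀) :
    utr (β P) = 2 * X.chi P.1 y := h P

theorem exists_good_chi_ne_zero {x₀ : T} (h₀ : X.q (X.q x₀) ≠ X.e) :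
    ∃ P : X.GP x₀, X.chi P.1 x₀ ≠ 0 := by
  by_contra hcon
  push Not at hcon
  refine h₀ (eq_of_chi_good h₀ fun P => ?_)
  rw [chi_q, chi_q, hcon P, chi_e]
  ring

/-- A sequence of elements representing the translates of `β` by powers of `s`. -/
def IsSeq {x₀ : T} (s β : X.Gr x₀) (φ : ℤ → T) : Prop :=
  (∀ k, Rep (β * s ^ k) (φ k)) ∧ ∀ k, X.mul x₀ (φ k) = {φ (k + 1), φ (k - 1)}

theorem Adm.exists_seq {x₀ : T} (h₀ : X.q (X.q x₀) ≠ X.e) {s β : X.Gr x₀} (hs : Rep s x₀)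
    (h : Adm s β) : ∃ φ, IsSeq s β φ := by
  choose y z z' hy hz hz' hm using fun k => h.mul_zpow hs k
  refine ⟨y, hy, fun k => ?_⟩
  rw [hm k]
  congr 1
  · refine Rep.unique h₀ (hz k) ?_
    rw [mul_assoc, ← zpow_add_one]
    exact hy (k + 1)
  · congr 1
    refine Rep.unique h₀ (hz' k) ?_
    rw [mul_assoc, ← zpow_sub_one]
    exact hy (k - 1)

theorem IsSeq.chi_add {x₀ : T} {s β : X.Gr x₀} {φ : ℤ → T} (h : IsSeq s β φ) (P : X.Pt) (k : ℤ) :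
    X.chi P (φ (k + 1)) + X.chi P (φ (k - 1)) = 2 * X.chi P x₀ * X.chi P (φ k) :=
  chi_pair (h.2 k) P

theorem IsSeq.exchange {x₀ : T} {s β γ : X.Gr x₀} {φ ψ : ℤ → T} (hφ : IsSeq s β φ)
    (hψ : IsSeq s γ ψ) (i i' j j' : ℤ) :
    X.mul (φ (i + j)) (ψ (i - j)) + X.mul (φ (i' + j')) (ψ (i' - j')) =
      X.mul (φ (i + j')) (ψ (i - j')) + X.mul (φ (i' + j)) (ψ (i' - j)) :=
  X.eq_of_chis fun P => by
    simp only [chis_add]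
    refine exchange_of_adjacent (f := fun i j => X.chis P (X.mul (φ (i + j)) (ψ (i - j)))) ?_ _ _ _ _
    intro i j
    simp only [chis_mul]
    have h1 := hφ.chi_add P (i + j - 1)
    have h2 := hψ.chi_add P (i - j)
    rw [show i + j - 1 + 1 = i + j by ring, show i + j - 1 - 1 = i - 1 + (j - 1) by ring] at h1
    rw [show i - j + 1 = i - (j - 1) by ring, show i - j - 1 = i - 1 - j by ring] at h2
    rw [show i - 1 - (j - 1) = i - j by ring, show i + (j - 1) = i + j - 1 by ring,
      show i - 1 + j = i + j - 1 by ring]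
    linear_combination 2 * X.chi P (ψ (i - j)) * h1 - 2 * X.chi P (φ (i + j - 1)) * h2

theorem IsSeq.utr_add {x₀ : T} {s β γ : X.Gr x₀} {φ ψ : ℤ → T} (hφ : IsSeq s β φ)
    (hψ : IsSeq s γ ψ) (P : X.GP x₀) (i j : ℤ) :
    utr (β P * γ P * s P ^ (2 * i)) + utr (β P * (γ P)⁻¹ * s P ^ (2 * j)) =
      4 * X.chi P.1 (φ (i + j)) * X.chi P.1 (ψ (i - j)) ∧
    utr (β P * γ P * s P ^ (2 * i)) * utr (β P * (γ P)⁻¹ * s P ^ (2 * j)) =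
      4 * (X.chi P.1 (φ (i + j)) ^ 2 + X.chi P.1 (ψ (i - j)) ^ 2 - 1) := by
  have h1 := (hφ.1 (i + j)).utr_eq P
  have h2 := (hψ.1 (i - j)).utr_eq P
  simp only [Pi.mul_apply, Pi.pow_apply] at h1 h2
  have e1 : β P * s P ^ (i + j) * (γ P * s P ^ (i - j)) = β P * γ P * s P ^ (2 * i) := by
    rw [mul_mul_mul_comm, ← zpow_add]; congr 2; ring
  have e2 : β P * s P ^ (i + j) * (γ P * s P ^ (i - j))⁻¹ = β P * (γ P)⁻¹ * s P ^ (2 * j) := by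
    rw [mul_inv, mul_mul_mul_comm, ← zpow_neg, ← zpow_add]; congr 2; ring
  rw [← e1, ← e2]
  constructor
  · rw [← utr_mul_utr, h1, h2]; ring
  · rw [utr_mul_mul_utr_mul_inv, h1, h2]; ring

theorem IsSeq.exists_mul_eq {x₀ : T} (h₀ : X.q (X.q x₀) ≠ X.e) {s β γ : X.Gr x₀} (hs : Rep s x₀)
    {φ ψ : ℤ → T} (hφ : IsSeq s β φ) (hψ : IsSeq s γ ψ) :
    ∃ w v, X.mul (φ 0) (ψ 0) = {w, v} ∧ Rep (β * γ) w ∧ Rep (β * γ⁻¹) v := by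
  obtain ⟨P₀, hP₀⟩ := exists_good_chi_ne_zero h₀
  have hP₀' : utr (s P₀) ≠ 0 := by
    rw [hs.utr_eq]; exact mul_ne_zero (X.two_ne_zero' _) hP₀
  have hsum : ∀ i j (P : X.GP x₀), 2 * X.chis P.1 (X.mul (φ (i + j)) (ψ (i - j))) =
      utr (β P * γ P * s P ^ (2 * i)) + utr (β P * (γ P)⁻¹ * s P ^ (2 * j)) := by
    intro i j P
    rw [(hφ.utr_add hψ P i j).1, chis_mul]; ring
  rcases split_of_exchange (M := fun i j => X.mul (φ (i + j)) (ψ (i - j)))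
      (fun _ _ => X.card_mul _ _) (hφ.exchange hψ) with ⟨F, G, hFG⟩ | hb | hc
  · have key : ∀ P : X.GP x₀, 2 * X.chi P.1 (F 0) = utr (β P * γ P) := by
      intro P
      by_contra hne
      have e1 : ∀ i j, 2 * X.chi P.1 (F i) + 2 * X.chi P.1 (G j) =
          utr (β P * γ P * s P ^ (2 * i)) + utr (β P * (γ P)⁻¹ * s P ^ (2 * j)) := by
        intro i j
        rw [← hsum, hFG, chis_pair]; ring
      have e2 : ∀ i j, 2 * X.chi P.1 (F i) * (2 * X.chi P.1 (G j)) =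
          utr (β P * γ P * s P ^ (2 * i)) * utr (β P * (γ P)⁻¹ * s P ^ (2 * j)) := by
        intro i j
        rw [(hφ.utr_add hψ P i j).2, ← chi_mul_chi_of_exists h₀ (hFG i j)]; ring
      have hd := GP.root_sq_ne hs P
      have f1 := e1 0 0
      have f2 := e1 0 1
      have f3 := e1 0 (-1)
      have f4 := e1 1 0
      have f5 := e1 (-1) 0
      have g1 := e2 0 0
      have g2 := e2 0 1
      have g3 := e2 0 (-1)
      have g4 := e2 1 0
      have g5 := e2 (-1) 0
      simp only [mul_zero, zpow_zero, mul_one, mul_neg] at f1 f2 f3 f4 f5 g1 g2 g3 g4 g5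
      have hne' := sub_ne_zero.2 hne
      have k1 : 2 * X.chi P.1 (F 0) = utr (β P * (γ P)⁻¹) :=
        mul_left_cancel₀ hne' (by linear_combination 2 * X.chi P.1 (F 0) * f1 - g1)
      have k2 : 2 * X.chi P.1 (F 0) = utr (β P * (γ P)⁻¹ * s P ^ (2 : ℤ)) :=
        mul_left_cancel₀ hne' (by linear_combination 2 * X.chi P.1 (F 0) * f2 - g2)
      have k3 : 2 * X.chi P.1 (F 0) = utr (β P * (γ P)⁻¹ * s P ^ (-2 : ℤ)) :=
        mul_left_cancel₀ hne' (by linear_combination 2 * X.chi P.1 (F 0) * f3 - g3)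
      have z1 := (utr_eq_zero_of_const hd (k2.symm.trans k1) (k3.symm.trans k1)).2
      have k4 : 2 * X.chi P.1 (G 0) = utr (β P * γ P * s P ^ (2 : ℤ)) := by
        refine mul_left_cancel₀ hne' ?_
        linear_combination (2 * X.chi P.1 (G 0) - utr (β P * γ P * s P ^ (2 : ℤ))) * f1
          + g4 - 2 * X.chi P.1 (G 0) * f4
      have k5 : 2 * X.chi P.1 (G 0) = utr (β P * γ P * s P ^ (-2 : ℤ)) := by
        refine mul_left_cancel₀ hne' ?_
        linear_combination (2 * X.chi P.1 (G 0) - utr (β P * γ P * s P ^ (-2 : ℤ))) * f1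
          + g5 - 2 * X.chi P.1 (G 0) * f5
      have k6 : 2 * X.chi P.1 (G 0) = utr (β P * γ P) := by linear_combination f1 - k1
      have z2 := (utr_eq_zero_of_const hd (k4.symm.trans k6) (k5.symm.trans k6)).2
      exact hne (by rw [z2, k1, z1])
    have h00 : X.mul (φ 0) (ψ 0) = {F 0, G 0} := by simpa using hFG 0 0
    refine ⟨F 0, G 0, h00, fun P => (key P).symm, fun P => ?_⟩
    have h1 := hsum 0 0 P
    simp only [mul_zero, zpow_zero, mul_one, add_zero, sub_zero] at h1
    rw [h00, chis_pair, ← key] at h1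
    change utr (β P * (γ P)⁻¹) = _
    linear_combination -h1
  · exfalso
    have h1 := hsum 0 0 P₀
    have h2 := hsum 0 1 P₀
    have h3 := hsum 0 (-1) P₀
    have b1 := hb 0 1 0
    have b2 := hb 0 (-1) 0
    rw [b1] at h2
    rw [b2] at h3
    simp only [mul_zero, zpow_zero, mul_one, mul_neg] at h1 h2 h3
    exact hP₀' (utr_eq_zero_of_const (d := β P₀ * (γ P₀)⁻¹) (GP.root_sq_ne hs P₀)
      (by linear_combination h1 - h2) (by linear_combination h1 - h3)).1
  · exfalso
    have h1 := hsum 0 0 P₀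
    have h2 := hsum 1 0 P₀
    have h3 := hsum (-1) 0 P₀
    have b1 := hc 1 0 0
    have b2 := hc (-1) 0 0
    rw [b1] at h2
    rw [b2] at h3
    simp only [mul_zero, zpow_zero, mul_one, mul_neg] at h1 h2 h3
    exact hP₀' (utr_eq_zero_of_const (d := β P₀ * γ P₀) (GP.root_sq_ne hs P₀)
      (by linear_combination h1 - h2) (by linear_combination h1 - h3)).1

end ICGroup

namespace ICGroup

variable {T : Type u} {X : ICGroup T}

theorem IsSeq.shift {x₀ : T} {s β : X.Gr x₀} {φ : ℤ → T} (h : IsSeq s β φ) (k : ℤ) :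
    IsSeq s (β * s ^ k) fun i => φ (k + i) := by
  refine ⟨fun i => ?_, fun i => ?_⟩
  · rw [mul_assoc, ← zpow_add]; exact h.1 _
  · rw [h.2, add_assoc, add_sub_assoc]

theorem eq_of_mul_root_eq {x₀ : T} (h₀ : X.q (X.q x₀) ≠ X.e) {w w' : T}
    (h : X.mul x₀ w = X.mul x₀ w') : w = w' := by
  classical
  by_contra hne
  have h1 : ({w, w} : Multiset T) + X.mul (X.q x₀) w = {w', w'} + X.mul (X.q x₀) w' :=
    X.eq_of_chis fun P => by
      have h2 := congrArg (X.chis P) h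
      simp only [chis_add, chis_pair, chis_mul, chi_q] at h2 ⊢
      linear_combination 2 * X.chi P x₀ * h2
  obtain ⟨a, b, hab⟩ := X.exists_pair (X.q x₀) w
  obtain ⟨a', b', hab'⟩ := X.exists_pair (X.q x₀) w'
  have h2 : a = w' ∧ b = w' ∧ a' = w ∧ b' = w := by
    rw [hab, hab'] at h1
    have c1 := congrArg (Multiset.count w) h1
    have c2 := congrArg (Multiset.count w') h1
    simp only [Multiset.insert_eq_cons, Multiset.count_add, Multiset.count_cons,
      Multiset.count_singleton] at c1 c2
    grind
  obtain ⟨rfl, rfl, rfl, rfl⟩ := h2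
  have h3 := mul_conj_of_exists h₀ hab
  have h4 := mul_conj_of_exists h₀ hab'
  rw [mul_self, pair_eq_pair] at h3 h4
  grind

theorem IsSeq.adm_mul {x₀ : T} (h₀ : X.q (X.q x₀) ≠ X.e) {s β γ : X.Gr x₀} (hs : Rep s x₀)
    {φ ψ : ℤ → T} (hφ : IsSeq s β φ) (hψ : IsSeq s γ ψ) : Adm s (β * γ) := by
  have hex : ∀ k l : ℤ, ∃ w v, X.mul (φ k) (ψ l) = {w, v} ∧
      Rep (β * γ * s ^ (k + l)) w ∧ Rep (β * γ⁻¹ * s ^ (k - l)) v := by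
    intro k l
    obtain ⟨w, v, h, hw, hv⟩ := (hφ.shift k).exists_mul_eq h₀ hs (hψ.shift l)
    refine ⟨w, v, by simpa using h, ?_, ?_⟩
    · rwa [mul_mul_mul_comm, ← zpow_add] at hw
    · rwa [mul_inv, mul_mul_mul_comm, ← zpow_neg, ← zpow_add, ← sub_eq_add_neg] at hv
  choose W₁ V₁ hWV hW₁ hV₁ using hex
  set W : ℤ → T := fun i => W₁ i 0 with hWd
  set V : ℤ → T := fun i => V₁ i 0 with hVd
  have hW : ∀ i, Rep (β * γ * s ^ i) (W i) := fun i => by simpa using hW₁ i 0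
  have hV : ∀ i, Rep (β * γ⁻¹ * s ^ i) (V i) := fun i => by simpa using hV₁ i 0
  have hm : ∀ k l, X.mul (φ k) (ψ l) = {W (k + l), V (k - l)} := fun k l => by
    rw [hWV, (hW₁ k l).unique h₀ (hW _), (hV₁ k l).unique h₀ (hV _)]
  have hdef : ∀ k (P : X.Pt), 2 * X.chi P x₀ * X.chi P (W (2 * k)) - X.chi P (W (2 * k + 1)) -
      X.chi P (W (2 * k - 1)) =
      X.chi P (V 1) + X.chi P (V (-1)) - 2 * X.chi P x₀ * X.chi P (V 0) := by
    intro k P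
    have e0 := chi_pair (hm k k) P
    have e1 := chi_pair (hm (k + 1) k) P
    have e2 := chi_pair (hm (k - 1) k) P
    have e3 := hφ.chi_add P k
    rw [show k + k = 2 * k by ring, sub_self] at e0
    rw [show k + 1 + k = 2 * k + 1 by ring, show k + 1 - k = 1 by ring] at e1
    rw [show k - 1 + k = 2 * k - 1 by ring, show k - 1 - k = -1 by ring] at e2
    linear_combination 2 * X.chi P x₀ * e0 - e1 - e2 - 2 * X.chi P (ψ k) * e3
  have hMN : ∀ k, X.mul x₀ (W (2 * k)) + {W 1, W (-1)} =
      ({W (2 * k + 1), W (2 * k - 1)} : Multiset T) + X.mul x₀ (W 0) := fun k =>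
    X.eq_of_chis fun P => by
      have e1 := hdef k P
      have e2 := hdef 0 P
      simp only [mul_zero, zero_add, zero_sub] at e2
      simp only [chis_add, chis_pair, chis_mul]
      linear_combination e1 - e2
  have hgood : ∀ P : X.GP x₀, X.chis P.1 (X.mul x₀ (W 0)) = X.chis P.1 {W 1, W (-1)} := by
    intro P
    have e0 := (hW 0).utr_eq P
    have e1 := (hW 1).utr_eq P
    have e2 := (hW (-1)).utr_eq P
    have e3 := hs.utr_eq P
    have e4 := utr_mul_utr ((β * γ) P) (s P)
    rw [chis_mul, chis_pair]
    refine mul_left_cancel₀ (X.two_ne_zero' P.1) ?_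
    simp only [zpow_zero, Pi.one_apply, mul_one, zpow_one, zpow_neg, Pi.mul_apply, Pi.inv_apply] at e0 e1 e2 e4
    linear_combination e4 - utr (s P) * e0 - 2 * X.chi P.1 (W 0) * e3 + e1 + e2
  have key : X.mul x₀ (W 0) = {W 1, W (-1)} := by
    by_contra hne
    rcases pair_cases_of_ne (X.card_mul _ _) (Multiset.card_pair _ _) hne with
      hd | ⟨p, r, f, hpr, hp, hr⟩
    · have hc : ∀ k, W (2 * k) = W 0 := fun k => by
        refine eq_of_mul_root_eq h₀ (eq_of_le_add_of_disjoint (X.card_mul _ _) (X.card_mul _ _) hd ?_)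
        rw [hMN]
        exact Multiset.le_add_left _ _
      obtain ⟨P₀, hP₀⟩ := exists_good_chi_ne_zero h₀
      have e0 := (hW 0).utr_eq P₀
      have e1 := (hW (2 * 1)).utr_eq P₀
      have e2 := (hW (2 * (-1))).utr_eq P₀
      rw [hc] at e1 e2
      simp only [zpow_zero, Pi.one_apply, mul_one, Pi.mul_apply, Pi.pow_apply] at e0 e1 e2
      have := (utr_eq_zero_of_const (GP.root_sq_ne hs P₀) (e1.trans e0.symm) (e2.trans e0.symm)).1
      rw [hs.utr_eq] at this
      exact mul_ne_zero (X.two_ne_zero' _) hP₀ this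
    · refine hpr (eq_of_chi_good h₀ fun P => ?_)
      have := hgood P
      rw [hp, hr, chis_pair, chis_pair] at this
      exact add_right_cancel this
  refine ⟨W 0, W 1, W (-1), ?_, ?_, ?_, key⟩
  · simpa using hW 0
  · simpa using hW 1
  · simpa using hW (-1)

/-- An element of order other than `1`, `2`, `4` forces the principal series. -/
theorem inSeriesA_of_q_q_ne {x₀ : T} (h₀ : X.q (X.q x₀) ≠ X.e) : InSeriesA X.toTwoValuedGroup := by
  obtain ⟨s, hs⟩ : ∃ s : X.Gr x₀, Rep s x₀ := exists_root x₀
  have hseq : ∀ {β : X.Gr x₀}, Adm s β → ∃ φ, IsSeq s β φ := fun h => h.exists_seq h₀ hs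
  let A : Subgroup (X.Gr x₀) :=
    { carrier := {β | Adm s β}
      one_mem' := adm_one hs
      mul_mem' := fun {a b} ha hb => by
        obtain ⟨φ, hφ⟩ := hseq ha
        obtain ⟨ψ, hψ⟩ := hseq hb
        exact hφ.adm_mul h₀ hs hψ
      inv_mem' := fun {a} ha => Adm.inv ha }
  have hrep : ∀ a : A, ∃ y, Rep a.1 y := fun a => by
    obtain ⟨y, -, -, hy, -⟩ := a.2
    exact ⟨y, hy⟩
  choose π hπ using hrep
  have h1 : π 1 = X.e := by
    refine Rep.unique h₀ (hπ 1) fun P => ?_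
    rw [chi_e]
    simp
    norm_num
  refine inSeriesA_of_hom (A := A) (π := π) ?_ h1 ?_ ?_
  · intro y
    obtain ⟨β, hβ, hy⟩ := exists_adm h₀ hs y
    exact ⟨⟨β, hβ⟩, Rep.unique h₀ (hπ _) hy⟩
  · intro a b
    obtain ⟨φ, hφ⟩ := hseq a.2
    obtain ⟨ψ, hψ⟩ := hseq b.2
    obtain ⟨w, v, h, hw, hv⟩ := hφ.exists_mul_eq h₀ hs hψ
    have e1 : φ 0 = π a := Rep.unique h₀ (by simpa using hφ.1 0) (hπ a)
    have e2 : ψ 0 = π b := Rep.unique h₀ (by simpa using hψ.1 0) (hπ b)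
    rw [← e1, ← e2, h, Rep.unique h₀ hw (hπ (a * b)), Rep.unique h₀ hv (hπ (a * b⁻¹))]
  · intro a ha
    refine Subtype.ext (funext fun P => Units.ext ?_)
    have h2 := hπ a P
    rw [ha, chi_e] at h2
    have h3 := (a.1 P).mul_inv
    have h4 : ((a.1 P : X.Fld P.1) - 1) ^ 2 = 0 := by
      linear_combination (a.1 P : X.Fld P.1) * h2 - h3
    have h5 := pow_eq_zero_iff (two_ne_zero) |>.1 h4
    simpa using sub_eq_zero.1 h5

end ICGroup

theorem exists_complement {G : Type*} [CommGroup G] (hG : IsBooleanGroup G) (D : Subgroup G) :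
    ∃ V : Subgroup G, (∀ g ∈ D, g ∈ V → g = 1) ∧ ∀ g, ∃ d ∈ D, ∃ v ∈ V, d * v = g := by
  let _ : Module (ZMod 2) (Additive G) := AddCommGroup.zmodModule fun x => by
    rw [two_nsmul]; exact hG x.toMul
  obtain ⟨q, hq⟩ := Submodule.exists_isCompl (AddSubgroup.toZModSubmodule 2 D.toAddSubgroup)
  refine ⟨(AddSubgroup.toSubgroup (q.toAddSubgroup)), fun g hg hv => ?_, fun g => ?_⟩
  · exact Submodule.disjoint_def.1 hq.disjoint (Additive.ofMul g) hg hv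
  · obtain ⟨d, hd, v, hv, h⟩ := Submodule.mem_sup.1
      (hq.sup_eq_top ▸ Submodule.mem_top : Additive.ofMul g ∈ _ ⊔ q)
    exact ⟨d.toMul, hd, v.toMul, hv, h⟩

namespace ICGroup

variable {T : Type u} {X : ICGroup T}

theorem mem_assoc {x y z t m : T} (ht : t ∈ X.mul x y) (hm : m ∈ X.mul t z) :
    ∃ r ∈ X.mul y z, m ∈ X.mul x r := by
  have h1 : m ∈ (X.mul x y).bind (fun t => X.mul t z) := Multiset.mem_bind.2 ⟨t, ht, hm⟩
  rw [X.assoc] at h1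
  exact Multiset.mem_bind.1 h1

theorem mul_smul_smul (g h : X.E) (x y : T) :
    X.mul (g • x) (h • y) = (X.mul x y).map ((g * h) • ·) := by
  rw [smul_mul, mul_smul', Multiset.map_map]
  simp [mul_smul]

theorem eq_smul_of_mem_val {g : X.E} {y z : T} (h : z ∈ X.mul g.val y) : z = g • y := by
  rw [mul_val] at h; simpa using h

section

variable (H : ∀ x, X.q (X.q x) = X.e)

/-- The square of an element, as an element with trivial square. -/
noncomputable def sqE (x : T) : X.E := ⟨X.q x, H x⟩

theorem sqE_val (x : T) : (sqE H x).val = X.q x := rfl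

variable {H}

theorem sqE_eq_iff {x y : T} : sqE H x = sqE H y ↔ X.q x = X.q y :=
  ⟨fun h => congrArg E.val h, fun h => E.ext h⟩

theorem sqE_eq_one_iff {x : T} : sqE H x = 1 ↔ X.q x = X.e :=
  ⟨fun h => congrArg E.val h, fun h => E.ext h⟩

theorem sqE_E (g : X.E) : sqE H g.val = 1 := sqE_eq_one_iff.2 g.q_val

theorem exists_E_of_sqE {x : T} (h : sqE H x = 1) : ∃ g : X.E, g.val = x :=
  exists_E (sqE_eq_one_iff.1 h)

theorem sqE_smul (g : X.E) (x : T) : sqE H (g • x) = sqE H x := sqE_eq_iff.2 (q_smul g x)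

theorem smul_eq_self_iff_sqE {g : X.E} {x : T} : g • x = x ↔ g = 1 ∨ g = sqE H x := by
  rw [smul_eq_self_iff]
  exact or_congr_right ⟨fun h => E.ext h, fun h => congrArg E.val h⟩

theorem sqE_smul_self (x : T) : sqE H x • x = x := smul_eq_self_iff_sqE.2 (Or.inr rfl)

theorem smul_eq_smul_iff {g h : X.E} {x : T} : g • x = h • x ↔ g = h ∨ g = h * sqE H x := by
  rw [← inv_smul_eq_iff, ← mul_smul, smul_eq_self_iff_sqE, inv_mul_eq_one, inv_mul_eq_iff_eq_mul,
    eq_comm (a := h)]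

theorem mul_eq_of_mem {x y z : T} (h : z ∈ X.mul x y) : X.mul x y = {z, sqE H x • z} := by
  obtain ⟨z', hz⟩ := X.exists_pair_of_mem h
  rw [hz]
  rcases mul_conj hz with h1 | ⟨h1, h2, -⟩
  · rw [eq_smul_of_mem (g := sqE H x) (x := z) (y := z') (by rw [h1, sqE_val]; simp)]
  · rw [h1, (sqE_eq_iff (H := H)).2 h2.symm, sqE_smul_self]

theorem mul_eq_of_mem' {x y z : T} (h : z ∈ X.mul x y) : X.mul x y = {z, sqE H y • z} := by
  rw [X.comm]; exact mul_eq_of_mem (mem_comm h)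

theorem smul_mem_of_mem {x y z : T} (h : z ∈ X.mul x y) : sqE H x • z ∈ X.mul x y := by
  rw [mul_eq_of_mem (H := H) h]; simp

theorem eq_or_of_mem {x y z z' : T} (h : z ∈ X.mul x y) (h' : z' ∈ X.mul x y) :
    z' = z ∨ z' = sqE H x • z := by
  rw [mul_eq_of_mem (H := H) h] at h'
  simpa using h'

theorem sqE_mul_or {x y z : T} (h : z ∈ X.mul x y) :
    sqE H x = sqE H y ∨ sqE H z = sqE H x * sqE H y := by
  have h1 := (mul_eq_of_mem (H := H) h).symm.trans (mul_eq_of_mem' (H := H) h)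
  have h2 : sqE H x • z = sqE H y • z := by
    rw [pair_eq_pair] at h1; grind
  rw [smul_eq_smul_iff (H := H)] at h2
  refine h2.imp_right fun h => ?_
  rw [h, mul_comm, ← mul_assoc, E.mul_self, one_mul]

theorem sqE_mul_or' {x y z : T} (h : z ∈ X.mul x y) :
    sqE H z = sqE H x * sqE H y ∨ (sqE H x = sqE H y ∧ sqE H z = sqE H x) := by
  rcases sqE_mul_or (H := H) h with h1 | h1
  · rcases sqE_mul_or (H := H) (mem_rot h) with h2 | h2
    · exact Or.inr ⟨h1, by rw [← h2, h1]⟩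
    · left
      have h3 : sqE H z = 1 := by
        rw [h1] at h2; exact mul_eq_left.1 h2.symm
      rw [h3, h1, E.mul_self]
  · exact Or.inl h1

/-- The existence of a special pair makes all nontrivial squares equal. -/
theorem sqE_eq_of_special {x y : T} (hx : sqE H x ≠ 1) (hxy : sqE H x = sqE H y)
    (ho : ∀ g : X.E, y ≠ g • x) (c : T) : sqE H c = 1 ∨ sqE H c = sqE H x := by
  by_contra! hc
  have hz : ∀ z ∈ X.mul x y, sqE H z = sqE H x := by
    intro z hz
    rcases sqE_mul_or' (H := H) hz with h | h
    · rw [hxy, E.mul_self] at h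
      obtain ⟨g, rfl⟩ := exists_E_of_sqE h
      exact absurd (eq_smul_of_mem hz) (ho g)
    · exact h.2
  obtain ⟨u, a, hu⟩ := X.exists_pair x c
  replace hu : u ∈ X.mul x c := by rw [hu]; simp
  obtain ⟨u', a', hu'⟩ := X.exists_pair c y
  replace hu' : u' ∈ X.mul c y := by rw [hu']; simp
  obtain ⟨m, a'', hm⟩ := X.exists_pair u u'
  replace hm : m ∈ X.mul u u' := by rw [hm]; simp
  have h1 : sqE H m = sqE H x := by
    obtain ⟨t, ht, hmt⟩ := mem_assoc hu hm
    obtain ⟨r, hr, htr⟩ := mem_assoc (mem_comm hu') (mem_comm ht)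
    rw [X.mul_self] at hr
    obtain ⟨g, rfl⟩ : ∃ g : X.E, g.val = r := by
      simp only [Multiset.mem_cons, Multiset.insert_eq_cons, Multiset.mem_singleton] at hr
      rcases hr with rfl | rfl
      · exact ⟨1, rfl⟩
      · exact ⟨sqE H c, rfl⟩
    rw [eq_smul_of_mem_val (mem_comm htr), mul_smul', Multiset.mem_map] at hmt
    obtain ⟨z, hz', rfl⟩ := hmt
    rw [sqE_smul, hz z hz']
  have h2 := sqE_mul_or (H := H) hu
  have h3 := sqE_mul_or (H := H) hu'
  have h4 := sqE_mul_or' (H := H) hm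
  have e1 : sqE H u = sqE H x * sqE H c := h2.resolve_left fun h => hc.2 h.symm
  have e2 : sqE H u' = sqE H x * sqE H c := by
    rw [hxy, mul_comm]; exact h3.resolve_left fun h => hc.2 (h.trans hxy.symm)
  rw [e1, e2, E.mul_self, h1] at h4
  rcases h4 with h4 | ⟨-, h4⟩
  · exact hx h4
  · exact hc.1 (mul_eq_left.1 h4.symm)

end

end ICGroup

namespace ICGroup

variable {T : Type u} {X : ICGroup T}

/-- Points where `s` has the value `1`. -/
abbrev KP (s : X.E) : Type u := {P : X.Pt // X.chi P s.val = 1}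

theorem eq_or_of_chi_kp {s : X.E} {x y : T} (h : ∀ P : KP s, X.chi P.1 x = X.chi P.1 y) :
    y = x ∨ y = s • x := by
  have h1 : ({x, s • x} : Multiset T) = {y, s • y} := X.eq_of_chis fun P => by
    rw [chis_pair, chis_pair, chi_smul, chi_smul]
    rcases mul_self_eq_one_iff.1 (by rw [← pow_two, s.sq P] : X.chi P s.val * X.chi P s.val = 1) with h1 | h1
    · rw [h ⟨P, h1⟩]
    · rw [h1]; ring
  have h2 : y ∈ ({x, s • x} : Multiset T) := by rw [h1]; simp
  simpa using h2

/-- If all nontrivial squares equal `s`, then the quotient by `s` is a Boolean group. -/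
theorem exists_boolean_quotient {H : ∀ x, X.q (X.q x) = X.e} {s : X.E}
    (hsq : ∀ c, sqE H c = 1 ∨ sqE H c = s) :
    ∃ (C : Type u) (_ : CommGroup C) (θ : T → C), Function.Surjective θ ∧ IsBooleanGroup C ∧
      (∀ {x y}, θ x = θ y → y = x ∨ y = s • x) ∧
      (∀ {x y z}, z ∈ X.mul x y → θ z = θ x * θ y) ∧ θ X.e = 1 ∧ θ s.val = 1 := by
  have hchi : ∀ (P : KP s) x, X.chi P.1 x * X.chi P.1 x = 1 := by
    intro P x
    have h1 := X.chi_q P.1 x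
    rw [← sqE_val H] at h1
    refine mul_left_cancel₀ (X.two_ne_zero' P.1) ?_
    rcases hsq x with h | h <;> rw [h] at h1
    · rw [E.val_one, chi_e] at h1; linear_combination -h1
    · rw [P.2] at h1; linear_combination -h1
  let θ : T → ∀ P : KP s, (X.Fld P.1)ˣ := fun x P =>
    ⟨X.chi P.1 x, X.chi P.1 x, hchi P x, hchi P x⟩
  have hθ : ∀ {x y}, θ x = θ y → y = x ∨ y = s • x := fun {x y} h =>
    eq_or_of_chi_kp fun P => congrArg Units.val (congrFun h P)
  have hθm : ∀ {x y z}, z ∈ X.mul x y → θ z = θ x * θ y := by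
    intro x y z hz
    refine funext fun P => Units.ext ?_
    change X.chi P.1 z = X.chi P.1 x * X.chi P.1 y
    have h1 := chi_pair (mul_eq_of_mem (H := H) hz) P.1
    refine mul_left_cancel₀ (X.two_ne_zero' P.1) ?_
    rw [chi_smul] at h1
    rcases hsq x with h | h <;> rw [h] at h1
    · rw [E.val_one, chi_e] at h1; linear_combination h1
    · rw [P.2] at h1; linear_combination h1
  have hθe : θ X.e = 1 := funext fun P => Units.ext (X.chi_e P.1)
  have hθss : θ s.val = 1 := funext fun P => Units.ext P.2
  have hθi : ∀ x, θ x * θ x = 1 := fun x => funext fun P => Units.ext (hchi P x)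
  let C : Subgroup (∀ P : KP s, (X.Fld P.1)ˣ) :=
    { carrier := Set.range θ
      one_mem' := ⟨X.e, hθe⟩
      mul_mem' := by
        rintro _ _ ⟨x, rfl⟩ ⟨y, rfl⟩
        obtain ⟨z, z', hz⟩ := X.exists_pair x y
        exact ⟨z, hθm (by rw [hz]; simp)⟩
      inv_mem' := by
        rintro _ ⟨x, rfl⟩
        exact ⟨x, eq_inv_of_mul_eq_one_left (hθi x)⟩ }
  refine ⟨C, inferInstance, fun x => ⟨θ x, x, rfl⟩, ?_, ?_, fun h => hθ (congrArg Subtype.val h),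
    fun h => Subtype.ext (hθm h), Subtype.ext hθe, Subtype.ext hθss⟩
  · rintro ⟨_, x, rfl⟩
    exact ⟨x, rfl⟩
  · rintro ⟨_, x, rfl⟩
    exact Subtype.ext (hθi x)

open Classical in
/-- Two-valued groups in which all nontrivial squares coincide are in the special series. -/
theorem inSeriesY_of_q_eq {H : ∀ x, X.q (X.q x) = X.e} {s : X.E} (hs : s ≠ 1)
    (hsq : ∀ c, sqE H c = 1 ∨ sqE H c = s) {x₁ x₂ : T} (hx₁ : sqE H x₁ = s) (hx₂ : sqE H x₂ = s)
    (ho : ∀ g : X.E, x₂ ≠ g • x₁) : InSeriesY X.toTwoValuedGroup := by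
  obtain ⟨C, _, θC, hCs, hC, hθC, hθCm, hθCe, hθCss⟩ := exists_boolean_quotient hsq
  have hθCs : ∀ (g : X.E) x, θC (g • x) = θC g.val * θC x := fun g x =>
    hθCm (by rw [mul_val]; simp)
  let D : Subgroup C :=
    { carrier := Set.range fun g : X.E => θC g.val
      one_mem' := ⟨1, hθCe⟩
      mul_mem' := by
        rintro _ _ ⟨g, rfl⟩ ⟨h, rfl⟩
        exact ⟨g * h, hθCs g h.val⟩
      inv_mem' := by
        rintro _ ⟨g, rfl⟩
        exact ⟨g, eq_inv_of_mul_eq_one_left (hC _)⟩ }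
  obtain ⟨V, hV₁, hV₂⟩ := exists_complement hC D
  obtain ⟨W, hW₁, hW₂⟩ := exists_complement X.isBooleanGroup_E (Subgroup.zpowers s)
  have hzs : ∀ {g : X.E}, g ∈ Subgroup.zpowers s → g = 1 ∨ g = s := by
    rintro _ ⟨k, rfl⟩
    simp only []
    obtain ⟨m, rfl | rfl⟩ := Int.even_or_odd' k
    · left; rw [zpow_mul, zpow_two, s.mul_self, one_zpow]
    · right; rw [zpow_add, zpow_mul, zpow_two, s.mul_self, one_zpow, one_mul, zpow_one]
  have hEs : ∀ {x}, (∃ g : X.E, θC x = θC g.val) → sqE H x = 1 := by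
    rintro x ⟨g, hg⟩
    rcases hθC hg.symm with h | h
    · rw [h, sqE_E]
    · rw [h, sqE_smul, sqE_E]
  have hσ : ∀ v : V, ∃ x, θC x = v ∧ (v = 1 → x = X.e) := by
    intro v
    by_cases hv : v = 1
    · exact ⟨X.e, by rw [hv, hθCe]; rfl, fun _ => rfl⟩
    · obtain ⟨x, hx⟩ := hCs v
      exact ⟨x, hx, fun h => absurd h hv⟩
  choose σ hσ₁ hσ₂ using hσ
  have hσe : σ 1 = X.e := hσ₂ 1 rfl
  have hσs : ∀ {v}, v ≠ 1 → sqE H (σ v) = s := by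
    intro v hv
    refine (hsq _).resolve_left fun h => hv ?_
    obtain ⟨g, hg⟩ := exists_E_of_sqE h
    refine Subtype.ext (hV₁ _ ⟨g, ?_⟩ v.2)
    rw [← hσ₁, ← hg]
  have hsσ : ∀ {v}, v ≠ 1 → s • σ v = σ v := fun {v} hv => by
    conv_lhs => rw [← hσs hv]
    exact sqE_smul_self _
  let τ : Option V → T := fun o => o.elim s.val σ
  have hτ : ∀ o, θC (τ o) = (o.getD 1 : V) := by
    rintro (_ | v)
    · exact hθCss
    · exact hσ₁ v
  have hτm : ∀ o o', X.mul (τ o) (τ o') = (mulY o o').map τ := by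
    have hns : ∀ v, X.mul s.val (σ v) = if v = 1 then {s.val, s.val} else {σ v, σ v} := by
      intro v
      rw [mul_val]
      split_ifs with h
      · rw [h, hσe, smul_e]
      · rw [hsσ h]
    rintro (_ | v) (_ | v')
    · change X.mul s.val s.val = _
      rw [X.mul_self, s.q_val]
      simp [mulY, τ, hσe]
    · change X.mul s.val (σ v') = _
      rw [hns]
      simp only [mulY]
      split_ifs <;> simp [τ]
    · change X.mul (σ v) s.val = _
      rw [X.comm, hns]
      simp only [mulY]
      split_ifs <;> simp [τ]
    · change X.mul (σ v) (σ v') = _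
      simp only [mulY]
      split_ifs with h1 h2
      · rw [← h1, h2, hσe, X.mul_e]; simp [τ, hσe]
      · rw [← h1, X.mul_self, ← sqE_val H, hσs h2]; simp [τ, hσe]
      · by_cases hv : v = 1
        · subst hv; rw [hσe, X.e_mul, one_mul]; simp [τ]
        by_cases hv' : v' = 1
        · subst hv'; rw [hσe, X.mul_e, mul_one]; simp [τ]
        have hvv : v * v' ≠ 1 := fun h => h1 (by
          rw [← mul_one v, ← (Subtype.ext (hC v'.1) : v' * v' = 1), ← mul_assoc, h, one_mul])
        obtain ⟨z, z', hz⟩ := X.exists_pair (σ v) (σ v')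
        have hall : ∀ z ∈ X.mul (σ v) (σ v'), z = σ (v * v') := by
          intro z hz
          have : θC (σ (v * v')) = θC z := by
            rw [hθCm hz, hσ₁, hσ₁, hσ₁]; rfl
          rcases hθC this with h | h
          · exact h
          · rw [h, hsσ hvv]
        have e1 := hall z (by rw [hz]; simp)
        have e2 := hall z' (by rw [hz]; simp)
        rw [hz, e1, e2]
        simp [τ]
  have hVV : ∀ {g g' : X.E} {v v' : V}, θC g.val * v = θC g'.val * v' → v = v' := by
    intro g g' v v' h
    have h2 : v.1 * v'.1⁻¹ = θC (g * g').val := by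
      rw [E.val_mul, hθCs, mul_inv_eq_iff_eq_mul, mul_assoc, ← h, ← mul_assoc, hC, one_mul]
    have := hV₁ (v.1 * v'.1⁻¹) ⟨g * g', h2.symm⟩ (V.mul_mem v.2 (V.inv_mem v'.2))
    exact Subtype.ext (mul_inv_eq_one.1 this)
  have hWW : ∀ {w w' : W}, w.1 * w'.1 = 1 ∨ w.1 * w'.1 = s → w = w' := by
    intro w w' h
    have h1 := hW₁ (w.1 * w'.1) (by
      rcases h with h | h
      · rw [h]; exact one_mem _
      · rw [h]; exact Subgroup.mem_zpowers s) (W.mul_mem w.2 w'.2)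
    refine Subtype.ext ?_
    rw [← mul_one w.1, ← w'.1.mul_self, ← mul_assoc, h1, one_mul]
  refine ⟨V, W, inferInstance, inferInstance, fun v => Subtype.ext (hC v.1),
    fun w => Subtype.ext (E.mul_self w.1), ?_, fun p => p.2.1 • τ p.1, ⟨?_, ?_⟩, ?_, ?_, ?_⟩
  · obtain ⟨_, ⟨g₁, rfl⟩, v₁, hv₁, h₁⟩ := hV₂ (θC x₁)
    obtain ⟨_, ⟨g₂, rfl⟩, v₂, hv₂, h₂⟩ := hV₂ (θC x₂)
    refine ⟨⟨v₁, hv₁⟩, ⟨v₂, hv₂⟩, fun h => ?_, fun h => ?_, fun h => ?_⟩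
    · have hv : v₁ = 1 := congrArg Subtype.val h
      rw [hv, mul_one] at h₁
      exact hs (hx₁.symm.trans (hEs ⟨g₁, h₁.symm⟩))
    · have hv : v₂ = 1 := congrArg Subtype.val h
      rw [hv, mul_one] at h₂
      exact hs (hx₂.symm.trans (hEs ⟨g₂, h₂.symm⟩))
    · have hv : v₁ = v₂ := congrArg Subtype.val h
      rw [hv] at h₁
      have h3 : θC ((g₂ * g₁) • x₁) = θC x₂ := by
        rw [hθCs, E.val_mul, hθCs, ← h₁, ← h₂]
        simp only []
        rw [mul_assoc, ← mul_assoc (θC g₁.val) _ v₂, hC, one_mul]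
      rcases hθC h3 with h | h
      · exact ho _ h
      · rw [← mul_smul] at h
        exact ho _ h
  · rintro ⟨o, w⟩ ⟨o', w'⟩ h
    simp only [] at h
    have h1 : o.getD 1 = o'.getD 1 := hVV (g := w.1) (g' := w'.1) (by
      rw [← hτ, ← hτ, ← hθCs, ← hθCs, h])
    have h2 : τ o = (w.1 * w'.1) • τ o' := by
      rw [mul_smul, ← h, smul_smul_self]
    have hE : ∀ {k g : X.E}, k.val = g • X.e → k = g := fun {k g} h => E.ext (by rw [h, smul_e])
    have hEs' : ∀ {k g : X.E}, k.val = g • s.val → k = g * s := fun {k g} h =>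
      E.ext (by rw [h, E.val_mul])
    have hw1 : ∀ {w w' : W}, w.1 * w'.1 ≠ s := fun {w w'} h => hs <| by
      have hw := hWW (Or.inr h)
      rw [← h, hw, E.mul_self]
    have hws : ∀ {w w' : W}, w.1 * w'.1 * s ≠ 1 := fun {w w'} h => hw1 (w := w) (w' := w') <| by
      rw [← mul_one s, ← h, mul_left_comm, E.mul_self, mul_one]
    rcases o with _ | v <;> rcases o' with _ | v'
    · have := hEs' (k := s) h2
      have hw : w = w' := hWW (Or.inl (by simpa using this.symm))
      rw [hw]
    · have hv : v' = 1 := h1.symm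
      change s.val = _ • σ v' at h2
      rw [hv, hσe] at h2
      exact absurd (hE h2).symm hw1
    · have hv : v = 1 := h1
      change σ v = _ at h2
      rw [hv, hσe] at h2
      exact absurd (hEs' (k := 1) h2).symm hws
    · have hv : v = v' := h1
      subst hv
      change σ v = _ • σ v at h2
      have hw : w = w' := by
        by_cases hv : v = 1
        · rw [hv, hσe] at h2
          exact hWW (Or.inl (hE (k := 1) h2).symm)
        · have := (smul_eq_self_iff_sqE (H := H)).1 h2.symm
          rw [hσs hv] at this
          exact hWW this
      rw [hw]
  · intro x
    obtain ⟨_, ⟨g, rfl⟩, v, hv, h₁⟩ := hV₂ (θC x)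
    have h2 : ∃ g : X.E, x = g • σ ⟨v, hv⟩ := by
      have : θC (g • σ ⟨v, hv⟩) = θC x := by rw [hθCs, hσ₁, ← h₁]
      rcases hθC this with h | h
      · exact ⟨g, h⟩
      · exact ⟨s * g, by rw [h, mul_smul]⟩
    obtain ⟨g, rfl⟩ := h2
    obtain ⟨d, hd, w, hw, rfl⟩ := hW₂ g
    rcases hzs hd with rfl | rfl
    · exact ⟨(some ⟨v, hv⟩, ⟨w, hw⟩), by simp [τ]⟩
    · by_cases h : (⟨v, hv⟩ : V) = 1
      · refine ⟨(none, ⟨w, hw⟩), ?_⟩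
        change w • d.val = _
        rw [h, hσe, smul_e, mul_comm, E.val_mul]
      · refine ⟨(some ⟨v, hv⟩, ⟨w, hw⟩), ?_⟩
        change w • σ _ = _
        rw [mul_comm, mul_smul, hsσ h]
  · change (1 : X.E) • σ 1 = _
    rw [one_smul, hσe]
  · intro o o' w w'
    change X.mul (w.1 • τ o) (w'.1 • τ o') = _
    rw [mul_smul_smul, hτm, Multiset.map_map]
    rfl
  · intro p
    exact X.invol _

end ICGroup

namespace ICGroup

variable {T : Type u} {X : ICGroup T} {H : ∀ x, X.q (X.q x) = X.e}

/-- Elements with equal squares differ by an element with trivial square. -/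
def NonSpecial (H : ∀ x, X.q (X.q x) = X.e) : Prop :=
  ∀ x y, sqE H x = sqE H y → ∃ g : X.E, y = g • x

theorem NonSpecial.sqE_mul (N : NonSpecial H) {x y z : T} (h : z ∈ X.mul x y) :
    sqE H z = sqE H x * sqE H y := by
  rcases sqE_mul_or' (H := H) h with h1 | ⟨h1, h2⟩
  · exact h1
  · obtain ⟨g, rfl⟩ := N x y h1
    rw [mul_smul', X.mul_self] at h
    have : sqE H z = 1 := by
      obtain ⟨k, hk, rfl⟩ := Multiset.mem_map.1 h
      rw [sqE_smul]
      simp only [Multiset.insert_eq_cons, Multiset.mem_cons, Multiset.mem_singleton] at hk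
      rcases hk with rfl | rfl
      · exact sqE_E 1
      · exact sqE_E (sqE H x)
    rw [sqE_smul, E.mul_self, this]

theorem chi_smul_mem {x y z : T} (h : z ∈ X.mul x y) (P : X.Pt) :
    X.chi P z * (1 + X.chi P (sqE H x).val) = 2 * X.chi P x * X.chi P y := by
  rw [← chi_pair (mul_eq_of_mem (H := H) h) P, chi_smul]; ring

theorem chi_sqE (P : X.Pt) (x : T) : X.chi P (sqE H x).val = 2 * X.chi P x ^ 2 - 1 := X.chi_q P x

section

variable {x₀ : T}

theorem chi_sqE_good (P : X.GP x₀) : X.chi P.1 (sqE H x₀).val = -1 := by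
  have h1 := (sqE H x₀).sq P.1
  have h2 := chi_sqE (H := H) P.1 x₀
  have h3 : (X.chi P.1 (sqE H x₀).val - 1) * (X.chi P.1 (sqE H x₀).val + 1) = 0 := by
    linear_combination h1
  rcases mul_eq_zero.1 h3 with h | h
  · refine absurd ?_ P.2
    exact mul_left_cancel₀ (X.two_ne_zero' P.1) (by linear_combination h - h2)
  · linear_combination h

theorem chi_good (H : ∀ x, X.q (X.q x) = X.e) (P : X.GP x₀) : X.chi P.1 x₀ = 0 := by
  have h2 := chi_sqE (H := H) P.1 x₀
  rw [chi_sqE_good] at h2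
  have h3 : 2 * X.chi P.1 x₀ ^ 2 = 0 := by linear_combination -h2
  simpa [X.two_ne_zero' P.1] using h3

theorem eq_or_of_chi_good (h₀ : sqE H x₀ ≠ 1) {y y' : T}
    (h : ∀ P : X.GP x₀, X.chi P.1 y = X.chi P.1 y') :
    y = y' ∨ (sqE H y = sqE H x₀ ∧ sqE H y' = sqE H x₀) := by
  classical
  have h1 := eq_of_chis_good (X := X) (x₀ := x₀) (M := {y}) (N := {y'})
    (fun P => by rw [chis_singleton, chis_singleton, h])
  rw [Multiset.singleton_bind, Multiset.singleton_bind, ← sqE_val H, mul_val, mul_val] at h1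
  have c1 := congrArg (Multiset.count y) h1
  have c2 := congrArg (Multiset.count y') h1
  simp only [Multiset.insert_eq_cons, Multiset.count_add, Multiset.count_cons,
    Multiset.count_singleton] at c1 c2
  by_cases hy : y = y'
  · exact Or.inl hy
  have e1 : sqE H x₀ • y = y := by grind
  have e2 : sqE H x₀ • y' = y' := by grind
  exact Or.inr ⟨((smul_eq_self_iff_sqE.1 e1).resolve_left h₀).symm,
    ((smul_eq_self_iff_sqE.1 e2).resolve_left h₀).symm⟩

theorem smul_sqE_eq (N : NonSpecial H) {y z : T} (h : z ∈ X.mul x₀ y) :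
    sqE H y • z = sqE H x₀ • z := by
  rw [smul_eq_smul_iff (H := H), N.sqE_mul h, ← mul_assoc, E.mul_self, one_mul]
  exact Or.inr rfl

/-- The sum and product relations of a pair `z ∈ x₀ * y` at good points. -/
theorem chi_sq_add (N : NonSpecial H) {y z : T} (h : z ∈ X.mul x₀ y) (P : X.GP x₀) :
    X.chi P.1 y ^ 2 + X.chi P.1 z ^ 2 = 1 ∧
      X.chi P.1 y ^ 2 - X.chi P.1 z ^ 2 = X.chi P.1 (sqE H y).val ∧
      X.chi P.1 y * X.chi P.1 z = 0 := by
  have h1 := chi_sqE (H := H) P.1 y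
  have h2 := chi_sqE (H := H) P.1 z
  rw [N.sqE_mul h, E.val_mul, chi_smul, chi_sqE_good] at h2
  have h2' := X.two_ne_zero' P.1
  have h3 := (sqE H y).sq P.1
  refine ⟨mul_left_cancel₀ h2' (by linear_combination -h1 - h2),
    mul_left_cancel₀ h2' (by linear_combination h2 - h1), ?_⟩
  have : (2 * X.chi P.1 y * X.chi P.1 z) ^ 2 = 0 := by
    have e1 : 2 * X.chi P.1 y ^ 2 = 1 + X.chi P.1 (sqE H y).val := by linear_combination -h1
    have e2 : 2 * X.chi P.1 z ^ 2 = 1 - X.chi P.1 (sqE H y).val := by linear_combination -h2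
    calc _ = (2 * X.chi P.1 y ^ 2) * (2 * X.chi P.1 z ^ 2) := by ring
      _ = 0 := by rw [e1, e2]; linear_combination -h3
  have := pow_eq_zero_iff (two_ne_zero) |>.1 this
  simpa [h2', mul_assoc] using this

theorem eq_of_pair_good (N : NonSpecial H) (h₀ : sqE H x₀ ≠ 1) {y z y' z' : T}
    (h : z ∈ X.mul x₀ y) (h' : z' ∈ X.mul x₀ y')
    (hy : ∀ P : X.GP x₀, X.chi P.1 y = X.chi P.1 y')
    (hz : ∀ P : X.GP x₀, X.chi P.1 z = X.chi P.1 z') : y = y' ∧ z = z' := by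
  have aux : ∀ {y z y' z' : T}, z ∈ X.mul x₀ y → z' ∈ X.mul x₀ y' →
      (∀ P : X.GP x₀, X.chi P.1 y = X.chi P.1 y') →
      (∀ P : X.GP x₀, X.chi P.1 z = X.chi P.1 z') → y = y' := by
    intro y z y' z' h h' hy hz
    rcases eq_or_of_chi_good h₀ hy with e | ⟨e1, e2⟩
    · exact e
    have n1 := N.sqE_mul h
    have n2 := N.sqE_mul h'
    rw [e1, E.mul_self] at n1
    rw [e2, E.mul_self] at n2
    have : z = z' := (eq_or_of_chi_good h₀ hz).resolve_right fun e => h₀ (by rw [← e.1, n1])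
    subst this
    obtain ⟨g, rfl⟩ := exists_E_of_sqE n1
    exact (eq_smul_of_mem_val (mem_comm (mem_rot (mem_comm h)))).trans
      (eq_smul_of_mem_val (mem_comm (mem_rot (mem_comm h')))).symm
  exact ⟨aux h h' hy hz, aux (mem_rot (mem_comm h)) (mem_rot (mem_comm h')) hz hy⟩

theorem exists_mul_pair (N : NonSpecial H) {y z t u : T} (h : z ∈ X.mul x₀ y)
    (h' : u ∈ X.mul x₀ t) : ∃ w p, w ∈ X.mul y t ∧ (p ∈ X.mul x₀ w ∨ p ∈ X.mul x₀ (sqE H y • w)) ∧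
      ∀ P : X.GP x₀,
        X.chi P.1 w = X.chi P.1 y * X.chi P.1 t - X.chi P.1 z * X.chi P.1 u ∧
        X.chi P.1 (sqE H y • w) = X.chi P.1 y * X.chi P.1 t + X.chi P.1 z * X.chi P.1 u ∧
        X.chi P.1 p = X.chi P.1 y * X.chi P.1 u + X.chi P.1 z * X.chi P.1 t := by
  have hn := N.sqE_mul h
  have ex : ∀ a b : T, ∃ c, c ∈ X.mul a b := fun a b => by
    obtain ⟨c, c', hc⟩ := X.exists_pair a b
    exact ⟨c, by rw [hc]; simp⟩
  obtain ⟨w, hw, hw'⟩ : ∃ w ∈ X.mul y t, sqE H x₀ • w ∈ X.mul z u := by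
    obtain ⟨Z, hZ⟩ := ex z u
    obtain ⟨r, hr, hZr⟩ := mem_assoc (mem_comm h) hZ
    obtain ⟨k, hk, hrk⟩ := mem_assoc (mem_comm h') (mem_comm hr)
    rw [X.mul_self] at hk
    simp only [Multiset.insert_eq_cons, Multiset.mem_cons, Multiset.mem_singleton] at hk
    rcases hk with rfl | rfl
    · rw [X.mul_e] at hrk
      have : r = t := by simpa using hrk
      subst this
      refine ⟨sqE H y • Z, smul_mem_of_mem hZr, ?_⟩
      rw [← mul_smul, ← hn]
      exact smul_mem_of_mem hZ
    · rw [← sqE_val H] at hrk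
      rw [eq_smul_of_mem_val (mem_comm hrk), mul_smul'] at hZr
      obtain ⟨w, hw, rfl⟩ := Multiset.mem_map.1 hZr
      exact ⟨w, hw, hZ⟩
  obtain ⟨p, hp, hp'⟩ : ∃ p ∈ X.mul y u, p ∈ X.mul z t := by
    obtain ⟨p, hp⟩ := ex y u
    obtain ⟨r, hr, hpr⟩ := mem_assoc (mem_comm h') (mem_comm hp)
    rcases eq_or_of_mem (H := H) h hr with rfl | rfl
    · exact ⟨p, hp, mem_comm hpr⟩
    · refine ⟨sqE H y • p, smul_mem_of_mem hp, ?_⟩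
      rw [X.comm, smul_mul] at hpr
      obtain ⟨s, hs, rfl⟩ := Multiset.mem_map.1 hpr
      rw [← mul_smul, mul_comm, ← hn]
      exact smul_mem_of_mem hs
  refine ⟨w, p, hw, ?_, fun P => ?_⟩
  · obtain ⟨r, hr, hpr⟩ := mem_assoc h' (mem_comm hp)
    rcases eq_or_of_mem (H := H) hw (mem_comm hr) with rfl | rfl
    · exact Or.inl hpr
    · exact Or.inr hpr
  · have h2 := X.two_ne_zero' P.1
    have e1 := chi_smul_mem (H := H) hw P.1
    have e2 := chi_smul_mem (H := H) hw' P.1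
    have e3 := chi_smul_mem (H := H) hp P.1
    have e4 := chi_smul_mem (H := H) hp' P.1
    rw [hn, E.val_mul] at e2 e4
    simp only [chi_smul, chi_sqE_good] at *
    exact ⟨mul_left_cancel₀ h2 (by linear_combination e1 - e2),
      mul_left_cancel₀ h2 (by linear_combination e1 + e2),
      mul_left_cancel₀ h2 (by linear_combination e3 + e4)⟩

end

end ICGroup

namespace ICGroup

variable {T : Type u} {X : ICGroup T} {H : ∀ x, X.q (X.q x) = X.e} {x₀ : T} {η : X.E}

variable (x₀ η) in
/-- The quadratic extension of the ring of functions on good points by a square root of `η`. -/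
abbrev QRing : Type u := ∀ P : X.GP x₀, QuadraticAlgebra (X.Fld P.1) (X.chi P.1 η.val) 0

variable (x₀ η) in
/-- The element of the quadratic extension with coordinates `y` and `z`. -/
noncomputable def theta (y z : T) : QRing x₀ η := fun P => ⟨X.chi P.1 y, X.chi P.1 z⟩

variable (x₀ η) in
/-- The constant given by an element with trivial square. -/
noncomputable def cst (g : X.E) : QRing x₀ η := fun P => ⟨X.chi P.1 g.val, 0⟩

variable (x₀ η) in
/-- The generator of the quadratic extension. -/
noncomputable def om : QRing x₀ η := fun _ => ⟨0, 1⟩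

variable (x₀ η) in
/-- The elements with coordinates `y` and `z ∈ x₀ * y`. -/
def lifts : Set (QRing x₀ η) := {β | ∃ y z, z ∈ X.mul x₀ y ∧ theta x₀ η y z = β}

theorem theta_mem {y z : T} (h : z ∈ X.mul x₀ y) : theta x₀ η y z ∈ lifts x₀ η := ⟨y, z, h, rfl⟩

variable (x₀ η) in
/-- The multipliers of the set of lifts. -/
def multipliers : Submonoid (QRing x₀ η) where
  carrier := {a | ∀ β ∈ lifts x₀ η, a * β ∈ lifts x₀ η}
  one_mem' := fun β h => by rwa [one_mul]
  mul_mem' := fun {a b} ha hb β h => by rw [mul_assoc]; exact ha _ (hb _ h)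

theorem qring_ext {α β : QRing x₀ η} (h₁ : ∀ P, (α P).re = (β P).re)
    (h₂ : ∀ P, (α P).im = (β P).im) : α = β :=
  funext fun P => QuadraticAlgebra.ext (h₁ P) (h₂ P)

theorem cst_mul_theta (g : X.E) (y z : T) :
    cst x₀ η g * theta x₀ η y z = theta x₀ η (g • y) (g • z) :=
  qring_ext (fun P => by simp [cst, theta]) fun P => by simp [cst, theta]

theorem om_mul_theta (y z : T) : om x₀ η * theta x₀ η y z = theta x₀ η (η • z) y :=
  qring_ext (fun P => by simp [om, theta]) fun P => by simp [om, theta]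

theorem theta_e (H : ∀ x, X.q (X.q x) = X.e) : theta x₀ η X.e x₀ = 1 :=
  qring_ext (fun P => X.chi_e P.1) fun P => chi_good H P

theorem one_mem_lifts (H : ∀ x, X.q (X.q x) = X.e) : (1 : QRing x₀ η) ∈ lifts x₀ η := by
  rw [← theta_e H]
  exact theta_mem (by rw [X.mul_e]; simp)

theorem mem_lifts_of_mem (H : ∀ x, X.q (X.q x) = X.e) {a : QRing x₀ η}
    (h : a ∈ multipliers x₀ η) : a ∈ lifts x₀ η := by
  rw [← mul_one a]; exact h _ (one_mem_lifts H)

theorem cst_mem (g : X.E) : cst x₀ η g ∈ multipliers x₀ η := by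
  rintro _ ⟨y, z, h, rfl⟩
  rw [cst_mul_theta]
  exact theta_mem (by rw [mul_smul']; exact Multiset.mem_map_of_mem _ h)

theorem mem_om (hη : η = 1 ∨ η = sqE H x₀) {y z : T} (h : z ∈ X.mul x₀ y) :
    y ∈ X.mul x₀ (η • z) := by
  have h1 := mem_rot (mem_comm h)
  rcases hη with rfl | rfl
  · rwa [one_smul]
  · rw [mul_smul', mul_eq_of_mem (H := H) h1]
    simp [smul_smul_self]

theorem om_mem (hη : η = 1 ∨ η = sqE H x₀) : om x₀ η ∈ multipliers x₀ η := by
  rintro _ ⟨y, z, h, rfl⟩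
  rw [om_mul_theta]
  exact theta_mem (mem_om hη h)

theorem theta_mul_re (y z t u : T) (P : X.GP x₀) :
    ((theta x₀ η y z * theta x₀ η t u) P).re =
      X.chi P.1 y * X.chi P.1 t + X.chi P.1 η.val * (X.chi P.1 z * X.chi P.1 u) := by
  simp [theta, mul_assoc]

theorem theta_mul_im (y z t u : T) (P : X.GP x₀) :
    ((theta x₀ η y z * theta x₀ η t u) P).im =
      X.chi P.1 y * X.chi P.1 u + X.chi P.1 z * X.chi P.1 t := by
  simp [theta]

theorem theta_inj (N : NonSpecial H) (h₀ : sqE H x₀ ≠ 1) {y z y' z' : T}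
    (h : z ∈ X.mul x₀ y) (h' : z' ∈ X.mul x₀ y') (e : theta x₀ η y z = theta x₀ η y' z') :
    y = y' ∧ z = z' :=
  eq_of_pair_good N h₀ h h' (fun P => congrArg QuadraticAlgebra.re (congrFun e P))
    fun P => congrArg QuadraticAlgebra.im (congrFun e P)

theorem theta_mul_self_one (N : NonSpecial H) {y z : T} (h : z ∈ X.mul x₀ y) :
    theta x₀ (1 : X.E) y z * theta x₀ (1 : X.E) y z = 1 := by
  refine qring_ext (fun P => ?_) fun P => ?_
  · refine (theta_mul_re _ _ _ _ _).trans ?_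
    change _ = (1 : X.Fld P.1)
    rw [E.val_one, chi_e]
    linear_combination (chi_sq_add N h P).1
  · refine (theta_mul_im _ _ _ _ _).trans ?_
    change _ = (0 : X.Fld P.1)
    linear_combination 2 * (chi_sq_add N h P).2.2

theorem theta_mul_self_sqE (N : NonSpecial H) {y z : T} (h : z ∈ X.mul x₀ y) :
    theta x₀ (sqE H x₀) y z * theta x₀ (sqE H x₀) y z = cst x₀ (sqE H x₀) (sqE H y) := by
  refine qring_ext (fun P => ?_) fun P => ?_
  · refine (theta_mul_re _ _ _ _ _).trans ?_
    change _ = X.chi P.1 (sqE H y).val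
    rw [chi_sqE_good]
    linear_combination (chi_sq_add N h P).2.1
  · refine (theta_mul_im _ _ _ _ _).trans ?_
    change _ = (0 : X.Fld P.1)
    linear_combination 2 * (chi_sq_add N h P).2.2

theorem sq_mem (N : NonSpecial H) (hη : η = 1 ∨ η = sqE H x₀) {β : QRing x₀ η}
    (h : β ∈ lifts x₀ η) : β * β ∈ multipliers x₀ η := by
  obtain ⟨y, z, h, rfl⟩ := h
  rcases hη with rfl | rfl
  · rw [theta_mul_self_one N h]; exact one_mem _
  · rw [theta_mul_self_sqE N h]; exact cst_mem _

theorem theta_mul_mem_or (N : NonSpecial H) {y z t u : T} (h : z ∈ X.mul x₀ y)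
    (h' : u ∈ X.mul x₀ t) :
    theta x₀ (sqE H x₀) y z * theta x₀ (sqE H x₀) t u ∈ lifts x₀ (sqE H x₀) ∨
      theta x₀ (1 : X.E) y z * theta x₀ (1 : X.E) t u ∈ lifts x₀ (1 : X.E) := by
  obtain ⟨w, p, -, hp, e⟩ := exists_mul_pair N h h'
  refine hp.imp (fun hp => ⟨w, p, hp, ?_⟩) fun hp => ⟨_, p, hp, ?_⟩ <;>
    refine qring_ext (fun P => ?_) fun P => ?_
  · refine (e P).1.trans (.trans ?_ (theta_mul_re _ _ _ _ _).symm)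
    rw [chi_sqE_good]; ring
  · rw [theta_mul_im]
    exact (e P).2.2
  · refine (e P).2.1.trans (.trans ?_ (theta_mul_re _ _ _ _ _).symm)
    rw [E.val_one, chi_e]; ring
  · rw [theta_mul_im]
    exact (e P).2.2

theorem theta_mul (N : NonSpecial H) (hη : η = 1 ∨ η = sqE H x₀) {y z t u : T}
    (h : z ∈ X.mul x₀ y) (h' : u ∈ X.mul x₀ t) :
    ∃ m p, m ∈ X.mul y t ∧ p ∈ X.mul x₀ m ∧
      (theta x₀ η y z * theta x₀ η t u = theta x₀ η m p ∨
        theta x₀ η y z * theta x₀ η t u = theta x₀ η (sqE H y • m) p) := by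
  obtain ⟨w, p, hw, hp, e⟩ := exists_mul_pair N h h'
  have e1 : η = sqE H x₀ → theta x₀ η y z * theta x₀ η t u = theta x₀ η w p := fun hη =>
    qring_ext (fun P => (theta_mul_re _ _ _ _ _).trans
      (.trans (by rw [hη, chi_sqE_good]; ring) (e P).1.symm))
      fun P => by rw [theta_mul_im]; exact (e P).2.2.symm
  have e2 : η = 1 → theta x₀ η y z * theta x₀ η t u = theta x₀ η (sqE H y • w) p := fun hη =>
    qring_ext (fun P => (theta_mul_re _ _ _ _ _).trans
      (.trans (by rw [hη, E.val_one, chi_e]; ring) (e P).2.1.symm))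
      fun P => by rw [theta_mul_im]; exact (e P).2.2.symm
  rcases hp with hp | hp
  · exact ⟨w, p, hw, hp, hη.symm.imp e1 e2⟩
  · refine ⟨_, p, smul_mem_of_mem hw, hp, ?_⟩
    rw [smul_smul_self]
    exact hη.imp e2 e1

theorem mem_of_theta_mul (N : NonSpecial H) (h₀ : sqE H x₀ ≠ 1) (hη : η = 1 ∨ η = sqE H x₀)
    {y z t u w p : T} (h : z ∈ X.mul x₀ y) (h' : u ∈ X.mul x₀ t) (hp : p ∈ X.mul x₀ w)
    (e : theta x₀ η y z * theta x₀ η t u = theta x₀ η w p) : w ∈ X.mul y t := by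
  obtain ⟨m, p', hm, hp', e' | e'⟩ := theta_mul N hη h h'
  · rw [e] at e'
    rwa [(theta_inj N h₀ hp hp' e').1]
  · rw [e] at e'
    rcases eq_or_of_chi_good h₀ (fun P => congrArg QuadraticAlgebra.re (congrFun e' P)) with e1 | e1
    · change w = _ at e1
      rw [e1]
      exact smul_mem_of_mem hm
    · have n1 := N.sqE_mul hp
      have n2 := N.sqE_mul hp'
      rw [e1.1, E.mul_self] at n1
      rw [sqE_smul] at e1
      rw [e1.2, E.mul_self] at n2
      have : p = p' := (eq_or_of_chi_good h₀ (fun P =>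
        congrArg QuadraticAlgebra.im (congrFun e' P))).resolve_right fun e => h₀ (by
          rw [← e.1]; exact n1)
      subst this
      obtain ⟨g, rfl⟩ := exists_E_of_sqE n1
      rwa [eq_smul_of_mem_val (mem_comm (mem_rot (mem_comm hp))),
        ← eq_smul_of_mem_val (mem_comm (mem_rot (mem_comm hp')))]

variable (x₀) in
/-- Squares modulo the square of `x₀`. -/
noncomputable def sqQ (H : ∀ x, X.q (X.q x) = X.e) :
    X.E →* X.E ⧸ Subgroup.zpowers (sqE H x₀) := QuotientGroup.mk' _

theorem sqQ_eq_iff {g h : X.E} : sqQ x₀ H g = sqQ x₀ H h ↔ h = g ∨ h = g * sqE H x₀ := by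
  rw [sqQ, QuotientGroup.mk'_eq_mk']
  constructor
  · rintro ⟨z, hz, rfl⟩
    rw [Subgroup.mem_zpowers_iff] at hz
    obtain ⟨k, rfl⟩ := hz
    rcases Int.even_or_odd' k with ⟨k, rfl | rfl⟩
    · simp [zpow_mul, pow_two, E.mul_self]
    · simp [zpow_mul, zpow_add, pow_two, E.mul_self]
  · rintro (rfl | rfl)
    · exact ⟨1, one_mem _, mul_one _⟩
    · exact ⟨_, Subgroup.mem_zpowers _, rfl⟩

theorem sqQ_base : sqQ x₀ H (sqE H x₀) = 1 := by
  rw [← map_one (sqQ x₀ H), eq_comm, sqQ_eq_iff, one_mul]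
  exact Or.inr rfl

theorem sqQ_mul_self (g : X.E) : sqQ x₀ H g * sqQ x₀ H g = 1 := by
  rw [← map_mul, E.mul_self, map_one]

theorem exists_multiplier (N : NonSpecial H) (hη : η = 1 ∨ η = sqE H x₀) {y z t u : T}
    (h : z ∈ X.mul x₀ y) (h' : u ∈ X.mul x₀ t)
    (e : sqQ x₀ H (sqE H y) = sqQ x₀ H (sqE H t)) :
    ∃ a ∈ multipliers x₀ η, theta x₀ η t u = a * theta x₀ η y z := by
  have aux : ∀ {y z t u : T}, z ∈ X.mul x₀ y → u ∈ X.mul x₀ t → sqE H y = sqE H t →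
      ∃ a ∈ multipliers x₀ η, theta x₀ η t u = a * theta x₀ η y z := by
    intro y z t u h h' e
    obtain ⟨g, rfl⟩ := N y t e
    rw [mul_smul', mul_eq_of_mem (H := H) h] at h'
    simp only [Multiset.insert_eq_cons, Multiset.map_cons, Multiset.map_singleton,
      Multiset.mem_cons, Multiset.mem_singleton] at h'
    rcases h' with rfl | rfl
    · exact ⟨_, cst_mem g, (cst_mul_theta _ _ _).symm⟩
    · refine ⟨_, cst_mem (g * sqE H y), ?_⟩
      rw [cst_mul_theta, mul_smul, mul_smul, sqE_smul_self, smul_sqE_eq N h]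
  rcases sqQ_eq_iff.1 e with e | e
  · exact aux h h' e.symm
  · obtain ⟨a, ha, e'⟩ := aux (mem_om hη h) h' (by rw [sqE_smul, N.sqE_mul h, e, mul_comm])
    rw [← om_mul_theta, ← mul_assoc] at e'
    exact ⟨_, mul_mem ha (om_mem hη), e'⟩


end ICGroup

namespace ICGroup

variable {T : Type u} {X : ICGroup T} {H : ∀ x, X.q (X.q x) = X.e} {x₀ : T} {η : X.E}

/-- Multiset comparison at good points: an element `g • w` of `N` that is not in the translate of
`N` has to be equal to `r`. -/
theorem eq_of_chis_pair {r a₁ a₂ a₃ a₄ : T}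
    (h : ∀ P : X.GP x₀, 2 * X.chi P.1 r =
      X.chi P.1 a₁ + X.chi P.1 a₂ + X.chi P.1 a₃ + X.chi P.1 a₄)
    (h₁ : a₁ ≠ sqE H x₀ • a₁) (h₂ : a₁ ≠ sqE H x₀ • a₂) (h₃ : a₁ ≠ sqE H x₀ • a₃)
    (h₄ : a₁ ≠ sqE H x₀ • a₄) : a₁ = r := by
  classical
  have h1 := eq_of_chis_good (X := X) (x₀ := x₀) (M := {r, r}) (N := {a₁, a₂, a₃, a₄})
    (fun P => by
      have := h P
      simp only [Multiset.insert_eq_cons, chis_cons, chis_singleton]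
      linear_combination this)
  simp only [Multiset.insert_eq_cons, Multiset.cons_bind, Multiset.singleton_bind,
    ← sqE_val H, mul_val] at h1
  have c1 := congrArg (Multiset.count a₁) h1
  simp only [Multiset.insert_eq_cons, Multiset.count_add, Multiset.count_cons,
    Multiset.count_singleton] at c1
  grind

theorem smul_ne_smul_of_sqQ {w : T} {g h : X.E} (h1 : g ≠ h)
    (h2 : sqQ x₀ H g ≠ sqQ x₀ H h * sqQ x₀ H (sqE H w)) : g • w ≠ h • w := fun e => by
  rcases (smul_eq_smul_iff (H := H)).1 e with e | e
  · exact h1 e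
  · exact h2 (by rw [e, map_mul])

theorem mul_mem_of_independent (N : NonSpecial H) (h₀ : sqE H x₀ ≠ 1) (hη : η = 1 ∨ η = sqE H x₀)
    {y₁ z₁ y₂ z₂ y₃ z₃ : T} (h₁ : z₁ ∈ X.mul x₀ y₁) (h₂ : z₂ ∈ X.mul x₀ y₂)
    (h₃ : z₃ ∈ X.mul x₀ y₃)
    {b c d : X.E ⧸ Subgroup.zpowers (sqE H x₀)} (eb : sqQ x₀ H (sqE H y₁) = b)
    (ec : sqQ x₀ H (sqE H y₂) = c) (ed : sqQ x₀ H (sqE H y₃) = d)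
    (hb : b ≠ 1) (hc : c ≠ 1) (hbc : b ≠ c) (hd : d ≠ 1) (hdb : d ≠ b) (hdc : d ≠ c)
    (hdbc : d ≠ b * c) (hm : theta x₀ η y₁ z₁ * theta x₀ η y₂ z₂ ∈ lifts x₀ η) :
    theta x₀ η y₁ z₁ * theta x₀ η y₃ z₃ ∈ lifts x₀ η := by
  by_contra hn
  obtain ⟨m, p, hm₁, hp, e | e⟩ := theta_mul N hη h₁ h₃
  · exact hn ⟨m, p, hp, e.symm⟩
  obtain ⟨w₁, p₁, hp₁, e₁⟩ := hm
  obtain ⟨r, hr⟩ : ∃ r, ∀ P : X.GP x₀,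
      ((theta x₀ η w₁ p₁ * theta x₀ η y₃ z₃) P).re = X.chi P.1 r := by
    obtain ⟨m, p, -, -, e | e⟩ := theta_mul N hη hp₁ h₃
    · exact ⟨m, fun P => by rw [e]; rfl⟩
    · exact ⟨_, fun P => by rw [e]; rfl⟩
  have key : theta x₀ η w₁ p₁ * theta x₀ η y₃ z₃ =
      theta x₀ η (sqE H y₁ • m) p * theta x₀ η y₂ z₂ := by
    rw [e₁, ← e, mul_right_comm]
  obtain ⟨w, p', hw, -, hwp⟩ := exists_mul_pair N hp h₂
  have nm := N.sqE_mul hm₁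
  have nw := N.sqE_mul hw
  rw [nm] at nw
  have hη2 : sqQ x₀ H η = 1 := by
    rcases hη with rfl | rfl
    · exact map_one _
    · exact sqQ_base
  have hsum : ∀ P : X.GP x₀, 2 * X.chi P.1 r = X.chi P.1 (sqE H y₁ • w) +
      X.chi P.1 (sqE H y₃ • w) + X.chi P.1 ((η * (sqE H y₁ * sqE H y₃)) • w) +
      X.chi P.1 ((η * sqE H x₀) • w) := fun P => by
    have h1 := hr P
    rw [key, theta_mul_re] at h1
    obtain ⟨h2, h3, -⟩ := hwp P
    have h4 := (sqE H y₁).sq P.1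
    rw [nm] at h3
    simp only [chi_smul, E.val_mul, chi_sqE_good] at *
    linear_combination -2 * h1 - (X.chi P.1 (sqE H y₁).val - X.chi P.1 η.val) * h2 -
      (X.chi P.1 (sqE H y₁).val + X.chi P.1 η.val) * h3 +
      X.chi P.1 (sqE H y₃).val * X.chi P.1 w * h4
  have sqw : sqQ x₀ H (sqE H w) = b * d * c := by rw [nw, map_mul, map_mul, eb, ec, ed]
  have sq : ∀ {g : X.E ⧸ Subgroup.zpowers (sqE H x₀)}, g * g = 1 := fun {g} => by
    induction g using QuotientGroup.induction_on with
    | H g => exact sqQ_mul_self g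
  have sq' : ∀ {g h : X.E ⧸ Subgroup.zpowers (sqE H x₀)}, g * (g * h) = h := fun {g h} => by
    rw [← mul_assoc, sq, one_mul]
  have hne : ∀ {g h : X.E}, sqQ x₀ H g ≠ sqQ x₀ H h → g ≠ h := fun h e => h (by rw [e])
  have fin : ∀ {g h : X.E ⧸ Subgroup.zpowers (sqE H x₀)}, g * h ≠ 1 → g ≠ h := fun hh e =>
    hh (by rw [e, sq])
  have hgh : ∀ {g h : X.E ⧸ Subgroup.zpowers (sqE H x₀)}, g ≠ h → g * h ≠ 1 := fun {g h} hh e =>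
    hh (by rw [← mul_one g, ← sq (g := h), ← mul_assoc, e, one_mul])
  have f₁ := hgh hbc
  have f₂ := hgh hdb
  have f₃ := hgh hdc
  have f₄ := hgh hdbc
  simp only [mul_comm, mul_left_comm, mul_assoc] at f₁ f₂ f₃ f₄
  have sqw' : sqQ x₀ H (sqE H w) ≠ 1 := by
    rw [sqw]; simpa only [mul_comm, mul_left_comm, mul_assoc] using f₄
  have self : ∀ g : X.E, g • w ≠ (sqE H x₀ * g) • w := fun g =>
    smul_ne_smul_of_sqQ (fun e => h₀ (mul_eq_right.1 e.symm))
      (by rw [map_mul, sqQ_base, one_mul]; exact fun e => sqw' (mul_eq_left.1 e.symm))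
  have e₁r : sqE H y₁ • w = r := by
    refine eq_of_chis_pair (H := H) hsum ?_ ?_ ?_ ?_ <;>
    rw [← mul_smul]
    · exact self _
    all_goals
      refine smul_ne_smul_of_sqQ (hne (fin ?_)) (fin ?_) <;>
      simp only [map_mul, eb, ed, sqw, sqQ_base, hη2, one_mul, mul_one] <;>
      (try simp only [mul_comm, mul_left_comm, mul_assoc, sq, sq', mul_one]) <;> assumption
  have e₂r : sqE H y₃ • w = r := by
    refine eq_of_chis_pair (H := H) (fun P => (hsum P).trans
      (congrArg₂ _ (congrArg₂ _ (add_comm _ _) rfl) rfl)) ?_ ?_ ?_ ?_ <;>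
    rw [← mul_smul]
    · exact self _
    all_goals
      refine smul_ne_smul_of_sqQ (hne (fin ?_)) (fin ?_) <;>
      simp only [map_mul, eb, ed, sqw, sqQ_base, hη2, one_mul, mul_one] <;>
      (try simp only [mul_comm, mul_left_comm, mul_assoc, sq, sq', mul_one]) <;> assumption
  refine smul_ne_smul_of_sqQ (hne (fin ?_)) (fin ?_) (e₁r.trans e₂r.symm) <;>
  simp only [eb, ed, sqw] <;>
  (try simp only [mul_comm, mul_left_comm, mul_assoc, sq, sq', mul_one]) <;> assumption

end ICGroup

namespace ICGroup

variable {T : Type u} {X : ICGroup T} {H : ∀ x, X.q (X.q x) = X.e} {x₀ : T} {η : X.E}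

theorem mem_of_dependent (N : NonSpecial H) (hη : η = 1 ∨ η = sqE H x₀)
    {y₁ z₁ y₂ z₂ : T} (h₁ : z₁ ∈ X.mul x₀ y₁) (h₂ : z₂ ∈ X.mul x₀ y₂)
    (h : sqQ x₀ H (sqE H y₂) = 1 ∨ sqQ x₀ H (sqE H y₁) = sqQ x₀ H (sqE H y₂)) :
    theta x₀ η y₁ z₁ * theta x₀ η y₂ z₂ ∈ lifts x₀ η := by
  rcases h with h | h
  · obtain ⟨a, ha, e⟩ := exists_multiplier N hη (y := X.e) (z := x₀) (by rw [X.mul_e]; simp) h₂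
      (by rw [h, ← E.val_one, sqE_E, map_one])
    rw [e, theta_e H, mul_one, mul_comm]
    exact ha _ (theta_mem h₁)
  · obtain ⟨a, ha, e⟩ := exists_multiplier N hη h₁ h₂ h
    rw [e, mul_left_comm]
    exact mem_lifts_of_mem H (mul_mem ha (sq_mem N hη (theta_mem h₁)))

theorem mem_of_good (N : NonSpecial H) (h₀ : sqE H x₀ ≠ 1) (hη : η = 1 ∨ η = sqE H x₀)
    {y₁ z₁ y₂ z₂ y₃ z₃ : T} (h₁ : z₁ ∈ X.mul x₀ y₁) (h₂ : z₂ ∈ X.mul x₀ y₂)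
    (h₃ : z₃ ∈ X.mul x₀ y₃)
    (hb : sqQ x₀ H (sqE H y₁) ≠ 1) (hc : sqQ x₀ H (sqE H y₂) ≠ 1)
    (hbc : sqQ x₀ H (sqE H y₁) ≠ sqQ x₀ H (sqE H y₂))
    (hm : theta x₀ η y₁ z₁ * theta x₀ η y₂ z₂ ∈ lifts x₀ η) :
    theta x₀ η y₁ z₁ * theta x₀ η y₃ z₃ ∈ lifts x₀ η := by
  by_cases hd : sqQ x₀ H (sqE H y₃) = 1
  · exact mem_of_dependent N hη h₁ h₃ (Or.inl hd)
  by_cases hdb : sqQ x₀ H (sqE H y₃) = sqQ x₀ H (sqE H y₁)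
  · exact mem_of_dependent N hη h₁ h₃ (Or.inr hdb.symm)
  by_cases hdc : sqQ x₀ H (sqE H y₃) = sqQ x₀ H (sqE H y₂)
  · obtain ⟨a, ha, e⟩ := exists_multiplier N hη h₂ h₃ hdc.symm
    rw [e, mul_left_comm]
    exact ha _ hm
  by_cases hdbc : sqQ x₀ H (sqE H y₃) = sqQ x₀ H (sqE H y₁) * sqQ x₀ H (sqE H y₂)
  · obtain ⟨w, p, hp, e⟩ := hm
    obtain ⟨a, ha, e'⟩ := exists_multiplier N hη hp h₃ (by
      rw [hdbc, ← map_mul, ← N.sqE_mul (mem_of_theta_mul N h₀ hη h₁ h₂ hp e.symm)])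
    rw [e', e, mul_left_comm, ← mul_assoc (theta x₀ η y₁ z₁)]
    exact ha _ (sq_mem N hη (theta_mem h₁) _ (theta_mem h₂))
  exact mul_mem_of_independent N h₀ hη h₁ h₂ h₃ rfl rfl rfl hb hc hbc hd hdb hdc hdbc hm

theorem mul_mem_lifts (N : NonSpecial H) (h₀ : sqE H x₀ ≠ 1) (hη : η = 1 ∨ η = sqE H x₀)
    {y₁ z₁ y₂ z₂ : T} (h₁ : z₁ ∈ X.mul x₀ y₁) (h₂ : z₂ ∈ X.mul x₀ y₂)
    (hb : sqQ x₀ H (sqE H y₁) ≠ 1) (hc : sqQ x₀ H (sqE H y₂) ≠ 1)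
    (hbc : sqQ x₀ H (sqE H y₁) ≠ sqQ x₀ H (sqE H y₂))
    (hm : theta x₀ η y₁ z₁ * theta x₀ η y₂ z₂ ∈ lifts x₀ η) {α β : QRing x₀ η}
    (hα : α ∈ lifts x₀ η) (hβ : β ∈ lifts x₀ η) : α * β ∈ lifts x₀ η := by
  obtain ⟨y, z, h, rfl⟩ := hα
  obtain ⟨t, u, h', rfl⟩ := hβ
  by_cases hy : sqQ x₀ H (sqE H y) = 1
  · rw [mul_comm]
    exact mem_of_dependent N hη h' h (Or.inl hy)
  by_cases hyb : sqQ x₀ H (sqE H y₁) = sqQ x₀ H (sqE H y)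
  · obtain ⟨a, ha, e⟩ := exists_multiplier N hη h₁ h hyb
    rw [e, mul_assoc]
    exact ha _ (mem_of_good N h₀ hη h₁ h₂ h' hb hc hbc hm)
  have h1 := mem_of_good N h₀ hη h₁ h₂ h hb hc hbc hm
  rw [mul_comm] at h1
  exact mem_of_good N h₀ hη h h₁ h' hy hb (Ne.symm hyb) h1

/-- Either all products of lifts are lifts for `η = x₀²`, or there are three elements with
independent squares and all products of lifts are lifts for `η = 1`. -/
theorem mul_mem_lifts_or (N : NonSpecial H) (h₀ : sqE H x₀ ≠ 1) :
    (∀ α ∈ lifts x₀ (sqE H x₀), ∀ β ∈ lifts x₀ (sqE H x₀), α * β ∈ lifts x₀ (sqE H x₀)) ∨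
      (∃ y₁ y₂, sqQ x₀ H (sqE H y₁) ≠ 1 ∧ sqQ x₀ H (sqE H y₂) ≠ 1 ∧
        sqQ x₀ H (sqE H y₁) ≠ sqQ x₀ H (sqE H y₂)) ∧
      ∀ α ∈ lifts x₀ (1 : X.E), ∀ β ∈ lifts x₀ (1 : X.E), α * β ∈ lifts x₀ (1 : X.E) := by
  rw [or_iff_not_imp_left]
  intro h
  push Not at h
  obtain ⟨_, ⟨y₁, z₁, h₁, rfl⟩, _, ⟨y₂, z₂, h₂, rfl⟩, h⟩ := h
  have hη : sqE H x₀ = 1 ∨ sqE H x₀ = sqE H x₀ := Or.inr rfl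
  have hb : sqQ x₀ H (sqE H y₁) ≠ 1 := fun hb => h (by
    rw [mul_comm]; exact mem_of_dependent N hη h₂ h₁ (Or.inl hb))
  have hc : sqQ x₀ H (sqE H y₂) ≠ 1 := fun hc => h (mem_of_dependent N hη h₁ h₂ (Or.inl hc))
  have hbc : sqQ x₀ H (sqE H y₁) ≠ sqQ x₀ H (sqE H y₂) := fun hbc =>
    h (mem_of_dependent N hη h₁ h₂ (Or.inr hbc))
  exact ⟨⟨y₁, y₂, hb, hc, hbc⟩, fun α hα β hβ => mul_mem_lifts N h₀ (Or.inl rfl) h₁ h₂ hb hc hbc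
    ((theta_mul_mem_or N h₁ h₂).resolve_left h) hα hβ⟩

/-- The group of lifts, with the projection to the first coordinate. -/
theorem exists_liftGroup (N : NonSpecial H) (h₀ : sqE H x₀ ≠ 1) (hη : η = 1 ∨ η = sqE H x₀)
    (h : ∀ α ∈ lifts x₀ η, ∀ β ∈ lifts x₀ η, α * β ∈ lifts x₀ η) :
    ∃ (G : Subgroup (QRing x₀ η)ˣ) (π ρ : G → T),
      (∀ g, ρ g ∈ X.mul x₀ (π g)) ∧ (∀ g, theta x₀ η (π g) (ρ g) = g.1.1) ∧
      ∀ y z, z ∈ X.mul x₀ y → ∃ g, π g = y ∧ ρ g = z := by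
  have hinv : ∀ α ∈ lifts x₀ η, ∃ β ∈ lifts x₀ η, α * β = 1 := by
    rintro _ ⟨y, z, hz, rfl⟩
    rcases hη with rfl | rfl
    · exact ⟨_, theta_mem hz, theta_mul_self_one N hz⟩
    · refine ⟨cst x₀ _ (sqE H y) * theta x₀ _ y z, cst_mem _ _ (theta_mem hz), ?_⟩
      rw [mul_left_comm, theta_mul_self_sqE N hz]
      refine qring_ext (fun P => ?_) fun P => ?_
      · have := (sqE H y).sq P.1
        change _ = (1 : X.Fld P.1)
        simp only [cst, Pi.mul_apply, QuadraticAlgebra.re_mul]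
        linear_combination this
      · change _ = (0 : X.Fld P.1)
        simp [cst]
  let G : Subgroup (QRing x₀ η)ˣ :=
    { carrier := {u | u.1 ∈ lifts x₀ η}
      one_mem' := one_mem_lifts H
      mul_mem' := fun {a b} ha hb => h _ ha _ hb
      inv_mem' := fun {a} ha => by
        obtain ⟨β, hβ, e⟩ := hinv _ ha
        have : (a⁻¹).1 = β := by rw [Units.inv_eq_of_mul_eq_one_right e]
        change (a⁻¹).1 ∈ lifts x₀ η
        rwa [this] }
  have hG : ∀ g : G, ∃ y z, z ∈ X.mul x₀ y ∧ theta x₀ η y z = g.1.1 := fun g => g.2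
  choose π ρ hρ he using hG
  refine ⟨G, π, ρ, hρ, he, fun y z hz => ?_⟩
  obtain ⟨β, -, e⟩ := hinv _ (theta_mem hz)
  let g : G := ⟨⟨_, β, e, by rw [mul_comm, e]⟩, theta_mem hz⟩
  exact ⟨g, theta_inj N h₀ (hρ g) hz (he g)⟩

end ICGroup

namespace ICGroup

variable {T : Type u} {X : ICGroup T} {H : ∀ x, X.q (X.q x) = X.e} {x₀ : T} {η : X.E}

/-- Recognition of the unipotent series. -/
theorem inSeriesU_of_hom {G : Type u} [CommGroup G] (hG : IsBooleanGroup G) {π : G → T}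
    (hs : Function.Surjective π) (h1 : π 1 = X.e) (N : G →* G) (hN : ∀ g, N (N g) = 1)
    (hm : ∀ a b, X.mul (π a) (π b) = {π (a * b), π (a * b * N b)})
    (hf : ∀ a b, π a = π b ↔ b = a ∨ b = a * N a)
    (hd : ∃ a b c : G, N a ≠ 1 ∧ N b ≠ 1 ∧ N a ≠ N b ∧ N c ≠ 1 ∧ N c ≠ N a ∧ N c ≠ N b ∧
      N c ≠ N a * N b) : InSeriesU X.toTwoValuedGroup := by
  obtain ⟨V, hV, hV'⟩ := exists_complement hG N.ker
  obtain ⟨W, hW, hW'⟩ := exists_complement hG N.range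
  have sq : ∀ g : G, g * g = 1 := hG
  have injV : ∀ a ∈ V, ∀ b ∈ V, N a = N b → a = b := fun a ha b hb h =>
    mul_inv_eq_one.1 (hV _ (by rw [MonoidHom.mem_ker, map_mul, map_inv, h, mul_inv_cancel])
      (V.mul_mem ha (V.inv_mem hb)))
  have surjV : ∀ g, ∃ v : V, N v = N g := fun g => by
    obtain ⟨d, hd, v, hv, rfl⟩ := hV' g
    exact ⟨⟨v, hv⟩, by rw [map_mul, MonoidHom.mem_ker.1 hd, one_mul]⟩
  have kerW : ∀ w : (W ⊓ N.ker : Subgroup G), N w = 1 := fun w => MonoidHom.mem_ker.1 w.2.2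
  let F : (V × V) × (W ⊓ N.ker : Subgroup G) → G := fun p => p.1.1 * N p.1.2 * p.2
  have NF : ∀ p, N (F p) = N p.1.1 := fun p => by simp [F, hN, kerW]
  have injF : ∀ p q, F p = F q → p = q := by
    rintro ⟨⟨a, b⟩, w⟩ ⟨⟨a', b'⟩, w'⟩ h
    have ha : N a = N a' := by rw [← NF ⟨⟨a, b⟩, w⟩, h, NF]
    obtain rfl : a = a' := Subtype.ext (injV _ a.2 _ a'.2 ha)
    have h : N b * w = N b' * w' := by
      have : a * (N b * w : G) = a * (N b' * w') := by simpa only [F, mul_assoc] using h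
      exact mul_left_cancel this
    have h' : N (b' * b : G) = w * w' := by
      have e : N b' * N b * (N b * w) = N b' * N b * (N b' * w') := by rw [h]
      rw [map_mul]
      calc N b' * N b = N b' * N b * (w * w) * (w' * w') * (N b * N b) := by
            simp only [sq, mul_one]
        _ = (N b' * N b * (N b * w)) * (w * (w' * w')) * N b := by
            simp only [mul_comm, mul_left_comm, mul_assoc]
        _ = (N b' * N b * (N b' * w')) * (w * (w' * w')) * N b := by rw [e]
        _ = (N b' * N b') * (N b * N b) * (w' * w') * (w * w') := by
            simp only [mul_comm, mul_left_comm, mul_assoc]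
        _ = w * w' := by simp only [sq, one_mul]
    have h1 : N (b' * b : G) = 1 := hW _ ⟨_, rfl⟩ (by rw [h']; exact W.mul_mem w.2.1 w'.2.1)
    have hb : N b = N b' := by
      rw [map_mul, mul_eq_one_iff_eq_inv, inv_eq_of_mul_eq_one_right (sq _)] at h1
      exact h1.symm
    obtain rfl : b = b' := Subtype.ext (injV _ b.2 _ b'.2 hb)
    obtain rfl : w = w' := Subtype.ext (mul_left_cancel h)
    rfl
  obtain ⟨d₁, d₂, d₃, hd⟩ := hd
  obtain ⟨v₁, hv₁⟩ := surjV d₁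
  obtain ⟨v₂, hv₂⟩ := surjV d₂
  obtain ⟨v₃, hv₃⟩ := surjV d₃
  rw [← hv₁, ← hv₂, ← hv₃] at hd
  obtain ⟨e₁, e₂, e₃, e₄, e₅, e₆, e₇⟩ := hd
  refine ⟨V, (W ⊓ N.ker : Subgroup G), inferInstance, inferInstance, fun v => Subtype.ext (sq v),
    fun w => Subtype.ext (sq w), ⟨v₁, v₂, v₃, ?_, ?_, ?_, ?_, ?_, ?_, ?_⟩,
    fun p => π (F p), ?_, ?_, ?_, ?_, ?_, fun p => X.invol _⟩
  · rintro rfl; exact e₁ (map_one N)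
  · rintro rfl; exact e₂ (map_one N)
  · rintro rfl; exact e₃ rfl
  · rintro rfl; exact e₄ (map_one N)
  · rintro rfl; exact e₅ rfl
  · rintro rfl; exact e₆ rfl
  · rintro rfl; exact e₇ (map_mul N _ _)
  · intro t
    obtain ⟨g, rfl⟩ := hs t
    obtain ⟨d, hd, v, hv, rfl⟩ := hV' g
    obtain ⟨_, ⟨h, rfl⟩, w, hw, rfl⟩ := hW' d
    obtain ⟨b, hb⟩ := surjV h
    have hwk : w ∈ N.ker := by
      rw [MonoidHom.mem_ker, map_mul, hN, one_mul] at hd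
      exact hd
    refine ⟨⟨⟨⟨v, hv⟩, b⟩, ⟨w, hw, hwk⟩⟩, congrArg π ?_⟩
    change v * N b * w = _
    rw [hb]
    simp only [mul_comm, mul_left_comm]
  · simpa [F] using h1
  · intro a b w
    refine ((hf _ _).2 (Or.inr ?_)).symm
    rw [NF]
    simp only [F, Subgroup.coe_mul, map_mul, mul_comm, mul_left_comm]
  · intro p q h
    rcases (hf _ _).1 h with h | h
    · rw [injF _ _ h]; exact ⟨rfl, Or.inl rfl⟩
    · have : q = ((p.1.1, p.1.1 * p.1.2), p.2) := injF _ _ (by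
        rw [h, NF]
        simp only [F, Subgroup.coe_mul, map_mul, mul_comm, mul_left_comm])
      rw [this]; exact ⟨rfl, Or.inr rfl⟩
  · intro a₁ b₁ a₂ b₂ w₁ w₂
    refine (hm _ _).trans ?_
    rw [NF]
    simp only [F, Subgroup.coe_mul, map_mul, mul_comm, mul_left_comm, mul_assoc]

/-- The group of lifts covering a non-special two-valued group, with the square map split off. -/
theorem exists_cover (N : NonSpecial H) (h₀ : sqE H x₀ ≠ 1) (hη : η = 1 ∨ η = sqE H x₀)
    (h : ∀ α ∈ lifts x₀ η, ∀ β ∈ lifts x₀ η, α * β ∈ lifts x₀ η) :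
    ∃ (G : Type u) (_ : CommGroup G) (π : G → T) (κ : X.E →* G),
      Function.Surjective π ∧ π 1 = X.e ∧ (∀ a b, π (a * b) ∈ X.mul (π a) (π b)) ∧
      (∀ g a, π (κ g * a) = g • π a) ∧ (∀ a b, π a = π b → b = a ∨ b = κ (sqE H (π a)) * a) ∧
      (∀ a, π a = X.e → a = 1) ∧ (η = 1 → ∀ a : G, a * a = 1) ∧
      (η = sqE H x₀ → ∀ a, a * a = κ (sqE H (π a))) := by
  obtain ⟨G, π, ρ, hρ, he, hs⟩ := exists_liftGroup N h₀ hη h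
  have ext : ∀ a b : G, theta x₀ η (π a) (ρ a) = theta x₀ η (π b) (ρ b) → a = b := fun a b e =>
    Subtype.ext (Units.ext (by rw [← he, ← he, e]))
  have hx₀ : x₀ ∈ X.mul x₀ X.e := by rw [X.mul_e]; simp
  have hκ : ∀ g : X.E, g • x₀ ∈ X.mul x₀ g.val := fun g => by
    rw [X.comm, mul_val]; simp
  choose κ hκπ hκρ using fun g => hs _ _ (hκ g)
  have val : ∀ g, (κ g).1.1 = cst x₀ η g := fun g => by
    rw [← he, hκπ, hκρ, ← smul_e, ← cst_mul_theta, theta_e H, mul_one]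
  have ker : ∀ a, π a = X.e → a = 1 := fun a ha => by
    have h1 := hρ a
    rw [ha, X.mul_e] at h1
    have h2 : ρ a = x₀ := by simpa using h1
    refine Subtype.ext (Units.ext ?_)
    rw [← he, ha, h2, theta_e H]; rfl
  have hκm : ∀ g h, κ (g * h) = κ g * κ h := fun g h => by
    refine Subtype.ext (Units.ext ?_)
    change (κ (g * h)).1.1 = (κ g).1.1 * (κ h).1.1
    rw [← he (κ h), val, val, hκπ, hκρ, cst_mul_theta, ← smul_e, smul_smul, smul_smul,
      ← cst_mul_theta, theta_e H, mul_one]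
  have hact : ∀ g a, theta x₀ η (π (κ g * a)) (ρ (κ g * a)) = theta x₀ η (g • π a) (g • ρ a) :=
    fun g a => by
      rw [he, ← cst_mul_theta, he, ← val]; rfl
  have hmem : ∀ (g : X.E) (a : G), g • ρ a ∈ X.mul x₀ (g • π a) := fun g a => by
    rw [X.comm]; exact smul_mem (by rw [X.comm]; exact hρ a)
  refine ⟨G, inferInstance, π, MonoidHom.mk' κ hκm, ?_, ?_, ?_, ?_, ?_, ker, ?_, ?_⟩
  · intro y
    obtain ⟨a, b, hab⟩ := X.exists_pair x₀ y
    obtain ⟨g, hg, -⟩ := hs y a (by rw [hab]; simp)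
    exact ⟨g, hg⟩
  · exact (theta_inj N h₀ (hρ 1) hx₀ (by rw [he, theta_e H]; rfl)).1
  · intro a b
    exact mem_of_theta_mul N h₀ hη (hρ a) (hρ b) (hρ (a * b)) (by rw [he, he, he]; rfl)
  · intro g a
    exact (theta_inj N h₀ (hρ _) (hmem g a) (hact g a)).1
  · intro a b hab
    have hb := hρ b
    rw [← hab] at hb
    rcases eq_or_of_mem (H := H) (hρ a) hb with e | e
    · exact Or.inl (ext _ _ (by rw [hab, e]))
    · refine Or.inr (ext _ _ ((hact _ _).trans ?_).symm)
      rw [sqE_smul_self, smul_sqE_eq N (hρ a), ← e, hab]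
  · rintro rfl a
    refine Subtype.ext (Units.ext ?_)
    change a.1.1 * a.1.1 = 1
    rw [← he]
    exact theta_mul_self_one N (hρ a)
  · rintro rfl a
    refine Subtype.ext (Units.ext ?_)
    change a.1.1 * a.1.1 = (κ _).1.1
    rw [val, ← he]
    exact theta_mul_self_sqE N (hρ a)

/-- A two-valued group without special pairs in which not all squares are trivial belongs to the
principal or to the unipotent series. -/
theorem inSeries_of_nonSpecial (N : NonSpecial H) (h₀ : sqE H x₀ ≠ 1) :
    InSeriesA X.toTwoValuedGroup ∨ InSeriesU X.toTwoValuedGroup := by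
  have sqE' : ∀ g : X.E, g * g = 1 := X.isBooleanGroup_E
  rcases mul_mem_lifts_or N h₀ with h | ⟨⟨y₁, y₂, hy₁, hy₂, hy⟩, h⟩
  · obtain ⟨G, _, π, κ, hs, h1, hm, hact, -, hk, -, hsq⟩ := exists_cover N h₀ (Or.inr rfl) h
    refine Or.inl (inSeriesA_of_hom hs h1 (fun a b => ?_) hk)
    rw [mul_eq_of_mem' (H := H) (hm a b), ← hact]
    have h2 : κ (sqE H (π b)) * κ (sqE H (π b)) = 1 := by rw [← map_mul, sqE', map_one]
    have h3 : b⁻¹ = κ (sqE H (π b)) * b := by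
      rw [inv_eq_iff_mul_eq_one, mul_left_comm, hsq rfl, h2]
    rw [h3, mul_left_comm]
  · obtain ⟨G, _, π, κ, hs, h1, hm, hact, hf, hk, hsq, -⟩ := exists_cover N h₀ (Or.inl rfl) h
    have hκ : ∀ g, π (κ g) = g.val := fun g => by rw [← mul_one (κ g), hact, h1, smul_e]
    have inj : Function.Injective κ := fun g h e => E.ext (by rw [← hκ, e, hκ])
    let ν : G →* G := MonoidHom.mk' (fun a => κ (sqE H (π a))) fun a b => by
      rw [N.sqE_mul (hm a b), map_mul]
    have hν : ∀ a, ν a = κ (sqE H (π a)) := fun _ => rfl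
    refine Or.inr (inSeriesU_of_hom (hsq rfl) hs h1 ν (fun g => ?_) (fun a b => ?_)
      (fun a b => ⟨fun e => ?_, ?_⟩) ?_)
    · rw [hν, hν, hκ, sqE_E, map_one]
    · rw [mul_eq_of_mem' (H := H) (hm a b), ← hact, hν, mul_comm (κ _)]
    · rw [hν, mul_comm a]; exact hf a b e
    · rintro (rfl | rfl)
      · rfl
      · rw [hν, mul_comm a, hact, sqE_smul_self]
    · obtain ⟨a, rfl⟩ := hs x₀
      obtain ⟨b, rfl⟩ := hs y₁
      obtain ⟨c, rfl⟩ := hs y₂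
      have e1 : ∀ g, ν g ≠ 1 ↔ sqE H (π g) ≠ 1 := fun g => by
        rw [hν, ← map_one κ]; exact inj.ne_iff
      refine ⟨a, b, c, (e1 a).2 h₀, (e1 b).2 fun e => hy₁ (by rw [e, map_one]), fun e => ?_,
        (e1 c).2 fun e => hy₂ (by rw [e, map_one]), fun e => ?_, fun e => ?_, fun e => ?_⟩
      · exact hy₁ (by rw [← inj e, sqQ_base])
      · exact hy₂ (by rw [inj e, sqQ_base])
      · exact hy (by rw [inj e])
      · rw [hν, hν, hν, ← map_mul] at e
        exact hy (by rw [inj e, map_mul, sqQ_base, one_mul])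

end ICGroup

/-- Every involutive commutative two-valued group belongs to one of the three series. -/
theorem ICGroup.inSeries {T : Type u} (X : ICGroup T) : InSeriesA X.toTwoValuedGroup ∨
    InSeriesU X.toTwoValuedGroup ∨ InSeriesY X.toTwoValuedGroup := by
  by_cases H : ∀ x, X.q (X.q x) = X.e
  swap
  · push Not at H
    obtain ⟨x₀, h₀⟩ := H
    exact Or.inl (inSeriesA_of_q_q_ne h₀)
  by_cases hq : ∀ x, X.q x = X.e
  · exact Or.inl (inSeriesA_of_q_eq hq)
  push Not at hq
  obtain ⟨x₀, h₀⟩ := hq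
  by_cases N : NonSpecial H
  · exact (inSeries_of_nonSpecial N fun h => h₀ (sqE_eq_one_iff.1 h)).imp_right Or.inl
  unfold NonSpecial at N
  push Not at N
  obtain ⟨x, y, hxy, ho⟩ := N
  have hx : sqE H x ≠ 1 := fun hx => by
    obtain ⟨g, rfl⟩ := exists_E_of_sqE hx
    obtain ⟨h, rfl⟩ := exists_E_of_sqE (hxy.symm.trans hx)
    refine ho (h * g) ?_
    rw [← smul_e, ← smul_e, smul_smul, mul_assoc, X.isBooleanGroup_E g, mul_one]
  exact Or.inr (Or.inr (inSeriesY_of_q_eq hx (sqE_eq_of_special hx hxy ho) rfl hxy.symm ho))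

section Disjoint

variable {T : Type u} {S : Type v} {X : TwoValuedGroup T} {Z : TwoValuedGroup S}

theorem Isomorphic.symm (h : Isomorphic X Z) : Isomorphic Z X := by
  obtain ⟨f, hf, h1, hm⟩ := h
  let F := Equiv.ofBijective f hf
  have hF : ∀ t, F.symm (f t) = t := F.symm_apply_apply
  refine ⟨F.symm, F.symm.bijective, by rw [← h1, hF], fun x y => ?_⟩
  obtain ⟨x, rfl⟩ := hf.2 x
  obtain ⟨y, rfl⟩ := hf.2 y
  rw [← hm, Multiset.map_map, hF, hF]
  simp [hF]

theorem IsHom.mem {f : T → S} (h : IsHom X Z f) {x y z : T} (hz : z ∈ X.mul x y) :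
    f z ∈ Z.mul (f x) (f y) := by
  rw [← h.2]; exact Multiset.mem_map_of_mem f hz

theorem IsHom.mem_iff {f : T → S} (h : IsHom X Z f) (hf : Function.Injective f) {x y z : T} :
    f z ∈ Z.mul (f x) (f y) ↔ z ∈ X.mul x y := by
  rw [← h.2]; exact Multiset.mem_map_of_injective hf

theorem IsHom.mul_pair {f : T → S} (h : IsHom X Z f) {x y z t : T} (hz : X.mul x y = {z, t}) :
    Z.mul (f x) (f y) = {f z, f t} := by
  rw [← h.2, hz]; simp

theorem IsHom.mul_pair_iff {f : T → S} (h : IsHom X Z f) (hf : Function.Injective f)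
    {x y z t : T} : Z.mul (f x) (f y) = {f z, f t} ↔ X.mul x y = {z, t} := by
  refine ⟨fun e => Multiset.map_injective hf ?_, h.mul_pair⟩
  rw [h.2, e]; simp

/-- There are two elements of order greater than two whose product is a repeated element. -/
def HasSpecialPair (X : TwoValuedGroup T) : Prop :=
  ∃ x y z, X.mul x x ≠ {X.e, X.e} ∧ X.mul y y ≠ {X.e, X.e} ∧ X.mul x y = {z, z}

/-- There are three elements of order four with independent squares, generating a Fano
configuration. -/
def HasFano (X : TwoValuedGroup T) : Prop :=
  ∃ x₁ x₂ x₃ q₁ q₂ q₃ z₁₂ z₁₃ z₂₃ u,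
    (X.mul x₁ x₁ = {X.e, q₁} ∧ X.mul x₂ x₂ = {X.e, q₂} ∧ X.mul x₃ x₃ = {X.e, q₃}) ∧
    (X.mul q₁ q₁ = {X.e, X.e} ∧ X.mul q₂ q₂ = {X.e, X.e} ∧ X.mul q₃ q₃ = {X.e, X.e}) ∧
    (q₁ ≠ X.e ∧ q₂ ≠ X.e ∧ q₃ ≠ X.e) ∧ (q₁ ≠ q₂ ∧ q₁ ≠ q₃ ∧ q₂ ≠ q₃ ∧ q₃ ∉ X.mul q₁ q₂) ∧
    (z₁₂ ∈ X.mul x₁ x₂ ∧ z₁₃ ∈ X.mul x₁ x₃ ∧ z₂₃ ∈ X.mul x₂ x₃) ∧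
    z₂₃ ∈ X.mul z₁₂ z₁₃ ∧ u ∈ X.mul z₁₂ x₃ ∧ u ∈ X.mul z₁₃ x₂ ∧ u ∈ X.mul z₂₃ x₁

theorem HasSpecialPair.of_isomorphic (h : Isomorphic X Z) (hX : HasSpecialPair X) :
    HasSpecialPair Z := by
  obtain ⟨f, hf, h⟩ := h
  obtain ⟨x, y, z, hx, hy, hz⟩ := hX
  refine ⟨f x, f y, f z, ?_, ?_, h.mul_pair hz⟩
  · rwa [← h.1, Ne, h.mul_pair_iff hf.1]
  · rwa [← h.1, Ne, h.mul_pair_iff hf.1]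

theorem HasFano.of_isomorphic (h : Isomorphic X Z) (hX : HasFano X) : HasFano Z := by
  obtain ⟨f, hf, h⟩ := h
  obtain ⟨x₁, x₂, x₃, q₁, q₂, q₃, z₁₂, z₁₃, z₂₃, u, hX⟩ := hX
  refine ⟨f x₁, f x₂, f x₃, f q₁, f q₂, f q₃, f z₁₂, f z₁₃, f z₂₃, f u, ?_⟩
  simpa only [← h.1, h.mul_pair_iff hf.1, h.mem_iff hf.1, hf.1.ne_iff] using hX

theorem InSeriesY.hasSpecialPair (h : InSeriesY X) : HasSpecialPair X := by
  obtain ⟨V, W, _, _, hV, hW, ⟨a, b, ha, hb, hab⟩, f, hf, h1, hm, -⟩ := h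
  have key : ∀ a : V, a ≠ 1 → X.mul (f (some a, 1)) (f (some a, 1)) ≠ {X.e, X.e} := by
    intro a ha e
    rw [hm, ← h1] at e
    have e' := congrArg (fun M => f (none, 1) ∈ M) e
    simp [mulY, ha, hf.1.eq_iff] at e'
  exact ⟨f (some a, 1), f (some b, 1), f (some (a * b), 1), key a ha, key b hb, by
    rw [hm]; simp [mulY, hab]⟩

theorem InSeriesA.not_hasSpecialPair (h : InSeriesA X) : ¬ HasSpecialPair X := by
  obtain ⟨A, _, π, hs, h1, hi, hf, hm, -⟩ := h
  rintro ⟨x, y, z, hx, hy, hz⟩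
  obtain ⟨a, rfl⟩ := hs x
  obtain ⟨b, rfl⟩ := hs y
  have key : ∀ a, X.mul (π a) (π a) ≠ {X.e, X.e} → a * a ≠ 1 := fun a h e => h (by
    rw [hm, e, mul_inv_cancel, h1])
  rw [hm] at hz
  have e : π (a * b) = π (a * b⁻¹) := by
    have e1 : π (a * b) ∈ ({z, z} : Multiset T) := by rw [← hz]; simp
    have e2 : π (a * b⁻¹) ∈ ({z, z} : Multiset T) := by rw [← hz]; simp
    simp at e1 e2
    rw [e1, e2]
  rcases hf _ _ e with e | e
  · exact key b hy (by rw [mul_eq_one_iff_eq_inv]; exact (mul_left_cancel e).symm)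
  · rw [mul_inv] at e
    exact key a hx (by rw [mul_eq_one_iff_eq_inv]; exact mul_right_cancel e)

theorem InSeriesU.not_hasSpecialPair (h : InSeriesU X) : ¬ HasSpecialPair X := by
  obtain ⟨V, W, _, _, hV, hW, -, f, hs, h1, -, hf, hm, -⟩ := h
  rintro ⟨x, y, z, hx, hy, hz⟩
  obtain ⟨⟨⟨a, b⟩, w⟩, rfl⟩ := hs x
  obtain ⟨⟨⟨c, d⟩, w'⟩, rfl⟩ := hs y
  have sq : ∀ v : V, v * v = 1 := hV
  have sqW : ∀ v : W, v * v = 1 := hW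
  have key : ∀ a b w, X.mul (f ((a, b), w)) (f ((a, b), w)) ≠ {X.e, X.e} → a ≠ 1 := by
    rintro a b w h rfl
    exact h (by rw [hm, one_mul, mul_assoc, sq, sqW, one_mul, h1])
  rw [hm] at hz
  have e : f ((a * c, b * d), w * w') = f ((a * c, c * b * d), w * w') := by
    have e1 : f ((a * c, b * d), w * w') ∈ ({z, z} : Multiset T) := by rw [← hz]; simp
    have e2 : f ((a * c, c * b * d), w * w') ∈ ({z, z} : Multiset T) := by rw [← hz]; simp
    simp at e1 e2
    rw [e1, e2]
  rcases (hf _ _ e).2 with e | e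
  · refine key c d w' hy ?_
    simpa [mul_assoc] using e
  · refine key a b w hx ?_
    have e := (Prod.ext_iff.1 e).2
    simpa [mul_assoc] using e

theorem InSeriesU.hasFano (h : InSeriesU X) : HasFano X := by
  obtain ⟨V, W, _, _, hV, hW, ⟨a, b, c, ha, hb, hab, hc, hca, hcb, hcab⟩, f, hs, h1, -, hf, hm,
    -⟩ := h
  have sq : ∀ v : V, v * v = 1 := hV
  have inj : ∀ a b : V, f ((1, a), 1) = f ((1, b), 1) → b = a := fun a b e => by
    simpa using (hf _ _ e).2
  refine ⟨f ((a, 1), 1), f ((b, 1), 1), f ((c, 1), 1), f ((1, a), 1), f ((1, b), 1),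
    f ((1, c), 1), f ((a * b, 1), 1), f ((a * c, 1), 1), f ((b * c, 1), 1),
    f ((a * b * c, 1), 1), ?_, ?_, ?_, ?_, ?_, ?_, ?_, ?_, ?_⟩
  · simp [hm, sq, h1]
  · simp [hm, sq, h1]
  · rw [← h1]
    exact ⟨fun e => ha (inj _ _ e).symm, fun e => hb (inj _ _ e).symm, fun e => hc (inj _ _ e).symm⟩
  · refine ⟨fun e => hab (inj _ _ e).symm, fun e => hca (inj _ _ e), fun e => hcb (inj _ _ e),
      fun e => hcab ?_⟩
    rw [hm] at e
    simp at e
    exact (inj _ _ e).symm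
  · simp [hm]
  · have e : a * b * (a * c) = b * c := by
      rw [mul_mul_mul_comm, sq, one_mul]
    simp [hm, e]
  · simp [hm]
  · have e : a * c * b = a * b * c := mul_right_comm _ _ _
    simp [hm, e]
  · have e : b * c * a = a * b * c := by rw [mul_comm, mul_assoc]
    simp [hm, e]

end Disjoint

section Fano

variable {T : Type u} {X : TwoValuedGroup T}

theorem not_hasFano_of_add {A : Type v} [AddCommGroup A] {π : A → T}
    (hs : Function.Surjective π) (h0 : π 0 = X.e) (hi : ∀ a, π (-a) = π a)
    (hf : ∀ a b, π a = π b → b = a ∨ b = -a)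
    (hm : ∀ a b, X.mul (π a) (π b) = {π (a + b), π (a - b)}) : ¬ HasFano X := by
  rintro ⟨x₁, x₂, x₃, q₁, q₂, q₃, z₁₂, z₁₃, z₂₃, u, ⟨s₁, s₂, s₃⟩, ⟨t₁, t₂, t₃⟩, ⟨o₁, o₂, o₃⟩,
    ⟨n₁₂, n₁₃, n₂₃, n⟩, ⟨m₁₂, m₁₃, m₂₃⟩, l₀, l₃, l₂, l₁⟩
  have mem : ∀ a b z, z ∈ X.mul (π a) (π b) ↔ z = π (a + b) ∨ z = π (a - b) := fun a b z => by
    rw [hm]; simp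
  have pair : ∀ x y z : T, ({x, y} : Multiset T) = {y, z} → x = z := fun x y z e => by
    rw [Multiset.pair_comm] at e
    simpa using e
  have square : ∀ a q, X.mul (π a) (π a) = {X.e, q} → π (a + a) = q := fun a q h => by
    rw [hm, sub_self, h0] at h
    exact pair _ _ _ h
  have ker : ∀ a, π a = X.e → a = 0 := fun a h => by
    rcases hf 0 a (by rw [h0, h]) with e | e <;> simpa using e
  have order : ∀ a, X.mul (π (a + a)) (π (a + a)) = {X.e, X.e} → a + a + (a + a) = 0 := fun a h =>
    ker _ (square _ _ h)
  obtain ⟨a, rfl⟩ := hs x₁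
  obtain ⟨b, rfl, rfl⟩ : ∃ b, π b = x₂ ∧ z₁₂ = π (a + b) := by
    obtain ⟨b, rfl⟩ := hs x₂
    rcases (mem _ _ _).1 m₁₂ with e | e
    · exact ⟨b, rfl, e⟩
    · exact ⟨-b, hi b, by rw [e, sub_eq_add_neg]⟩
  obtain ⟨c, rfl, rfl⟩ : ∃ c, π c = x₃ ∧ z₁₃ = π (a + c) := by
    obtain ⟨c, rfl⟩ := hs x₃
    rcases (mem _ _ _).1 m₁₃ with e | e
    · exact ⟨c, rfl, e⟩
    · exact ⟨-c, hi c, by rw [e, sub_eq_add_neg]⟩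
  obtain rfl := square a q₁ s₁
  obtain rfl := square b q₂ s₂
  obtain rfl := square c q₃ s₃
  have ra := order a t₁
  have rb := order b t₂
  have rc := order c t₃
  have ha : a + a ≠ 0 := fun e => o₁ (by rw [e, h0])
  have hb : b + b ≠ 0 := fun e => o₂ (by rw [e, h0])
  have hc : c + c ≠ 0 := fun e => o₃ (by rw [e, h0])
  have hab : a + a ≠ b + b := fun e => n₁₂ (by rw [e])
  have hac : a + a ≠ c + c := fun e => n₁₃ (by rw [e])
  have hbc : b + b ≠ c + c := fun e => n₂₃ (by rw [e])
  have habc : c + c ≠ a + a + (b + b) := fun e => n (by rw [mem, e]; exact Or.inl rfl)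
  rcases (mem _ _ _).1 m₂₃ with rfl | rfl
  · rcases (mem _ _ _).1 l₀ with e | e
    · rcases hf _ _ e with e | e
      · exact ha (by linear_combination (norm := abel) e)
      · exact habc (by linear_combination (norm := abel) rc - e)
    · rcases hf _ _ e with e | e
      · exact hc (by linear_combination (norm := abel) - e)
      · exact hb (by linear_combination (norm := abel) e)
  · rcases (mem _ _ _).1 l₃ with rfl | rfl
    · rcases (mem _ _ _).1 l₁ with e | e
      · rcases hf _ _ e with e | e
        · exact hc (by linear_combination (norm := abel) - e)
        · exact hab (by linear_combination (norm := abel) e - rb)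
      · rcases hf _ _ e with e | e
        · exact hac (by linear_combination (norm := abel) - e - rc)
        · exact hb (by linear_combination (norm := abel) e)
    · rcases (mem _ _ _).1 l₂ with e | e
      · rcases hf _ _ e with e | e
        · exact hc (by linear_combination (norm := abel) e)
        · exact hab (by linear_combination (norm := abel) e - rb)
      · rcases hf _ _ e with e | e
        · exact hbc (by linear_combination (norm := abel) - e)
        · exact ha (by linear_combination (norm := abel) e)

theorem InSeriesA.not_hasFano (h : InSeriesA X) : ¬ HasFano X := by
  obtain ⟨A, _, π, hs, h1, hi, hf, hm, -⟩ := h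
  exact not_hasFano_of_add (A := Additive A) (π := fun a => π a.toMul) hs h1 hi hf
    fun a b => (hm _ _).trans (by rw [sub_eq_add_neg]; rfl)

end Fano

section Criterion

variable {S₁ : Type v} {S₂ : Type w} {Y₁ : TwoValuedGroup S₁} {Y₂ : TwoValuedGroup S₂}

theorem exists_mem_mul {S : Type u} (Y : TwoValuedGroup S) (x y : S) : ∃ z, z ∈ Y.mul x y :=
  Multiset.card_pos_iff_exists_mem.1 (by rw [Y.card_mul]; norm_num)

/-- An isomorphism of two-valued groups compatible with two projections to Boolean groups induces
an isomorphism of these Boolean groups. -/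
theorem groupIsomorphic_of_isHom {V₁ : Type v} {V₂ : Type w} [CommGroup V₁] [CommGroup V₂]
    (hV₁ : IsBooleanGroup V₁) (hV₂ : IsBooleanGroup V₂) {f : S₁ → S₂}
    (hf : Function.Surjective f) (h : IsHom Y₁ Y₂ f) {p₁ : S₁ → V₁} {p₂ : S₂ → V₂}
    (hp₁ : ∀ x y, ∀ z ∈ Y₁.mul x y, p₁ z = p₁ x * p₁ y)
    (hp₂ : ∀ x y, ∀ z ∈ Y₂.mul x y, p₂ z = p₂ x * p₂ y)
    {D₁ : Set S₁} {D₂ : Set S₂} (hD : ∀ x, f x ∈ D₂ ↔ x ∈ D₁)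
    (hDm : ∀ x ∈ D₁, ∀ y ∈ D₁, ∀ z ∈ Y₁.mul x y, z ∈ D₁)
    (hs₁ : ∀ v, ∃ x ∈ D₁, p₁ x = v) (hs₂ : ∀ v, ∃ x ∈ D₂, p₂ x = v)
    (hk : ∀ x ∈ D₁, p₁ x = 1 ↔ p₂ (f x) = 1) : GroupIsomorphic V₁ V₂ := by
  have key : ∀ x ∈ D₁, ∀ y ∈ D₁, p₁ x = p₁ y ↔ p₂ (f x) = p₂ (f y) := fun x hx y hy => by
    obtain ⟨z, hz⟩ := Y₁.exists_mem_mul x y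
    have h1 := hk z (hDm x hx y hy z hz)
    rw [hp₁ x y z hz, hp₂ _ _ _ (h.mem hz), mul_eq_one_iff_eq_inv, mul_eq_one_iff_eq_inv,
      inv_eq_of_mul_eq_one_right (hV₁ _), inv_eq_of_mul_eq_one_right (hV₂ _)] at h1
    exact h1
  choose s hsD hsp using hs₁
  let φ : V₁ →* V₂ := MonoidHom.mk' (fun v => p₂ (f (s v))) fun v w => by
    obtain ⟨z, hz⟩ := Y₁.exists_mem_mul (s v) (s w)
    rw [← hp₂ _ _ _ (h.mem hz), ← key _ (hsD _) _ (hDm _ (hsD _) _ (hsD _) _ hz), hsp,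
      hp₁ _ _ _ hz, hsp, hsp]
  refine ⟨MulEquiv.ofBijective φ ⟨fun v w e => ?_, fun v => ?_⟩⟩
  · rw [← hsp v, ← hsp w, key _ (hsD _) _ (hsD _)]
    exact e
  · obtain ⟨x, hx, rfl⟩ := hs₂ v
    obtain ⟨x, rfl⟩ := hf x
    exact ⟨p₁ x, (key _ (hsD _) _ ((hD x).1 hx)).1 (hsp _)⟩

/-- Projections to `V` and to `W` shared by `X^u_V × W` and `Y_V × W`. -/
def HasProjections {S : Type v} (Y : TwoValuedGroup S) (V W : Type v) [CommGroup V]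
    [CommGroup W] : Prop :=
  ∃ (p : S → V) (r : S → W), (∀ x y, ∀ z ∈ Y.mul x y, p z = p x * p y) ∧
    (∀ x y, ∀ z ∈ Y.mul x y, r z = r x * r y) ∧ Function.Surjective p ∧
    (∀ x, p x = 1 ↔ Y.mul x x = {Y.e, Y.e}) ∧ (∀ w, ∃ x, p x = 1 ∧ r x = w) ∧
    ∀ x, p x = 1 → r x = 1 → ∃ t, Y.mul t t = {Y.e, x}

theorem HasProjections.groupIsomorphic {V₁ W₁ : Type v} {V₂ W₂ : Type w} [CommGroup V₁]
    [CommGroup W₁] [CommGroup V₂] [CommGroup W₂] (hV₁ : IsBooleanGroup V₁)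
    (hW₁ : IsBooleanGroup W₁) (hV₂ : IsBooleanGroup V₂) (hW₂ : IsBooleanGroup W₂)
    (h₁ : HasProjections Y₁ V₁ W₁) (h₂ : HasProjections Y₂ V₂ W₂) (h : Isomorphic Y₁ Y₂) :
    GroupIsomorphic V₁ V₂ ∧ GroupIsomorphic W₁ W₂ := by
  obtain ⟨f, hf, h⟩ := h
  obtain ⟨p₁, r₁, hp₁, hr₁, hps₁, hpk₁, hrs₁, hrk₁⟩ := h₁
  obtain ⟨p₂, r₂, hp₂, hr₂, hps₂, hpk₂, hrs₂, hrk₂⟩ := h₂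
  have hp : ∀ x, p₂ (f x) = 1 ↔ p₁ x = 1 := fun x => by
    rw [hpk₁, hpk₂, ← h.1, h.mul_pair_iff hf.1]
  refine ⟨groupIsomorphic_of_isHom hV₁ hV₂ hf.2 h hp₁ hp₂ (D₁ := Set.univ) (D₂ := Set.univ)
    (by simp) (by simp) (fun v => ?_) (fun v => ?_) (fun x _ => (hp x).symm),
    groupIsomorphic_of_isHom hW₁ hW₂ hf.2 h hr₁ hr₂ (D₁ := {x | p₁ x = 1})
      (D₂ := {x | p₂ x = 1}) hp (fun x hx y hy z hz => ?_) hrs₁ hrs₂ fun x hx => ⟨fun e => ?_,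
      fun e => ?_⟩⟩
  · obtain ⟨x, rfl⟩ := hps₁ v
    exact ⟨x, trivial, rfl⟩
  · obtain ⟨x, rfl⟩ := hps₂ v
    exact ⟨x, trivial, rfl⟩
  · change p₁ x = 1 at hx
    change p₁ y = 1 at hy
    change p₁ z = 1
    rw [hp₁ _ _ _ hz, hx, hy, one_mul]
  · obtain ⟨t, ht⟩ := hrk₁ x hx e
    rw [hr₂ (f t) (f t) (f x) (by rw [h.mul_pair ht]; simp), hW₂]
  · obtain ⟨t, ht⟩ := hrk₂ _ ((hp x).2 hx) e
    obtain ⟨t, rfl⟩ := hf.2 t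
    rw [← h.1, h.mul_pair_iff hf.1] at ht
    rw [hr₁ t t x (by rw [ht]; simp), hW₁]

theorem IsUnipotentCosetProdOf.hasProjections {V W : Type v} [CommGroup V] [CommGroup W]
    (hV : IsBooleanGroup V) (hW : IsBooleanGroup W) (h : IsUnipotentCosetProdOf Y₁ V W) :
    HasProjections Y₁ V W := by
  obtain ⟨f, hs, h1, -, hf, hm, -⟩ := h
  have sqV : ∀ v : V, v * v = 1 := hV
  have sqW : ∀ v : W, v * v = 1 := hW
  choose g hg using hs
  have hgp : ∀ q, (g (f q)).1.1 = q.1.1 := fun q => by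
    rcases (hf _ _ (hg (f q))).2 with e | e <;> rw [e]
  have hgr : ∀ q, (g (f q)).2 = q.2 := fun q => (hf _ _ (hg (f q))).1.symm
  have forall_f : ∀ {P : S₁ → Prop}, (∀ a b w, P (f ((a, b), w))) → ∀ x, P x := fun hP x => by
    rw [← hg x]; exact hP _ _ _
  refine ⟨fun x => (g x).1.1, fun x => (g x).2, forall_f fun a b w => forall_f fun c d w' => ?_,
    forall_f fun a b w => forall_f fun c d w' => ?_, fun v => ⟨f ((v, 1), 1), hgp _⟩,
    forall_f fun a b w => ?_, fun w => ⟨f ((1, 1), w), hgp _, hgr _⟩, forall_f fun a b w => ?_⟩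
  · rw [hm]
    simp [hgp]
  · rw [hm]
    simp [hgr]
  · beta_reduce
    rw [hm, hgp, mul_assoc, sqV, sqV, sqW, h1, mul_one]
    constructor
    · rintro (rfl : a = 1)
      rw [h1]
    · intro e
      have e : f ((1, a), 1) = f ((1, 1), 1) := by rw [h1]; simpa using e
      exact Eq.symm (by simpa using (hf _ _ e).2)
  · beta_reduce
    rw [hgp, hgr]
    rintro (rfl : a = 1) (rfl : w = 1)
    exact ⟨f ((b, 1), 1), by rw [hm, sqV, sqW, mul_one, mul_one, mul_one, h1]⟩

theorem IsYProdOf.hasProjections {V W : Type v} [CommGroup V] [CommGroup W]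
    (hV : IsBooleanGroup V) (hW : IsBooleanGroup W) (hd : ∃ a : V, a ≠ 1)
    (h : IsYProdOf Y₁ V W) : HasProjections Y₁ V W := by
  obtain ⟨f, hf, h1, hm, -⟩ := h
  have sqV : ∀ v : V, v * v = 1 := hV
  have sqW : ∀ v : W, v * v = 1 := hW
  let g := (Equiv.ofBijective f hf).symm
  have hg : ∀ q, g (f q) = q := (Equiv.ofBijective f hf).symm_apply_apply
  have forall_f : ∀ {P : S₁ → Prop}, (∀ a w, P (f (a, w))) → ∀ x, P x := fun hP x => by
    obtain ⟨q, rfl⟩ := hf.2 x; exact hP _ _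
  refine ⟨fun x => (g x).1.getD 1, fun x => (g x).2,
    forall_f fun a w => forall_f fun c w' z hz => ?_,
    forall_f fun a w => forall_f fun c w' z hz => ?_, fun v => ⟨f (some v, 1), by simp [hg]⟩,
    forall_f fun a w => ?_, fun w => ⟨f (some 1, w), by simp [hg]⟩, forall_f fun a w => ?_⟩
  · rw [hm, Multiset.mem_map] at hz
    obtain ⟨t, ht, rfl⟩ := hz
    simp only [hg]
    rcases a with _ | a <;> rcases c with _ | c <;> simp only [mulY] at ht <;>
      (try split_ifs at ht) <;> simp_all
    rcases ht with rfl | rfl <;> rfl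
  · rw [hm, Multiset.mem_map] at hz
    obtain ⟨t, ht, rfl⟩ := hz
    simp only [hg]
  · beta_reduce
    rw [hm, hg, sqW]
    rcases a with _ | a
    · simp [mulY, h1]
    · by_cases ha : a = 1
      · simp [mulY, h1, ha]
      · simp [mulY, h1, ha]
        rw [← h1, hf.1.eq_iff]
        simp
  · beta_reduce
    rw [hg]
    rcases a with _ | a
    · rintro - (rfl : w = 1)
      obtain ⟨a, ha⟩ := hd
      exact ⟨f (some a, 1), by rw [hm]; simp [mulY, ha, h1]⟩
    · rintro (rfl : a = 1) (rfl : w = 1)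
      exact ⟨f (some 1, 1), by rw [hm]; simp [mulY, h1]⟩

theorem IsUnipotentCosetProdOf.isomorphic {V₁ W₁ : Type v} {V₂ W₂ : Type w} [CommGroup V₁]
    [CommGroup W₁] [CommGroup V₂] [CommGroup W₂] (h₁ : IsUnipotentCosetProdOf Y₁ V₁ W₁)
    (h₂ : IsUnipotentCosetProdOf Y₂ V₂ W₂) (hV : GroupIsomorphic V₁ V₂)
    (hW : GroupIsomorphic W₁ W₂) : Isomorphic Y₁ Y₂ := by
  obtain ⟨f₁, hs₁, e₁, hi₁, hf₁, hm₁, -⟩ := h₁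
  obtain ⟨f₂, hs₂, e₂, hi₂, hf₂, hm₂, -⟩ := h₂
  obtain ⟨φ⟩ := hV
  obtain ⟨ψ⟩ := hW
  choose g hg using hs₁
  let F : S₁ → S₂ := fun x => f₂ ((φ (g x).1.1, φ (g x).1.2), ψ (g x).2)
  have hF : ∀ a b w, F (f₁ ((a, b), w)) = f₂ ((φ a, φ b), ψ w) := fun a b w => by
    have h := hf₁ _ _ (hg (f₁ ((a, b), w)))
    simp only [F]
    generalize g (f₁ ((a, b), w)) = q at h ⊢
    obtain ⟨⟨c, d⟩, t⟩ := q
    simp only [Prod.mk.injEq] at h ⊢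
    obtain ⟨rfl, ⟨rfl, rfl⟩ | ⟨rfl, rfl⟩⟩ := h
    · rfl
    · simp only [map_mul, hi₂]
  have forall_f : ∀ {P : S₁ → Prop}, (∀ a b w, P (f₁ ((a, b), w))) → ∀ x, P x := fun hP x => by
    rw [← hg x]; exact hP _ _ _
  refine ⟨F, ⟨?_, fun y => ?_⟩, ?_, ?_⟩
  · refine forall_f fun a b w => forall_f fun c d w' e => ?_
    rw [hF, hF] at e
    have h := hf₂ _ _ e
    simp only [Prod.mk.injEq, ← map_mul, EmbeddingLike.apply_eq_iff_eq] at h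
    obtain ⟨rfl, ⟨rfl, rfl⟩ | ⟨rfl, rfl⟩⟩ := h
    · rfl
    · exact (hi₁ _ _ _).symm
  · obtain ⟨⟨⟨a, b⟩, w⟩, rfl⟩ := hs₂ y
    exact ⟨f₁ ((φ.symm a, φ.symm b), ψ.symm w), by simp [hF]⟩
  · rw [← e₁, hF]; simp [e₂]
  · refine forall_f fun a b w => forall_f fun c d w' => ?_
    simp [hm₁, hm₂, hF]

theorem mulY_map {V₁ : Type v} {V₂ : Type w} [CommGroup V₁] [CommGroup V₂] (φ : V₁ ≃* V₂)
    (x y : Option V₁) :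
    mulY (x.map φ) (y.map φ) = (mulY x y).map (Option.map φ) := by
  rcases x with _ | x <;> rcases y with _ | y <;> simp only [mulY, Option.map] <;>
    (try split_ifs) <;> simp_all

theorem IsYProdOf.isomorphic {V₁ W₁ : Type v} {V₂ W₂ : Type w} [CommGroup V₁]
    [CommGroup W₁] [CommGroup V₂] [CommGroup W₂] (h₁ : IsYProdOf Y₁ V₁ W₁)
    (h₂ : IsYProdOf Y₂ V₂ W₂) (hV : GroupIsomorphic V₁ V₂)
    (hW : GroupIsomorphic W₁ W₂) : Isomorphic Y₁ Y₂ := by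
  obtain ⟨f₁, hf₁, e₁, hm₁, -⟩ := h₁
  obtain ⟨f₂, hf₂, e₂, hm₂, -⟩ := h₂
  obtain ⟨φ⟩ := hV
  obtain ⟨ψ⟩ := hW
  let F : S₁ ≃ S₂ := (Equiv.ofBijective f₁ hf₁).symm.trans
    (((Equiv.optionCongr φ.toEquiv).prodCongr ψ.toEquiv).trans (Equiv.ofBijective f₂ hf₂))
  have hF : ∀ a w, F (f₁ (a, w)) = f₂ (a.map φ, ψ w) := fun a w => by
    have : (Equiv.ofBijective f₁ hf₁).symm (f₁ (a, w)) = (a, w) :=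
      (Equiv.ofBijective f₁ hf₁).symm_apply_apply _
    simp only [F, Equiv.trans_apply, this]
    rfl
  refine ⟨F, F.bijective, ?_, fun x y => ?_⟩
  · rw [← e₁, hF]; simp [e₂]
  · obtain ⟨⟨a, w⟩, rfl⟩ := hf₁.2 x
    obtain ⟨⟨c, w'⟩, rfl⟩ := hf₁.2 y
    rw [hm₁, hF, hF, hm₂, mulY_map, Multiset.map_map, Multiset.map_map]
    simp only [Function.comp_def, hF, map_mul]

end Criterion

/-- **Theorem 12.1 (theorem_non_fg).** Every involutive commutative two-valued group is
isomorphic to `X^a_A` (`A` abelian), or to `X^u_V × W` (`V`, `W` Boolean, `dim V ≥ 3`),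
or to `Y_V × W` (`V`, `W` Boolean, `dim V ≥ 2`). Two-valued groups from different series
are never isomorphic; within the unipotent (resp. special) series, two two-valued groups
are isomorphic iff the corresponding Boolean groups `V` are isomorphic and the
corresponding Boolean groups `W` are isomorphic. -/
theorem classification_general {T : Type u} (X : TwoValuedGroup T)
    (hc : X.Commutative) (hinv : X.Involutive) :
    (InSeriesA X ∨ InSeriesU X ∨ InSeriesY X) ∧
    -- two-valued groups from different series are never isomorphic
    (∀ (S₁ : Type v) (S₂ : Type w) (Y₁ : TwoValuedGroup S₁) (Y₂ : TwoValuedGroup S₂),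
      Isomorphic Y₁ Y₂ →
        ¬ (InSeriesA Y₁ ∧ InSeriesU Y₂) ∧ ¬ (InSeriesU Y₁ ∧ InSeriesA Y₂) ∧
        ¬ (InSeriesA Y₁ ∧ InSeriesY Y₂) ∧ ¬ (InSeriesY Y₁ ∧ InSeriesA Y₂) ∧
        ¬ (InSeriesU Y₁ ∧ InSeriesY Y₂) ∧ ¬ (InSeriesY Y₁ ∧ InSeriesU Y₂)) ∧
    -- the isomorphism criterion within the unipotent series
    (∀ (S₁ : Type v) (S₂ : Type w) (Y₁ : TwoValuedGroup S₁) (Y₂ : TwoValuedGroup S₂)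
      (V₁ W₁ : Type v) (V₂ W₂ : Type w)
      (iV₁ : CommGroup V₁) (iW₁ : CommGroup W₁) (iV₂ : CommGroup V₂) (iW₂ : CommGroup W₂),
      @IsBooleanGroup V₁ iV₁ → @IsBooleanGroup W₁ iW₁ → @BoolDimGE3 V₁ iV₁ →
      @IsUnipotentCosetProdOf S₁ Y₁ V₁ W₁ iV₁ iW₁ →
      @IsBooleanGroup V₂ iV₂ → @IsBooleanGroup W₂ iW₂ → @BoolDimGE3 V₂ iV₂ →
      @IsUnipotentCosetProdOf S₂ Y₂ V₂ W₂ iV₂ iW₂ →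
      (Isomorphic Y₁ Y₂ ↔
        @GroupIsomorphic V₁ V₂ iV₁ iV₂ ∧ @GroupIsomorphic W₁ W₂ iW₁ iW₂)) ∧
    -- the isomorphism criterion within the special series
    (∀ (S₁ : Type v) (S₂ : Type w) (Y₁ : TwoValuedGroup S₁) (Y₂ : TwoValuedGroup S₂)
      (V₁ W₁ : Type v) (V₂ W₂ : Type w)
      (iV₁ : CommGroup V₁) (iW₁ : CommGroup W₁) (iV₂ : CommGroup V₂) (iW₂ : CommGroup W₂),
      @IsBooleanGroup V₁ iV₁ → @IsBooleanGroup W₁ iW₁ → @BoolDimGE2 V₁ iV₁ →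
      @IsYProdOf S₁ Y₁ V₁ W₁ iV₁ iW₁ →
      @IsBooleanGroup V₂ iV₂ → @IsBooleanGroup W₂ iW₂ → @BoolDimGE2 V₂ iV₂ →
      @IsYProdOf S₂ Y₂ V₂ W₂ iV₂ iW₂ →
      (Isomorphic Y₁ Y₂ ↔
        @GroupIsomorphic V₁ V₂ iV₁ iV₂ ∧ @GroupIsomorphic W₁ W₂ iW₁ iW₂)) := by
  refine ⟨ICGroup.inSeries ⟨X, hc, hinv⟩, ?_, ?_, ?_⟩
  · intro S₁ S₂ Y₁ Y₂ h
    exact ⟨fun ⟨h₁, h₂⟩ => h₁.not_hasFano (h₂.hasFano.of_isomorphic h.symm),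
      fun ⟨h₁, h₂⟩ => h₂.not_hasFano (h₁.hasFano.of_isomorphic h),
      fun ⟨h₁, h₂⟩ => h₁.not_hasSpecialPair (h₂.hasSpecialPair.of_isomorphic h.symm),
      fun ⟨h₁, h₂⟩ => h₂.not_hasSpecialPair (h₁.hasSpecialPair.of_isomorphic h),
      fun ⟨h₁, h₂⟩ => h₁.not_hasSpecialPair (h₂.hasSpecialPair.of_isomorphic h.symm),
      fun ⟨h₁, h₂⟩ => h₂.not_hasSpecialPair (h₁.hasSpecialPair.of_isomorphic h)⟩
  · intro S₁ S₂ Y₁ Y₂ V₁ W₁ V₂ W₂ _ _ _ _ hV₁ hW₁ _ h₁ hV₂ hW₂ _ h₂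
    exact ⟨(h₁.hasProjections hV₁ hW₁).groupIsomorphic hV₁ hW₁ hV₂ hW₂
      (h₂.hasProjections hV₂ hW₂), fun h => h₁.isomorphic h₂ h.1 h.2⟩
  · rintro S₁ S₂ Y₁ Y₂ V₁ W₁ V₂ W₂ _ _ _ _ hV₁ hW₁ ⟨a₁, -, ha₁, -⟩ h₁ hV₂ hW₂ ⟨a₂, -, ha₂, -⟩ h₂
    exact ⟨(h₁.hasProjections hV₁ hW₁ ⟨a₁, ha₁⟩).groupIsomorphic hV₁ hW₁ hV₂ hW₂
      (h₂.hasProjections hV₂ hW₂ ⟨a₂, ha₂⟩), fun h => h₁.isomorphic h₂ h.1 h.2⟩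

end TwoValuedGroup
end

section
/- Let X be a special involutive commutative two-valued group. Then X is not coset, that is, X is not isomorphic to any two-valued group of the form G/ι, where G is a (not necessarily commutative) group and ι is an automorphism of G with ι² = id. -/
/-!
Two-valued groups after V.M. Buchstaber, A.P. Veselov and A.A. Gaifullin.

`X.mul x y` is the two-element multiset `x * y`.
-/

universe u v w u' v' w'

namespace TwoValuedGroup

/-- An element of order greater than two does not square to the doubled identity. -/
theorem OrdGT2.mul_self_ne {T : Type u} {X : TwoValuedGroup T} {P : T → ℤ → T}
    (hP : X.IsPowFamily P) {x : T} (hx : X.OrdGT2 P x) : X.mul x x ≠ {X.e, X.e} := by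
  intro h
  obtain ⟨h0, h1, -, hmul⟩ := hP x
  have hsq := hmul 1 le_rfl
  rw [h1, h, sub_self, h0] at hsq
  have hP2 : X.e = P x (1 + 1) := by
    simpa [Multiset.insert_eq_cons, Multiset.cons_inj_right] using hsq
  have hmem : 2 ∈ {n : ℕ | 0 < n ∧ P x (n : ℤ) = X.e} := ⟨two_pos, hP2.symm⟩
  have hpos := (Nat.sInf_mem ⟨2, hmem⟩).1
  have hle := Nat.sInf_le hmem
  unfold OrdGT2 ordOf at hx
  omega

/-- **Proposition 4.3 (propos_no_coset).** A special involutive commutative two-valued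
group is not a coset two-valued group: it is not isomorphic to any `G/ι` where `G` is a
(not necessarily commutative) group and `ι` is an automorphism of `G` with `ι² = id`. -/
theorem special_not_coset {T : Type u} (X : TwoValuedGroup T)
    (hc : X.Commutative) (hinv : X.Involutive)
    (P : T → ℤ → T) (hP : X.IsPowFamily P)
    (hs : X.IsSpecial P) :
    ∀ (G : Type v) (iG : Group G) (ι : G → G),
      @IsInvolutiveAut G iG ι → ¬ @IsCosetOf T G iG X ι := by
  obtain ⟨x, y, z, hx, hy, hz⟩ := hs
  rintro G iG ι ⟨-, hι, -⟩ ⟨π, hsurj, hone, -, hfib, hmul, hπinv⟩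
  -- Preimages of elements of order greater than two are moved by `ι`.
  have hmove : ∀ g, X.OrdGT2 P (π g) → ι g ≠ g := by
    intro g hg hfix
    have hginv : g⁻¹ = g := by
      have h := hfib g g⁻¹ (by rw [← hπinv, hinv])
      rwa [hfix, or_self] at h
    have hgg : g * g = 1 := mul_eq_one_iff_inv_eq.2 hginv
    exact hg.mul_self_ne hP (by rw [hmul, hfix, hgg, hone])
  obtain ⟨g, rfl⟩ := hsurj x
  obtain ⟨h, rfl⟩ := hsurj y
  rw [hmul] at hz
  have hmem : ∀ t ∈ ({π (g * h), π (g * ι h)} : Multiset T), t = z := by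
    simp [hz]
  have heq : π (g * h) = π (g * ι h) :=
    (hmem _ (by simp)).trans (hmem _ (by simp)).symm
  rcases hfib _ _ heq with hgh | hgh
  · exact hmove h hy (mul_left_cancel hgh)
  · rw [hι] at hgh
    exact hmove g hx (mul_right_cancel hgh).symm

end TwoValuedGroup
end
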